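/- arXiv:math/0005168 — 3 statements merged into one kernel-verified Lean document; each statement's English description precedes it below -/
import Mathlib

section
/- Let A be a von Neumann algebra acting on a complex Hilbert space H which is a factor (i.e., its center equals ℂ·I). If φ : E(A) → E(A) is a bijective affine map (i.e., φ(λA + (1−λ)B) = λφ(A) + (1−λ)φ(B) for all A, B ∈ E(A) and λ ∈ [0,1]), then there exists a map Φ : A → A which is either a *-automorphism or a *-antiautomorphism of A such that either φ(A) = Φ(A) for all A ∈ E(A), or φ(A) = Φ(I − A) for all A ∈ E(A). -/
theorem herstein_aux {R : Type*} [Ring R] [Module ℝ R]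
    (prime : ∀ x y : R, (∀ r, x * r * y = 0) → x = 0 ∨ y = 0)
    (p q : R) (h : ∀ r, p * r * q + q * r * p = 0) : p = 0 ∨ q = 0 := by
  have two : ∀ z : R, z + z = 0 → z = 0 := by
    intro z hz
    have : (2 : ℝ) • z = 0 := by rw [two_smul, hz]
    simpa using this
  have h' : ∀ r, p * r * q = - (q * r * p) := fun r => eq_neg_of_add_eq_zero_left (h r)
  apply prime
  intro r
  have key : ∀ s, (p * r * q) * s * (p * r * q) = 0 := by
    intro s
    apply two
    have e1 : (p * r * q) * s * (p * r * q) = p * r * (q * s * p) * r * q := by noncomm_ring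
    have e2 : q * s * p = - (p * s * q) := by rw [h' s, neg_neg]
    have e3 : p * r * (q * s * p) * r * q = - ((p * (r * p * s) * q) * r * q) := by
      rw [e2]; noncomm_ring
    have e4 : (p * (r * p * s) * q) * r * q = - (q * r * p * s * (p * r * q)) := by
      rw [h' (r * p * s)]; noncomm_ring
    have e5 : q * r * p = - (p * r * q) := by rw [h' r, neg_neg]
    have e6 : (p * r * q) * s * (p * r * q) = -((p * r * q) * s * (p * r * q)) := by
      nth_rewrite 1 [e1]
      rw [e3, e4, e5]; noncomm_ring
    exact eq_neg_iff_add_eq_zero.mp e6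
  rcases prime _ _ key with h | h <;> exact h

theorem add_cover {G : Type*} [AddGroup G] (S T : AddSubgroup G) (h : ∀ x, x ∈ S ∨ x ∈ T) :
    (∀ x, x ∈ S) ∨ (∀ x, x ∈ T) := by
  by_contra! hc
  obtain ⟨⟨x, hx⟩, ⟨y, hy⟩⟩ := hc
  have hxT := (h x).resolve_left hx
  have hyS := (h y).resolve_right hy
  rcases h (x + y) with h1 | h1
  · exact hx ((S.add_mem_cancel_right hyS).mp h1)
  · exact hy ((T.add_mem_cancel_left hxT).mp h1)

theorem herstein {R : Type*} [Ring R] [Module ℝ R]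
    (prime : ∀ x y : R, (∀ r, x * r * y = 0) → x = 0 ∨ y = 0)
    (f : R →+ R) (hf : Function.Surjective f) (hsq : ∀ x, f (x * x) = f x * f x) :
    (∀ x y, f (x * y) = f x * f y) ∨ (∀ x y, f (x * y) = f y * f x) := by
  have two : ∀ z w : R, z + z = w + w → z = w := by
    intro z w hz
    have : (2 : ℝ) • z = (2 : ℝ) • w := by rw [two_smul, two_smul, hz]
    simpa using this
  have hj : ∀ x y, f (x * y) + f (y * x) = f x * f y + f y * f x := by
    intro x y
    have := hsq (x + y)
    simp only [mul_add, add_mul, map_add, hsq] at this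
    have e : f (x * y) + f (y * x) = (f x * f x + f (y * x) + (f (x * y) + f y * f y)) - f x * f x - f y * f y := by abel
    rw [e, this]; abel
  have ht : ∀ a b, f (a * b * a) = f a * f b * f a := by
    intro a b
    apply two
    have e1 := hj a (a * b + b * a)
    have e2 := hj (a * a) b
    have e3 := hj a b
    rw [map_add, e3] at e1
    rw [hsq] at e2
    have e4 : f (a * (a * b + b * a)) + f ((a * b + b * a) * a)
      = f (a * b * a) + f (a * b * a) + (f (a * a * b) + f (b * (a * a))) := by
      simp only [mul_add, add_mul, map_add, mul_assoc]; abel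
    rw [e4, e2] at e1
    have : f (a * b * a) + f (a * b * a) = f a * (f a * f b + f b * f a) + (f a * f b + f b * f a) * f a - (f a * f a * f b + f b * (f a * f a)) := by
      rw [← e1]; abel
    rw [this]; noncomm_ring
  have htri : ∀ a b c, f (a * b * c) + f (c * b * a) = f a * f b * f c + f c * f b * f a := by
    intro a b c
    have e := ht (a + c) b
    simp only [mul_add, add_mul, map_add, ht] at e
    have : f (a * b * c) + f (c * b * a) = (f a * f b * f a + f (c * b * a) + (f (a * b * c) + f c * f b * f c)) - f a * f b * f a - f c * f b * f c := by abel
    rw [this, e]; abel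
  have key : ∀ a b, f (a * b) = f a * f b ∨ f (a * b) = f b * f a := by
    intro a b
    rw [← sub_eq_zero, ← sub_eq_zero (a := f (a * b)) (b := f b * f a)]
    apply herstein_aux prime
    intro r'
    obtain ⟨r, rfl⟩ := hf r'
    have e1 := htri (a * b) r (b * a)
    have e2 : f (a * b * r * (b * a)) + f (b * a * r * (a * b)) =
        f a * f b * f r * f b * f a + f b * f a * f r * f a * f b := by
      have : a * b * r * (b * a) = a * (b * r * b) * a := by noncomm_ring
      rw [this, ht, ht]
      have : b * a * r * (a * b) = b * (a * r * a) * b := by noncomm_ring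
      rw [this, ht, ht]; noncomm_ring
    have e3 : f (b * a) = f a * f b + f b * f a - f (a * b) := by rw [← hj]; abel
    rw [e2, e3] at e1
    have e4 := sub_eq_zero.mpr e1
    rw [← e4]
    generalize f (a * b) = u
    noncomm_ring
  let S : R → AddSubgroup R := fun a =>
    { carrier := {b | f (a * b) = f a * f b}
      zero_mem' := by simp
      add_mem' := by
        intro x y hx hy
        simp only [Set.mem_ofPred_eq, mul_add, map_add] at *
        rw [hx, hy]
      neg_mem' := by
        intro x hx
        simp only [Set.mem_ofPred_eq, mul_neg, map_neg] at *
        rw [hx] }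
  let T : R → AddSubgroup R := fun a =>
    { carrier := {b | f (a * b) = f b * f a}
      zero_mem' := by simp
      add_mem' := by
        intro x y hx hy
        simp only [Set.mem_ofPred_eq, mul_add, add_mul, map_add] at *
        rw [hx, hy]
      neg_mem' := by
        intro x hx
        simp only [Set.mem_ofPred_eq, mul_neg, neg_mul, map_neg] at *
        rw [hx] }
  let S' : AddSubgroup R :=
    { carrier := {a | ∀ b, f (a * b) = f a * f b}
      zero_mem' := by simp
      add_mem' := by
        intro x y hx hy
        simp only [Set.mem_ofPred_eq, add_mul, map_add] at *
        intro b
        rw [hx, hy]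
      neg_mem' := by
        intro x hx
        simp only [Set.mem_ofPred_eq, neg_mul, map_neg] at *
        intro b
        rw [hx] }
  let T' : AddSubgroup R :=
    { carrier := {a | ∀ b, f (a * b) = f b * f a}
      zero_mem' := by simp
      add_mem' := by
        intro x y hx hy
        simp only [Set.mem_ofPred_eq, mul_add, add_mul, map_add] at *
        intro b
        rw [hx, hy]
      neg_mem' := by
        intro x hx
        simp only [Set.mem_ofPred_eq, mul_neg, neg_mul, map_neg] at *
        intro b
        rw [hx] }
  exact add_cover S' T' (fun a => add_cover (S a) (T a) (fun b => key a b))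
section
variable {R : Type*} [CStarAlgebra R] [PartialOrder R] [StarOrderedRing R]

theorem kadison (L : R →ₗ[ℝ] R) (hpos : ∀ x, 0 ≤ x → 0 ≤ L x) (h1 : L 1 = 1)
    (x : R) (h0 : 0 ≤ x) (hx1 : x ≤ 1) : L x * L x ≤ L (x * x) := by
  have main : ∀ n : ℕ, 0 ≤ L (x * x) - L x * L x + (1 / ((n : ℝ) + 1)) • (L x - L (x * x)) := by
    intro m
    obtain ⟨n, hn⟩ : ∃ n, n = m + 1 := ⟨_, rfl⟩
    let b : ℕ → R := fun k => Polynomial.aeval x (bernsteinPolynomial ℝ n k)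
    have hb : ∀ k, 0 ≤ b k := by
      intro k
      have : b k = (n.choose k : ℝ) • (x ^ k * (1 - x) ^ (n - k)) := by
        simp [b, bernsteinPolynomial, mul_assoc, Algebra.smul_def]
      rw [this]
      apply smul_nonneg (by positivity)
      apply Commute.mul_nonneg
      · exact CStarAlgebra.pow_nonneg h0 k
      · exact CStarAlgebra.pow_nonneg (sub_nonneg.mpr hx1) _
      · apply Commute.pow_pow
        exact (Commute.one_right x).sub_right (Commute.refl x)
    have s0 : ∑ k ∈ Finset.range (n + 1), b k = 1 := by
      have := congrArg (Polynomial.aeval x) (bernsteinPolynomial.sum ℝ n)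
      simpa only [map_sum, map_one] using this
    have s1 : ∑ k ∈ Finset.range (n + 1), (k : ℝ) • b k = (n : ℝ) • x := by
      have := congrArg (Polynomial.aeval x) (bernsteinPolynomial.sum_smul ℝ n)
      simp only [map_sum, map_nsmul, Polynomial.aeval_X] at this
      simpa only [Nat.cast_smul_eq_nsmul] using this
    have s2 : ∑ k ∈ Finset.range (n + 1), ((k : ℝ) * ((k : ℝ) - 1)) • b k
        = ((n : ℝ) * ((n : ℝ) - 1)) • (x * x) := by
      have := congrArg (Polynomial.aeval x) (bernsteinPolynomial.sum_mul_smul ℝ n)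
      simp only [map_sum, map_nsmul, Polynomial.aeval_X, map_pow] at this
      have c : ∀ k : ℕ, ((k : ℝ) * ((k : ℝ) - 1)) = ((k * (k - 1) : ℕ) : ℝ) := by
        intro k; cases k <;> simp
      simp only [c, Nat.cast_smul_eq_nsmul]
      rw [this, pow_two]
    have t0 : ∑ k ∈ Finset.range (n + 1), L (b k) = 1 := by
      rw [← map_sum, s0, h1]
    have t1 : ∑ k ∈ Finset.range (n + 1), (k : ℝ) • L (b k) = (n : ℝ) • L x := by
      rw [← map_smul, ← s1, map_sum]; simp
    have t2 : ∑ k ∈ Finset.range (n + 1), ((k : ℝ) * ((k : ℝ) - 1)) • L (b k)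
        = ((n : ℝ) * ((n : ℝ) - 1)) • L (x * x) := by
      rw [← map_smul, ← s2, map_sum]; simp
    have hs : IsSelfAdjoint (L x) := IsSelfAdjoint.of_nonneg (hpos x h0)
    set s := L x with hsdef
    have pos : 0 ≤ ∑ k ∈ Finset.range (n + 1),
        ((k : ℝ) • (1 : R) - (n : ℝ) • s) * L (b k) * ((k : ℝ) • (1 : R) - (n : ℝ) • s) := by
      apply Finset.sum_nonneg
      intro k _
      apply IsSelfAdjoint.conjugate_nonneg (hpos _ (hb k))
      exact ((IsSelfAdjoint.all (k : ℝ)).smul (IsSelfAdjoint.one R)).sub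
        ((IsSelfAdjoint.all (n : ℝ)).smul hs)
    have e : ∑ k ∈ Finset.range (n + 1),
        ((k : ℝ) • (1 : R) - (n : ℝ) • s) * L (b k) * ((k : ℝ) • (1 : R) - (n : ℝ) • s)
        = ∑ k ∈ Finset.range (n + 1), ((k : ℝ) * ((k : ℝ) - 1)) • L (b k)
          + ∑ k ∈ Finset.range (n + 1), (k : ℝ) • L (b k)
          - (n : ℝ) • (s * ∑ k ∈ Finset.range (n + 1), (k : ℝ) • L (b k))
          - (n : ℝ) • ((∑ k ∈ Finset.range (n + 1), (k : ℝ) • L (b k)) * s)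
          + ((n : ℝ) * n) • (s * (∑ k ∈ Finset.range (n + 1), L (b k)) * s) := by
      simp only [Finset.mul_sum, Finset.sum_mul, Finset.smul_sum, ← Finset.sum_add_distrib,
        ← Finset.sum_sub_distrib]
      apply Finset.sum_congr rfl
      intro k _
      simp only [sub_mul, mul_sub, smul_mul_assoc, mul_smul_comm, one_mul, mul_one, smul_sub]
      module
    rw [e, t0, t1, t2] at pos
    have hnpos : (0 : ℝ) < n := by rw [hn]; positivity
    have := smul_nonneg (a := (1 / ((n : ℝ) * n))) (by positivity) pos
    have hmn : (m : ℝ) + 1 = n := by rw [hn]; push_cast; ring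
    rw [hmn]
    convert this using 1
    simp only [mul_one, mul_smul_comm, smul_mul_assoc, smul_sub, smul_add, smul_smul]
    match_scalars <;> field_simp <;> ring
  have lim : Filter.Tendsto (fun n : ℕ => L (x * x) - L x * L x
      + (1 / ((n : ℝ) + 1)) • (L x - L (x * x))) Filter.atTop
      (nhds (L (x * x) - L x * L x + (0 : ℝ) • (L x - L (x * x)))) := by
    apply Filter.Tendsto.const_add
    apply Filter.Tendsto.smul_const
    exact tendsto_one_div_add_atTop_nhds_zero_nat
  have := ge_of_tendsto' lim main
  rw [zero_smul, add_zero] at this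
  exact sub_nonneg.mp this
end
section
variable {R : Type*} [CStarAlgebra R] [PartialOrder R] [StarOrderedRing R]

theorem le_norm_smul_one (x : R) (hx : IsSelfAdjoint x) : x ≤ ‖x‖ • (1 : R) := by
  have := hx.le_algebraMap_norm_self
  rwa [Algebra.algebraMap_eq_smul_one] at this

theorem add_norm_nonneg (x : R) (hx : IsSelfAdjoint x) : 0 ≤ x + ‖x‖ • (1 : R) := by
  have := hx.neg_algebraMap_norm_le_self
  rw [Algebra.algebraMap_eq_smul_one] at this
  rw [add_comm]
  exact neg_le_iff_add_nonneg'.mp this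

theorem scale_effect (x : R) (c : ℝ) (hc : 0 < c) (h0 : 0 ≤ x) (h1 : x ≤ c • (1 : R)) :
    c⁻¹ • x ∈ Set.Icc (0 : R) 1 := by
  refine ⟨smul_nonneg (by positivity) h0, ?_⟩
  have := smul_le_smul_of_nonneg_left h1 (inv_nonneg.mpr hc.le)
  rwa [smul_smul, inv_mul_cancel₀ hc.ne', one_smul] at this

theorem extend_exists (φ : R → R)
    (h0 : φ 0 = 0)
    (haff : ∀ x ∈ Set.Icc (0 : R) 1, ∀ y ∈ Set.Icc (0 : R) 1, ∀ t : ℝ, t ∈ Set.Icc (0 : ℝ) 1 →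
      φ (t • x + (1 - t) • y) = t • φ x + (1 - t) • φ y) :
    ∃ L : R →ₗ[ℂ] R, ∀ x ∈ Set.Icc (0 : R) 1, L x = φ x := by
  have one_nn : (0 : R) ≤ 1 := zero_le_one
  have z_mem : (0 : R) ∈ Set.Icc (0 : R) 1 := ⟨le_rfl, one_nn⟩
  have hsm : ∀ x ∈ Set.Icc (0 : R) 1, ∀ t : ℝ, t ∈ Set.Icc (0 : ℝ) 1 → φ (t • x) = t • φ x := by
    intro x hx t ht
    have := haff x hx 0 z_mem t ht
    simpa [h0] using this
  have hadd : ∀ x ∈ Set.Icc (0 : R) 1, ∀ y ∈ Set.Icc (0 : R) 1,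
      φ ((2⁻¹ : ℝ) • (x + y)) = (2⁻¹ : ℝ) • (φ x + φ y) := by
    intro x hx y hy
    have := haff x hx y hy 2⁻¹ (by constructor <;> norm_num)
    rw [smul_add, smul_add]
    convert this using 3 <;> norm_num
  let G : R → R := fun x => (‖x‖ + 1) • φ ((‖x‖ + 1)⁻¹ • x)
  have comp : ∀ (x : R) (c d : ℝ), 0 < c → c ≤ d → 0 ≤ x → x ≤ c • (1 : R) →
      c • φ (c⁻¹ • x) = d • φ (d⁻¹ • x) := by
    intro x c d hc hcd hx hxc
    have hd : 0 < d := hc.trans_le hcd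
    have e : d⁻¹ • x = (c / d) • (c⁻¹ • x) := by
      rw [smul_smul]; congr 1; field_simp
    rw [e, hsm _ (scale_effect x c hc hx hxc) (c / d)
      ⟨by positivity, (div_le_one hd).mpr hcd⟩, smul_smul]
    congr 1; field_simp
  have mono1 : ∀ c d : ℝ, c ≤ d → c • (1 : R) ≤ d • (1 : R) := fun c d h =>
    smul_le_smul_of_nonneg_right h one_nn
  have hG : ∀ (x : R) (c : ℝ), 0 < c → 0 ≤ x → x ≤ c • (1 : R) → G x = c • φ (c⁻¹ • x) := by
    intro x c hc hx hxc
    have hn : x ≤ (‖x‖ + 1) • (1 : R) :=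
      (le_norm_smul_one x (IsSelfAdjoint.of_nonneg hx)).trans (mono1 _ _ (by linarith))
    have a := comp x (‖x‖ + 1) (max (‖x‖ + 1) c) (by positivity) (le_max_left _ _) hx hn
    have b := comp x c (max (‖x‖ + 1) c) hc (le_max_right _ _) hx hxc
    simp only [G]
    rw [a, b]
  have hGle : ∀ x : R, 0 ≤ x → x ≤ ‖x‖ • (1 : R) := fun x hx =>
    le_norm_smul_one x (IsSelfAdjoint.of_nonneg hx)
  have Gadd : ∀ x y : R, 0 ≤ x → 0 ≤ y → G (x + y) = G x + G y := by
    intro x y hx hy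
    obtain ⟨c, hc⟩ : ∃ c, c = ‖x‖ + ‖y‖ + 1 := ⟨_, rfl⟩
    have hcp : 0 < c := by rw [hc]; positivity
    have hxc : x ≤ c • (1 : R) := (hGle x hx).trans (mono1 _ _ (by rw [hc]; linarith [norm_nonneg y]))
    have hyc : y ≤ c • (1 : R) := (hGle y hy).trans (mono1 _ _ (by rw [hc]; linarith [norm_nonneg x]))
    have hxy : x + y ≤ (2 * c) • (1 : R) := by
      have := add_le_add hxc hyc
      rwa [← add_smul, ← two_mul] at this
    rw [hG x c hcp hx hxc, hG y c hcp hy hyc, hG (x + y) (2 * c) (by positivity) (add_nonneg hx hy) hxy]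
    have e : (2 * c)⁻¹ • (x + y) = (2⁻¹ : ℝ) • (c⁻¹ • x + c⁻¹ • y) := by
      rw [← smul_add, smul_smul, mul_inv]
    rw [e, hadd _ (scale_effect x c hcp hx hxc) _ (scale_effect y c hcp hy hyc), smul_smul,
      ← smul_add]
    congr 1; field_simp
  have Gzero : G 0 = 0 := by simp [G, h0]
  have Gsmul : ∀ (t : ℝ) (x : R), 0 ≤ t → 0 ≤ x → G (t • x) = t • G x := by
    intro t x ht hx
    rcases ht.eq_or_lt with h | h
    · rw [← h]; simp [Gzero]
    have hc : (0 : ℝ) < ‖x‖ + 1 := by positivity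
    have hn : x ≤ (‖x‖ + 1) • (1 : R) := (hGle x hx).trans (mono1 _ _ (by linarith))
    have hn' : t • x ≤ (t * (‖x‖ + 1)) • (1 : R) := by
      rw [mul_smul]; exact smul_le_smul_of_nonneg_left hn ht
    rw [hG (t • x) (t * (‖x‖ + 1)) (by positivity) (smul_nonneg ht hx) hn', hG x _ hc hx hn,
      smul_smul, smul_smul]
    congr 3; field_simp
  have nn1 : ∀ t : ℝ, 0 ≤ t → 0 ≤ t • (1 : R) := fun t ht => smul_nonneg ht one_nn
  let F : R → R := fun x => G (x + ‖x‖ • 1) - G (‖x‖ • 1)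
  have hF : ∀ a b : R, 0 ≤ a → 0 ≤ b → F (a - b) = G a - G b := by
    intro a b ha hb
    have sa : IsSelfAdjoint (a - b) := (IsSelfAdjoint.of_nonneg ha).sub (IsSelfAdjoint.of_nonneg hb)
    have e := Gadd _ b (add_norm_nonneg _ sa) hb
    have e' := Gadd a (‖a - b‖ • 1) ha (nn1 _ (norm_nonneg _))
    have : a - b + ‖a - b‖ • 1 + b = a + ‖a - b‖ • 1 := by abel
    rw [this, e'] at e
    simp only [F]
    rw [sub_eq_sub_iff_add_eq_add, ← e]
  have dec : ∀ x : R, x = (x + ‖x‖ • 1) - ‖x‖ • 1 := fun x => by abel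
  have Fadd : ∀ x y : R, IsSelfAdjoint x → IsSelfAdjoint y → F (x + y) = F x + F y := by
    intro x y hx hy
    have : x + y = ((x + ‖x‖ • 1) + (y + ‖y‖ • 1)) - (‖x‖ • 1 + ‖y‖ • 1) := by abel
    rw [this, hF _ _ (add_nonneg (add_norm_nonneg x hx) (add_norm_nonneg y hy))
      (add_nonneg (nn1 _ (norm_nonneg _)) (nn1 _ (norm_nonneg _))),
      Gadd _ _ (add_norm_nonneg x hx) (add_norm_nonneg y hy),
      Gadd _ _ (nn1 _ (norm_nonneg _)) (nn1 _ (norm_nonneg _))]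
    simp only [F]; abel
  have Fsmul0 : ∀ (t : ℝ) (x : R), 0 ≤ t → IsSelfAdjoint x → F (t • x) = t • F x := by
    intro t x ht hx
    have : t • x = t • (x + ‖x‖ • 1) - t • (‖x‖ • 1) := by rw [← smul_sub, ← dec]
    rw [this, hF _ _ (smul_nonneg ht (add_norm_nonneg x hx))
      (smul_nonneg ht (nn1 _ (norm_nonneg _))), Gsmul _ _ ht (add_norm_nonneg x hx),
      Gsmul _ _ ht (nn1 _ (norm_nonneg _)), ← smul_sub]
  have Fneg : ∀ x : R, IsSelfAdjoint x → F (-x) = - F x := by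
    intro x hx
    have : -x = ‖x‖ • 1 - (x + ‖x‖ • 1) := by abel
    rw [this, hF _ _ (nn1 _ (norm_nonneg _)) (add_norm_nonneg x hx)]
    simp only [F]; abel
  have Fsmul : ∀ (t : ℝ) (x : R), IsSelfAdjoint x → F (t • x) = t • F x := by
    intro t x hx
    rcases le_total 0 t with ht | ht
    · exact Fsmul0 t x ht hx
    · have := Fsmul0 (-t) x (by linarith) hx
      rw [neg_smul, neg_smul, Fneg _ ((IsSelfAdjoint.all t).smul hx)] at this
      exact neg_injective this
  let F' : selfAdjoint R →ₗ[ℝ] R :=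
    { toFun := fun x => F x
      map_add' := fun x y => Fadd x y x.2 y.2
      map_smul' := fun t x => Fsmul t x x.2 }
  refine ⟨{ toFun := fun z => F' (realPart z) + Complex.I • F' (imaginaryPart z)
            map_add' := ?_, map_smul' := ?_ }, ?_⟩
  · intro x y
    simp only [map_add, smul_add]; abel
  · intro c x
    simp only [realPart_smul, imaginaryPart_smul, map_add, map_sub, map_smul, RingHom.id_apply]
    have hr : ∀ (t : ℝ) (z : R), t • z = (t : ℂ) • z := fun t z => (Complex.coe_smul t z).symm
    simp only [hr]
    generalize F' (realPart x) = u
    generalize F' (imaginaryPart x) = v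
    obtain ⟨a, b⟩ := c
    rw [Complex.mk_eq_add_mul_I]
    simp only [Complex.add_re, Complex.add_im, Complex.mul_re, Complex.mul_im, Complex.ofReal_re,
      Complex.ofReal_im, Complex.I_re, Complex.I_im, mul_zero, mul_one, sub_zero, add_zero, zero_add]
    match_scalars
    · ring_nf
    · ring_nf; simp [Complex.I_sq]
  · intro x hx
    have sa : IsSelfAdjoint x := IsSelfAdjoint.of_nonneg hx.1
    have hFx : F x = φ x := by
      have := hF x 0 hx.1 le_rfl
      rw [sub_zero, Gzero, sub_zero] at this
      rw [this, hG x 1 one_pos hx.1 (by simpa using hx.2)]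
      simp
    have e1 : ((realPart x : selfAdjoint R) : R) = x := sa.coe_realPart
    have e2 : imaginaryPart x = 0 := sa.imaginaryPart
    have F0 : F 0 = 0 := by simp [F]
    simp [e2, F', e1, hFx, F0]
end
section
variable {R : Type*} [CStarAlgebra R] [PartialOrder R] [StarOrderedRing R]

theorem sa_decomp (x : R) (hx : IsSelfAdjoint x) :
    ∃ (a b : ℝ) (e : R), e ∈ Set.Icc (0 : R) 1 ∧ x = a • e + b • (1 : R) := by
  have hc : (0 : ℝ) < 2 * ‖x‖ + 1 := by positivity
  refine ⟨2 * ‖x‖ + 1, -‖x‖, (2 * ‖x‖ + 1)⁻¹ • (x + ‖x‖ • 1), ?_, ?_⟩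
  · apply scale_effect _ _ hc (add_norm_nonneg x hx)
    calc x + ‖x‖ • (1 : R) ≤ ‖x‖ • 1 + ‖x‖ • 1 := by
          gcongr; exact le_norm_smul_one x hx
      _ = (2 * ‖x‖) • 1 := by rw [← add_smul, two_mul]
      _ ≤ (2 * ‖x‖ + 1) • 1 := smul_le_smul_of_nonneg_right (by linarith) zero_le_one
  · rw [smul_smul, mul_inv_cancel₀ hc.ne', one_smul, neg_smul]; abel

theorem one_mem_eff : (1 : R) ∈ Set.Icc (0 : R) 1 := ⟨zero_le_one, le_rfl⟩
theorem zero_mem_eff : (0 : R) ∈ Set.Icc (0 : R) 1 := ⟨le_rfl, zero_le_one⟩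

theorem clin_real (L : R →ₗ[ℂ] R) (t : ℝ) (x : R) : L (t • x) = t • L x := by
  rw [← Complex.coe_smul, map_smul, Complex.coe_smul]

theorem ext_effects (L M : R →ₗ[ℂ] R) (h : ∀ x ∈ Set.Icc (0 : R) 1, L x = M x) : L = M := by
  have sa : ∀ x : R, IsSelfAdjoint x → L x = M x := by
    intro x hx
    obtain ⟨a, b, e, he, rfl⟩ := sa_decomp x hx
    simp only [map_add, clin_real, h e he, h 1 one_mem_eff]
  ext z
  rw [← realPart_add_I_smul_imaginaryPart z]
  simp only [map_add, map_smul, sa _ (realPart z).2, sa _ (imaginaryPart z).2]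

theorem pos_of_effects (L : R →ₗ[ℂ] R) (h : ∀ x ∈ Set.Icc (0 : R) 1, 0 ≤ L x) (x : R) (hx : 0 ≤ x) :
    0 ≤ L x := by
  have hc : (0 : ℝ) < ‖x‖ + 1 := by positivity
  have hn : x ≤ (‖x‖ + 1) • (1 : R) :=
      (le_norm_smul_one x (IsSelfAdjoint.of_nonneg hx)).trans
        (smul_le_smul_of_nonneg_right (by linarith) zero_le_one)
  have := smul_nonneg hc.le (h _ (scale_effect x _ hc hx hn))
  rwa [← clin_real, smul_smul, mul_inv_cancel₀ hc.ne', one_smul] at this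

theorem star_of_effects (L : R →ₗ[ℂ] R) (h : ∀ x ∈ Set.Icc (0 : R) 1, 0 ≤ L x) (z : R) :
    L (star z) = star (L z) := by
  have sa : ∀ x : R, IsSelfAdjoint x → star (L x) = L x := by
    intro x hx
    obtain ⟨a, b, e, he, rfl⟩ := sa_decomp x hx
    simp only [map_add, clin_real, star_add, star_smul, star_trivial,
      (IsSelfAdjoint.of_nonneg (h e he)).star_eq, (IsSelfAdjoint.of_nonneg (h 1 one_mem_eff)).star_eq]
  rw [← realPart_add_I_smul_imaginaryPart z]
  simp only [map_add, map_smul, star_add, star_smul, sa _ (realPart z).2, sa _ (imaginaryPart z).2,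
    (realPart z).2.star_eq, (imaginaryPart z).2.star_eq]

theorem sq_of_effects (L : R →ₗ[ℂ] R) (h1 : L 1 = 1)
    (h : ∀ x ∈ Set.Icc (0 : R) 1, L (x * x) = L x * L x) (z : R) :
    L (z * z) = L z * L z := by
  have sa : ∀ x : R, IsSelfAdjoint x → L (x * x) = L x * L x := by
    intro x hx
    obtain ⟨a, b, e, he, rfl⟩ := sa_decomp x hx
    simp only [map_add, clin_real, mul_add, add_mul, smul_mul_assoc, mul_smul_comm, one_mul, mul_one,
      h e he, h1]
  have pol : ∀ x y : R, IsSelfAdjoint x → IsSelfAdjoint y →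
      L (x * y) + L (y * x) = L x * L y + L y * L x := by
    intro x y hx hy
    have := sa (x + y) (hx.add hy)
    simp only [mul_add, add_mul, map_add, sa x hx, sa y hy] at this
    have e : L (x * y) + L (y * x) = (L x * L x + L (y * x) + (L (x * y) + L y * L y))
      - L x * L x - L y * L y := by abel
    rw [e, this]; abel
  rw [← realPart_add_I_smul_imaginaryPart z]
  have hx := (realPart z).2
  have hy := (imaginaryPart z).2
  generalize ((realPart z : selfAdjoint R) : R) = x at *
  generalize ((imaginaryPart z : selfAdjoint R) : R) = y at *
  have e : L ((x + Complex.I • y) * (x + Complex.I • y)) = L (x * x)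
      + Complex.I • (L (x * y) + L (y * x)) + (Complex.I * Complex.I) • L (y * y) := by
    simp only [mul_add, add_mul, map_add, map_smul, smul_mul_assoc, mul_smul_comm, smul_add, smul_smul]
    abel
  rw [e, pol x y hx hy, sa x hx, sa y hy]
  simp only [mul_add, add_mul, map_add, map_smul, smul_mul_assoc, mul_smul_comm, smul_add, smul_smul]
  abel

theorem convex_eff (x y : R) (hx : x ∈ Set.Icc (0 : R) 1) (hy : y ∈ Set.Icc (0 : R) 1) (t : ℝ)
    (ht : t ∈ Set.Icc (0 : ℝ) 1) : t • x + (1 - t) • y ∈ Set.Icc (0 : R) 1 := by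
  have h1t : 0 ≤ 1 - t := by linarith [ht.2]
  refine ⟨add_nonneg (smul_nonneg ht.1 hx.1) (smul_nonneg h1t hy.1), ?_⟩
  calc t • x + (1 - t) • y ≤ t • 1 + (1 - t) • 1 :=
        add_le_add (smul_le_smul_of_nonneg_left hx.2 ht.1) (smul_le_smul_of_nonneg_left hy.2 h1t)
    _ = 1 := by rw [← add_smul]; simp

theorem unital_case (prime : ∀ x y : R, (∀ r, x * r * y = 0) → x = 0 ∨ y = 0)
    (φ : R → R) (hbij : Set.BijOn φ (Set.Icc 0 1) (Set.Icc 0 1))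
    (h0 : φ 0 = 0) (h1 : φ 1 = 1)
    (haff : ∀ x ∈ Set.Icc (0 : R) 1, ∀ y ∈ Set.Icc (0 : R) 1, ∀ t : ℝ, t ∈ Set.Icc (0 : ℝ) 1 →
      φ (t • x + (1 - t) • y) = t • φ x + (1 - t) • φ y) :
    ∃ L : R →ₗ[ℂ] R, Function.Bijective L ∧ (∀ x, L (star x) = star (L x)) ∧
      ((∀ x y, L (x * y) = L x * L y) ∨ (∀ x y, L (x * y) = L y * L x)) ∧
      ∀ x ∈ Set.Icc (0 : R) 1, φ x = L x := by
  let ψ := Function.invFunOn φ (Set.Icc (0 : R) 1)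
  have hinv : Set.InvOn ψ φ (Set.Icc 0 1) (Set.Icc 0 1) := hbij.invOn_invFunOn
  have hψ : Set.MapsTo ψ (Set.Icc 0 1) (Set.Icc 0 1) := hbij.surjOn.mapsTo_invFunOn
  have g0 : ψ 0 = 0 := by
    have := hinv.1 zero_mem_eff
    rwa [h0] at this
  have g1 : ψ 1 = 1 := by
    have := hinv.1 one_mem_eff
    rwa [h1] at this
  have gaff : ∀ x ∈ Set.Icc (0 : R) 1, ∀ y ∈ Set.Icc (0 : R) 1, ∀ t : ℝ, t ∈ Set.Icc (0 : ℝ) 1 →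
      ψ (t • x + (1 - t) • y) = t • ψ x + (1 - t) • ψ y := by
    intro x hx y hy t ht
    apply hbij.injOn (hψ (convex_eff x y hx hy t ht)) (convex_eff _ _ (hψ hx) (hψ hy) t ht)
    rw [haff _ (hψ hx) _ (hψ hy) t ht, hinv.2 hx, hinv.2 hy, hinv.2 (convex_eff x y hx hy t ht)]
  obtain ⟨L, hL⟩ := extend_exists φ h0 haff
  obtain ⟨M, hM⟩ := extend_exists ψ g0 gaff
  have ML : M ∘ₗ L = LinearMap.id := by
    apply ext_effects
    intro x hx
    simp only [LinearMap.comp_apply, LinearMap.id_apply]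
    rw [hL x hx, hM _ (hbij.mapsTo hx), hinv.1 hx]
  have LM : L ∘ₗ M = LinearMap.id := by
    apply ext_effects
    intro x hx
    simp only [LinearMap.comp_apply, LinearMap.id_apply]
    rw [hM x hx, hL _ (hψ hx), hinv.2 hx]
  have ML' : ∀ x, M (L x) = x := fun x => LinearMap.congr_fun ML x
  have LM' : ∀ x, L (M x) = x := fun x => LinearMap.congr_fun LM x
  have Lpos0 : ∀ x ∈ Set.Icc (0 : R) 1, 0 ≤ L x := fun x hx => by
    rw [hL x hx]; exact (hbij.mapsTo hx).1
  have Mpos0 : ∀ x ∈ Set.Icc (0 : R) 1, 0 ≤ M x := fun x hx => by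
    rw [hM x hx]; exact (hψ hx).1
  have Lpos := pos_of_effects L Lpos0
  have Mpos := pos_of_effects M Mpos0
  have L1 : L 1 = 1 := by rw [hL 1 one_mem_eff, h1]
  have M1 : M 1 = 1 := by rw [hM 1 one_mem_eff, g1]
  have sq : ∀ x ∈ Set.Icc (0 : R) 1, L (x * x) = L x * L x := by
    intro x hx
    apply le_antisymm
    · have hy : L x ∈ Set.Icc (0 : R) 1 := by rw [hL x hx]; exact hbij.mapsTo hx
      have k : M (L x) * M (L x) ≤ M (L x * L x) :=
        kadison (M.restrictScalars ℝ) Mpos M1 (L x) hy.1 hy.2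
      rw [ML'] at k
      have := Lpos _ (sub_nonneg.mpr k)
      rw [map_sub, LM'] at this
      exact sub_nonneg.mp this
    · exact kadison (L.restrictScalars ℝ) Lpos L1 x hx.1 hx.2
  refine ⟨L, ⟨fun x y hxy => ?_, fun y => ⟨M y, LM' y⟩⟩, star_of_effects L Lpos0, ?_,
    fun x hx => (hL x hx).symm⟩
  · rw [← ML' x, hxy, ML']
  · exact herstein prime L.toAddMonoidHom (fun y => ⟨M y, LM' y⟩) (sq_of_effects L L1 sq)

theorem compl_eff (x : R) (hx : x ∈ Set.Icc (0 : R) 1) : 1 - x ∈ Set.Icc (0 : R) 1 :=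
  ⟨sub_nonneg.mpr hx.2, by simpa using hx.1⟩

theorem mid_aff (φ : R → R)
    (haff : ∀ x ∈ Set.Icc (0 : R) 1, ∀ y ∈ Set.Icc (0 : R) 1, ∀ t : ℝ, t ∈ Set.Icc (0 : ℝ) 1 →
      φ (t • x + (1 - t) • y) = t • φ x + (1 - t) • φ y)
    (x y : R) (hx : x ∈ Set.Icc (0 : R) 1) (hy : y ∈ Set.Icc (0 : R) 1) :
    φ ((2⁻¹ : ℝ) • (x + y)) = (2⁻¹ : ℝ) • (φ x + φ y) := by
  have := haff x hx y hy 2⁻¹ (by constructor <;> norm_num)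
  rw [smul_add, smul_add]
  convert this using 3 <;> norm_num

theorem compl_image (φ : R → R) (hbij : Set.BijOn φ (Set.Icc 0 1) (Set.Icc 0 1))
    (haff : ∀ x ∈ Set.Icc (0 : R) 1, ∀ y ∈ Set.Icc (0 : R) 1, ∀ t : ℝ, t ∈ Set.Icc (0 : ℝ) 1 →
      φ (t • x + (1 - t) • y) = t • φ x + (1 - t) • φ y)
    (x : R) (hx : x ∈ Set.Icc (0 : R) 1) : φ (1 - x) = 1 - φ x := by
  have hm := mid_aff φ haff
  obtain ⟨m, hmdef⟩ : ∃ m, m = φ ((2⁻¹ : ℝ) • 1) := ⟨_, rfl⟩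
  have h2 : ∀ w ∈ Set.Icc (0 : R) 1, φ w + φ (1 - w) = (2 : ℝ) • m := by
    intro w hw
    have := hm w (1 - w) hw (compl_eff w hw)
    rw [add_sub_cancel, ← hmdef] at this
    rw [this, smul_smul]; norm_num
  have tr : ∀ y ∈ Set.Icc (0 : R) 1, y + ((2 : ℝ) • m - 1) ∈ Set.Icc (0 : R) 1 := by
    intro y hy
    obtain ⟨w, hw, hwy⟩ := hbij.surjOn (compl_eff y hy)
    have e := h2 w hw
    have := hbij.mapsTo (compl_eff w hw)
    convert this using 1
    rw [← e, hwy]; abel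
  have d0 := (tr 0 zero_mem_eff).1
  have d1 := (tr 1 one_mem_eff).2
  have d : (2 : ℝ) • m - 1 = 0 := by
    apply le_antisymm
    · simpa using d1
    · simpa using d0
  have := h2 x hx
  rw [sub_eq_zero.mp d] at this
  exact eq_sub_of_add_eq' this

/-- The key positivity estimate. -/
theorem block_pos (p b : R) (hp : IsSelfAdjoint p) (hpp : p * p = p) (hb1 : (1 - p) * b = b)
    (hb2 : b * p = b) : ∃ m : ℝ, ∀ n : ℝ, m ≤ n →
      0 ≤ (2⁻¹ : ℝ) • (1 - p) + (b + star b) + n • p := by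
  have ppos : 0 ≤ p := by
    have := star_mul_self_nonneg p
    rwa [hp.star_eq, hpp] at this
  have bp : p * star b = star b := by
    have := congrArg star hb2
    rwa [star_mul, hp.star_eq] at this
  have b1 : star b * (1 - p) = star b := by
    have := congrArg star hb1
    rwa [star_mul, star_sub, hp.star_eq, star_one] at this
  have qq : (1 - p) * (1 - p) = 1 - p := by
    simp only [mul_sub, sub_mul, mul_one, one_mul, hpp]; abel
  have bb : star b * b ≤ ‖star b * b‖ • p := by
    have h1 := le_norm_smul_one (star b * b) (IsSelfAdjoint.star_mul_self b)
    have h2 := hp.conjugate_le_conjugate h1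
    have e : p * (star b * b) * p = star b * b := by
      rw [← mul_assoc, bp, mul_assoc, hb2]
    rw [e] at h2
    simpa [hpp] using h2
  refine ⟨2 * ‖star b * b‖, fun n hn => ?_⟩
  have e1 : 0 ≤ star ((2⁻¹ : ℝ) • (1 - p) + b) * ((2⁻¹ : ℝ) • (1 - p) + b) := star_mul_self_nonneg _
  have e2 : star ((2⁻¹ : ℝ) • (1 - p) + b) * ((2⁻¹ : ℝ) • (1 - p) + b)
    = (2⁻¹ * 2⁻¹ : ℝ) • (1 - p) + (2⁻¹ : ℝ) • b + (2⁻¹ : ℝ) • star b + star b * b := by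
    have : star ((2⁻¹ : ℝ) • (1 - p) + b) = (2⁻¹ : ℝ) • (1 - p) + star b := by
      simp [hp.star_eq]
    rw [this]
    simp only [add_mul, mul_add, smul_mul_assoc, mul_smul_comm, qq, hb1, b1]
    module
  rw [e2] at e1
  have e3 := smul_nonneg (a := (2 : ℝ)) (by norm_num) (add_nonneg e1 (sub_nonneg.mpr bb))
  have e4 : 0 ≤ (n - 2 * ‖star b * b‖) • p := smul_nonneg (by linarith) ppos
  have := add_nonneg e3 e4
  convert this using 1
  module

theorem image_zero (prime : ∀ x y : R, (∀ r, x * r * y = 0) → x = 0 ∨ y = 0)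
    (φ : R → R) (hbij : Set.BijOn φ (Set.Icc 0 1) (Set.Icc 0 1))
    (haff : ∀ x ∈ Set.Icc (0 : R) 1, ∀ y ∈ Set.Icc (0 : R) 1, ∀ t : ℝ, t ∈ Set.Icc (0 : ℝ) 1 →
      φ (t • x + (1 - t) • y) = t • φ x + (1 - t) • φ y) :
    φ 0 = 0 ∨ φ 0 = 1 := by
  have hm := mid_aff φ haff
  obtain ⟨p, hpdef⟩ : ∃ p, p = φ 0 := ⟨_, rfl⟩
  have pe : p ∈ Set.Icc (0 : R) 1 := by rw [hpdef]; exact hbij.mapsTo zero_mem_eff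
  have hp : IsSelfAdjoint p := IsSelfAdjoint.of_nonneg pe.1
  have q1 : φ 1 = 1 - p := by
    have := compl_image φ hbij haff 0 zero_mem_eff
    rwa [sub_zero, ← hpdef] at this
  have half : ∀ a : R, (2⁻¹ : ℝ) • (a + a) = a := fun a => by
    rw [← two_smul ℝ a, smul_smul]; norm_num
  -- `p` is a projection
  have sqe : ∀ x ∈ Set.Icc (0 : R) 1, x * x ∈ Set.Icc (0 : R) 1 := by
    intro x hx
    have c : Commute x (1 - x) := (Commute.one_right x).sub_right (Commute.refl x)
    have h := c.mul_nonneg hx.1 (sub_nonneg.mpr hx.2)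
    refine ⟨(Commute.refl x).mul_nonneg hx.1 hx.1, ?_⟩
    rw [mul_sub, mul_one] at h
    exact (sub_nonneg.mp h).trans hx.2
  have hpp : p * p = p := by
    have m1 := sqe p pe
    have m2 := compl_eff _ (sqe _ (compl_eff p pe))
    obtain ⟨a, ha, hap⟩ := hbij.surjOn m1
    obtain ⟨b, hb, hbp⟩ := hbij.surjOn m2
    have e := hm a b ha hb
    have e2 : φ a + φ b = p + p := by
      rw [hap, hbp]; noncomm_ring
    rw [e2, half, hpdef] at e
    have memab : (2⁻¹ : ℝ) • (a + b) ∈ Set.Icc (0 : R) 1 := by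
      have := convex_eff a b ha hb 2⁻¹ (by constructor <;> norm_num)
      rw [smul_add]
      convert this using 3; norm_num
    have := hbij.injOn memab zero_mem_eff e
    have s : a + b = 0 := (smul_eq_zero.mp this).resolve_left (by norm_num)
    have a0 : a = 0 := by
      apply le_antisymm _ ha.1
      rw [← s]; simpa using hb.1
    rw [← hap, a0, hpdef]
  have ppos := pe.1
  have qpos := sub_nonneg.mpr pe.2
  -- everything `1/2 + (b + b*)` is an effect
  have key : ∀ b : R, (1 - p) * b = b → b * p = b →
      (2⁻¹ : ℝ) • (1 : R) + (b + star b) ∈ Set.Icc (0 : R) 1 := by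
    intro b hb1 hb2
    have sb1 : star b * (1 - p) = star b := by
      have := congrArg star hb1
      rwa [star_mul, star_sub, hp.star_eq, star_one] at this
    have sb2 : p * star b = star b := by
      have := congrArg star hb2
      rwa [star_mul, hp.star_eq] at this
    have hq : IsSelfAdjoint (1 - p) := (IsSelfAdjoint.one R).sub hp
    have hqq : (1 - p) * (1 - p) = 1 - p := by
      simp only [mul_sub, sub_mul, mul_one, one_mul, hpp]; abel
    obtain ⟨m1, h1⟩ := block_pos p b hp hpp hb1 hb2
    obtain ⟨m2, h2⟩ := block_pos p (-b) hp hpp (by rw [mul_neg, hb1]) (by rw [neg_mul, hb2])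
    obtain ⟨m3, h3⟩ := block_pos (1 - p) (star b) hq hqq (by rw [sub_sub_cancel, sb2]) sb1
    obtain ⟨m4, h4⟩ := block_pos (1 - p) (-star b) hq hqq
      (by rw [sub_sub_cancel, mul_neg, sb2]) (by rw [neg_mul, sb1])
    simp only [sub_sub_cancel, star_neg, star_star] at h2 h3 h4
    obtain ⟨n, hn1, hn⟩ : ∃ n : ℝ, 1 ≤ n ∧ (m1 ≤ n - 2⁻¹ ∧ m2 ≤ n - 2⁻¹ ∧ m3 ≤ n - 2⁻¹ ∧ m4 ≤ n - 2⁻¹) := by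
      refine ⟨1 + |m1| + |m2| + |m3| + |m4|, ?_, ?_, ?_, ?_, ?_⟩ <;>
      linarith [abs_nonneg m1, abs_nonneg m2, abs_nonneg m3, abs_nonneg m4, le_abs_self m1,
        le_abs_self m2, le_abs_self m3, le_abs_self m4]
    have k1 := h1 _ hn.1
    have k2 := h2 _ hn.2.1
    have k3 := h3 _ hn.2.2.1
    have k4 := h4 _ hn.2.2.2
    have hn0 : (0 : ℝ) < n := by linarith
    have in0 : (0 : ℝ) ≤ n⁻¹ := by positivity
    have in1 : n⁻¹ ≤ 1 := inv_le_one_of_one_le₀ hn1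
    set c := b + star b with hc
    -- x = (1-2p)/2 + c
    have x1 : n⁻¹ • ((2⁻¹ : ℝ) • (1 - p - p) + c) + p ∈ Set.Icc (0 : R) 1 := by
      constructor
      · have := smul_nonneg in0 k1
        convert this using 1
        match_scalars <;> field_simp <;> ring
      · have := smul_nonneg in0 k4
        rw [← sub_nonneg]
        convert this using 1
        rw [hc]
        match_scalars <;> field_simp <;> ring
    have x2 : n⁻¹ • ((2⁻¹ : ℝ) • (1 - p - p) - c) + p ∈ Set.Icc (0 : R) 1 := by
      constructor
      · have := smul_nonneg in0 k2
        convert this using 1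
        rw [hc]
        match_scalars <;> field_simp <;> ring
      · have := smul_nonneg in0 k3
        rw [← sub_nonneg]
        convert this using 1
        rw [hc]
        match_scalars <;> field_simp <;> ring
    obtain ⟨u, hu, hux⟩ := hbij.surjOn x1
    obtain ⟨v, hv, hvx⟩ := hbij.surjOn x2
    have sm : ∀ w ∈ Set.Icc (0 : R) 1, ∀ t ∈ Set.Icc (0 : ℝ) 1, φ (t • w) = t • φ w + (1 - t) • p := by
      intro w hw t ht
      have := haff w hw 0 zero_mem_eff t ht
      rwa [smul_zero, add_zero, ← hpdef] at this
    have tm : (2⁻¹ * n⁻¹ : ℝ) ∈ Set.Icc (0 : ℝ) 1 := ⟨by positivity, by linarith⟩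
    have e1 := sm 1 one_mem_eff _ tm
    have e2 := hm u v hu hv
    have memuv : (2⁻¹ : ℝ) • (u + v) ∈ Set.Icc (0 : R) 1 := by
      have := convex_eff u v hu hv 2⁻¹ (by constructor <;> norm_num)
      rw [smul_add]
      convert this using 3; norm_num
    have mem1 : (2⁻¹ * n⁻¹ : ℝ) • (1 : R) ∈ Set.Icc (0 : R) 1 := by
      have := convex_eff (1 : R) 0 one_mem_eff zero_mem_eff _ tm
      simpa using this
    have e3 : (2⁻¹ : ℝ) • (u + v) = (2⁻¹ * n⁻¹ : ℝ) • (1 : R) := by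
      apply hbij.injOn memuv mem1
      rw [e1, e2, hux, hvx, q1]
      module
    have e4 : u + v = n⁻¹ • (1 : R) := by
      have := congrArg (fun z : R => (2 : ℝ) • z) e3
      simp only [smul_smul] at this
      rw [← mul_assoc] at this
      norm_num at this
      exact this
    have nu : n • u ∈ Set.Icc (0 : R) 1 := by
      refine ⟨smul_nonneg hn0.le hu.1, ?_⟩
      have : u ≤ n⁻¹ • (1 : R) := by rw [← e4]; simpa using hv.1
      have := smul_le_smul_of_nonneg_left this hn0.le
      rwa [smul_smul, mul_inv_cancel₀ hn0.ne', one_smul] at this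
    have e5 := sm (n • u) nu n⁻¹ ⟨in0, in1⟩
    rw [smul_smul, inv_mul_cancel₀ hn0.ne', one_smul, hux] at e5
    have e6 : φ (n • u) = (2⁻¹ : ℝ) • (1 : R) + c := by
      have := congrArg (fun z : R => n • (z - ((1 : ℝ) - n⁻¹) • p)) e5
      simp only [add_sub_cancel_right, smul_smul, mul_inv_cancel₀ hn0.ne', one_smul] at this
      rw [← this]
      match_scalars <;> field_simp <;> ring
    rw [← e6]
    exact hbij.mapsTo nu
  -- hence the off-diagonal corner vanishes
  have corner : ∀ r : R, (1 - p) * r * p = 0 := by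
    intro r
    set b := (1 - p) * r * p with hb
    have hqq : (1 - p) * (1 - p) = 1 - p := by
      simp only [mul_sub, sub_mul, mul_one, one_mul, hpp]; abel
    have hb1 : (1 - p) * b = b := by rw [hb, ← mul_assoc, ← mul_assoc, hqq]
    have hb2 : b * p = b := by rw [hb, mul_assoc, hpp]
    have nb : ∀ t : ℝ, ‖t • (b + star b)‖ ≤ 2⁻¹ * ‖(1 : R)‖ + 1 := by
      intro t
      have k := key (t • b) (by rw [mul_smul_comm, hb1]) (by rw [smul_mul_assoc, hb2])
      have k' := (CStarAlgebra.norm_le_one_iff_of_nonneg _ k.1).mpr k.2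
      have e : t • (b + star b) = ((2⁻¹ : ℝ) • (1 : R) + (t • b + star (t • b))) - (2⁻¹ : ℝ) • (1 : R) := by
        simp
      rw [e]
      refine (norm_sub_le _ _).trans ?_
      rw [norm_smul]
      norm_num at *
      linarith
    have c0 : b + star b = 0 := by
      by_contra hne
      have hpos : 0 < ‖b + star b‖ := norm_pos_iff.mpr hne
      have := nb ((2⁻¹ * ‖(1 : R)‖ + 2) / ‖b + star b‖)
      rw [norm_smul, Real.norm_of_nonneg (by positivity), div_mul_cancel₀ _ hpos.ne'] at this
      linarith
    have sb1 : star b = p * star b := by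
      have := congrArg star hb2
      rw [star_mul, hp.star_eq] at this
      exact this.symm
    have : (1 - p) * (b + star b) = 0 := by rw [c0, mul_zero]
    rw [mul_add, hb1, sb1, ← mul_assoc, sub_mul, one_mul, hpp, sub_self, zero_mul, add_zero] at this
    exact this
  rw [← hpdef]
  rcases prime _ _ corner with h | h
  · right; exact (sub_eq_zero.mp h).symm
  · left; exact h

theorem abstract_main (prime : ∀ x y : R, (∀ r, x * r * y = 0) → x = 0 ∨ y = 0)
    (φ : R → R) (hbij : Set.BijOn φ (Set.Icc 0 1) (Set.Icc 0 1))
    (haff : ∀ x ∈ Set.Icc (0 : R) 1, ∀ y ∈ Set.Icc (0 : R) 1, ∀ t : ℝ, t ∈ Set.Icc (0 : ℝ) 1 →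
      φ (t • x + (1 - t) • y) = t • φ x + (1 - t) • φ y) :
    ∃ L : R →ₗ[ℂ] R, Function.Bijective L ∧ (∀ x, L (star x) = star (L x)) ∧
      ((∀ x y, L (x * y) = L x * L y) ∨ (∀ x y, L (x * y) = L y * L x)) ∧
      ((∀ x ∈ Set.Icc (0 : R) 1, φ x = L x) ∨ (∀ x ∈ Set.Icc (0 : R) 1, φ x = L (1 - x))) := by
  have hc := compl_image φ hbij haff
  rcases image_zero prime φ hbij haff with h0 | h0
  · have h1 : φ 1 = 1 := by
      have := hc 0 zero_mem_eff
      rwa [sub_zero, h0, sub_zero] at this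
    obtain ⟨L, a, b, c, d⟩ := unital_case prime φ hbij h0 h1 haff
    exact ⟨L, a, b, c, Or.inl d⟩
  · have h1 : φ 1 = 0 := by
      have := hc 0 zero_mem_eff
      rwa [sub_zero, h0, sub_self] at this
    have hcb : Set.BijOn (fun x : R => 1 - x) (Set.Icc 0 1) (Set.Icc 0 1) := by
      refine ⟨fun x hx => compl_eff x hx, fun x _ y _ h => by simpa using h, fun y hy =>
        ⟨1 - y, compl_eff y hy, by simp⟩⟩
    obtain ⟨L, a, b, c, d⟩ := unital_case prime (fun x => φ (1 - x)) (hbij.comp hcb)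
      (by simpa using h1) (by simpa using h0) (by
        intro x hx y hy t ht
        have := haff (1 - x) (compl_eff x hx) (1 - y) (compl_eff y hy) t ht
        rw [← this]
        congr 1
        module)
    refine ⟨L, a, b, c, Or.inr fun x hx => ?_⟩
    have := d (1 - x) (compl_eff x hx)
    simpa using this
end
section
variable {H : Type*} [NormedAddCommGroup H] [InnerProductSpace ℂ H] [CompleteSpace H]

theorem factor_prime (𝓐 : VonNeumannAlgebra H)
    (hfactor : ∀ x ∈ 𝓐, (∀ y ∈ 𝓐, x * y = y * x) → ∃ c : ℂ, x = c • (1 : H →L[ℂ] H))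
    (x y : H →L[ℂ] H) (hy : y ∈ 𝓐) (h : ∀ r ∈ 𝓐, x * r * y = 0) : x = 0 ∨ y = 0 := by
  by_cases hy0 : y = 0
  · exact Or.inr hy0
  left
  let V : Set H := {v | ∃ a ∈ 𝓐, ∃ ξ, v = a (y ξ)}
  let K : Submodule ℂ H := (Submodule.span ℂ V).topologicalClosure
  have Kcl : IsClosed (K : Set H) := Submodule.isClosed_topologicalClosure _
  haveI : CompleteSpace K := Kcl.completeSpace_coe
  have Kmin : ∀ T : Submodule ℂ H, IsClosed (T : Set H) → (∀ v ∈ V, v ∈ T) → K ≤ T := by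
    intro T hT hv
    exact Submodule.topologicalClosure_minimal _ (Submodule.span_le.mpr hv) hT
  have VK : ∀ v ∈ V, v ∈ K := fun v hv =>
    Submodule.le_topologicalClosure _ (Submodule.subset_span hv)
  have Kinv : ∀ z : H →L[ℂ] H, (∀ v ∈ V, z v ∈ V) → K ∈ Module.End.invtSubmodule (z : H →ₗ[ℂ] H) := by
    intro z hz
    rw [Module.End.mem_invtSubmodule]
    apply Kmin
    · exact Kcl.preimage z.continuous
    · intro v hv
      exact VK _ (hz v hv)
  have hP : IsStarProjection K.starProjection := isStarProjection_starProjection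
  have hr : (K.starProjection : H →L[ℂ] H).range = K := Submodule.range_starProjection K
  have P1 : K.starProjection ∈ 𝓐 := by
    rw [VonNeumannAlgebra.IsStarProjection.mem_iff hP]
    intro z hz
    rw [hr]
    apply Kinv
    rintro v ⟨a, ha, ξ, rfl⟩
    rw [VonNeumannAlgebra.mem_commutant_iff] at hz
    refine ⟨a, ha, z ξ, ?_⟩
    have e1 := congrArg (fun T : H →L[ℂ] H => T (y ξ)) (hz a ha)
    have e2 := congrArg (fun T : H →L[ℂ] H => T ξ) (hz y hy)
    change a (z (y ξ)) = z (a (y ξ)) at e1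
    change y (z ξ) = z (y ξ) at e2
    rw [e2]; exact e1.symm
  have P2 : K.starProjection ∈ 𝓐.commutant := by
    rw [VonNeumannAlgebra.IsStarProjection.mem_iff hP]
    intro z hz
    rw [hr]
    rw [VonNeumannAlgebra.commutant_commutant] at hz
    apply Kinv
    rintro v ⟨a, ha, ξ, rfl⟩
    exact ⟨z * a, mul_mem hz ha, ξ, rfl⟩
  rw [VonNeumannAlgebra.mem_commutant_iff] at P2
  obtain ⟨c, hc⟩ := hfactor _ P1 (fun w hw => (P2 w hw).symm)
  obtain ⟨ξ, hξ⟩ : ∃ ξ, y ξ ≠ 0 := by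
    by_contra! hne
    exact hy0 (ContinuousLinearMap.ext hne)
  have yK : y ξ ∈ K := VK _ ⟨1, one_mem _, ξ, rfl⟩
  have e : K.starProjection (y ξ) = y ξ := Submodule.starProjection_eq_self_iff.mpr yK
  rw [hc] at e
  have c1 : c = 1 := by
    have : (c - 1) • y ξ = 0 := by
      rw [sub_smul, one_smul, sub_eq_zero]; simpa using e
    exact sub_eq_zero.mp ((smul_eq_zero.mp this).resolve_right hξ)
  rw [c1, one_smul] at hc
  have Kall : ∀ v, v ∈ K := by
    intro v
    rw [← Submodule.starProjection_eq_self_iff, hc]; rfl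
  have Kker : K ≤ LinearMap.ker (x : H →ₗ[ℂ] H) := by
    apply Kmin
    · exact ContinuousLinearMap.isClosed_ker x
    · rintro v ⟨a, ha, η, rfl⟩
      have := congrArg (fun T : H →L[ℂ] H => T η) (h a ha)
      simpa using this
  ext v
  exact Kker (Kall v)

theorem vn_closed (𝓐 : VonNeumannAlgebra H) :
    IsClosed (𝓐.toStarSubalgebra : Set (H →L[ℂ] H)) := by
  rw [VonNeumannAlgebra.coe_toStarSubalgebra, ← VonNeumannAlgebra.centralizer_centralizer]
  exact Set.isClosed_centralizer _

theorem vn_ordered (𝓐 : VonNeumannAlgebra H) : StarOrderedRing 𝓐.toStarSubalgebra := by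
  apply StarOrderedRing.of_nonneg_iff'
  · intro x y hxy z
    exact add_le_add_right (α := H →L[ℂ] H) hxy z
  · intro x
    constructor
    · intro hx
      have hx' : (0 : H →L[ℂ] H) ≤ (x : H →L[ℂ] H) := hx
      have mem : CFC.sqrt (x : H →L[ℂ] H) ∈ 𝓐 := by
        suffices CFC.sqrt (x : H →L[ℂ] H) ∈ 𝓐.commutant.commutant by
          simpa only [VonNeumannAlgebra.commutant_commutant] using this
        rw [VonNeumannAlgebra.mem_commutant_iff]
        intro g hg
        rw [VonNeumannAlgebra.mem_commutant_iff] at hg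
        have : Commute (x : H →L[ℂ] H) g := hg x x.2
        exact (this.cfcₙ_nnreal NNReal.sqrt).symm
      refine ⟨⟨CFC.sqrt (x : H →L[ℂ] H), mem⟩, ?_⟩
      apply Subtype.ext
      change (x : H →L[ℂ] H) = star (CFC.sqrt (x : H →L[ℂ] H)) * CFC.sqrt (x : H →L[ℂ] H)
      rw [(IsSelfAdjoint.of_nonneg (CFC.sqrt_nonneg (x : H →L[ℂ] H))).star_eq,
        CFC.sqrt_mul_sqrt_self _ hx']
    · rintro ⟨s, rfl⟩
      exact star_mul_self_nonneg (s : H →L[ℂ] H)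
end

/-- Affine bijections of the effect interval of a factor von Neumann algebra are implemented
by a *-automorphism or *-antiautomorphism, possibly composed with the orthocomplementation. -/
theorem affine_bijection_of_factor_effects
    {H : Type*} [NormedAddCommGroup H] [InnerProductSpace ℂ H] [CompleteSpace H]
    (𝓐 : VonNeumannAlgebra H)
    (hfactor : ∀ x ∈ 𝓐, (∀ y ∈ 𝓐, x * y = y * x) → ∃ c : ℂ, x = c • (1 : H →L[ℂ] H))
    (E : Set (H →L[ℂ] H)) (hE : E = {x : H →L[ℂ] H | x ∈ 𝓐 ∧ 0 ≤ x ∧ x ≤ 1})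
    (φ : (H →L[ℂ] H) → (H →L[ℂ] H))
    (hbij : Set.BijOn φ E E)
    (haff : ∀ x ∈ E, ∀ y ∈ E, ∀ t : ℝ, t ∈ Set.Icc (0 : ℝ) 1 →
      φ ((t : ℂ) • x + ((1 - t : ℝ) : ℂ) • y) = (t : ℂ) • φ x + ((1 - t : ℝ) : ℂ) • φ y) :
    ∃ Φ : (H →L[ℂ] H) → (H →L[ℂ] H),
      Set.BijOn Φ (𝓐 : Set (H →L[ℂ] H)) (𝓐 : Set (H →L[ℂ] H)) ∧
      (∀ x ∈ 𝓐, ∀ y ∈ 𝓐, Φ (x + y) = Φ x + Φ y) ∧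
      (∀ (c : ℂ), ∀ x ∈ 𝓐, Φ (c • x) = c • Φ x) ∧
      (∀ x ∈ 𝓐, Φ (star x) = star (Φ x)) ∧
      ((∀ x ∈ 𝓐, ∀ y ∈ 𝓐, Φ (x * y) = Φ x * Φ y) ∨
       (∀ x ∈ 𝓐, ∀ y ∈ 𝓐, Φ (x * y) = Φ y * Φ x)) ∧
      ((∀ x ∈ E, φ x = Φ x) ∨ (∀ x ∈ E, φ x = Φ (1 - x))) := by
  subst hE
  haveI := vn_closed 𝓐
  haveI := vn_ordered 𝓐
  let S := 𝓐.toStarSubalgebra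
  let E : Set (H →L[ℂ] H) := {x : H →L[ℂ] H | x ∈ 𝓐 ∧ 0 ≤ x ∧ x ≤ 1}
  have mem_iff : ∀ x : S, x ∈ Set.Icc (0 : S) 1 ↔ (x : H →L[ℂ] H) ∈ E := fun x =>
    ⟨fun h => ⟨x.2, h.1, h.2⟩, fun h => ⟨h.2.1, h.2.2⟩⟩
  classical
  let ψ : S → S := fun x => if h : φ x ∈ 𝓐 then ⟨φ x, h⟩ else 0
  have hψ : ∀ x : S, x ∈ Set.Icc (0 : S) 1 → ((ψ x : S) : H →L[ℂ] H) = φ x := by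
    intro x hx
    have : φ x ∈ 𝓐 := (hbij.mapsTo ((mem_iff x).mp hx)).1
    simp only [ψ, dif_pos this]
  have ψbij : Set.BijOn ψ (Set.Icc 0 1) (Set.Icc 0 1) := by
    refine ⟨fun x hx => ?_, fun x hx y hy hxy => ?_, fun y hy => ?_⟩
    · rw [mem_iff, hψ x hx]
      exact hbij.mapsTo ((mem_iff x).mp hx)
    · apply Subtype.ext
      apply hbij.injOn ((mem_iff x).mp hx) ((mem_iff y).mp hy)
      rw [← hψ x hx, ← hψ y hy, hxy]
    · obtain ⟨x, hx, hxy⟩ := hbij.surjOn ((mem_iff y).mp hy)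
      have hx' := (mem_iff ⟨x, hx.1⟩).mpr hx
      refine ⟨⟨x, hx.1⟩, hx', ?_⟩
      apply Subtype.ext
      rw [hψ _ hx']
      exact hxy
  have ψaff : ∀ x ∈ Set.Icc (0 : S) 1, ∀ y ∈ Set.Icc (0 : S) 1, ∀ t : ℝ, t ∈ Set.Icc (0 : ℝ) 1 →
      ψ (t • x + (1 - t) • y) = t • ψ x + (1 - t) • ψ y := by
    intro x hx y hy t ht
    apply Subtype.ext
    rw [hψ _ (convex_eff x y hx hy t ht)]
    have := haff x ((mem_iff x).mp hx) y ((mem_iff y).mp hy) t ht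
    simp only [Complex.coe_smul] at this
    change φ (t • (x : H →L[ℂ] H) + (1 - t) • (y : H →L[ℂ] H))
      = t • ((ψ x : S) : H →L[ℂ] H) + (1 - t) • ((ψ y : S) : H →L[ℂ] H)
    rw [hψ x hx, hψ y hy, this]
  have prime : ∀ x y : S, (∀ r, x * r * y = 0) → x = 0 ∨ y = 0 := by
    intro x y h
    have := factor_prime 𝓐 hfactor x y y.2
      (fun r hr => congrArg (Subtype.val) (h ⟨r, hr⟩))
    rcases this with h | h
    · exact Or.inl (Subtype.ext h)
    · exact Or.inr (Subtype.ext h)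
  obtain ⟨L, Lbij, Lstar, Lmul, Lφ⟩ := abstract_main prime ψ ψbij ψaff
  let Φ : (H →L[ℂ] H) → (H →L[ℂ] H) := fun x => if h : x ∈ 𝓐 then ((L ⟨x, h⟩ : S) : H →L[ℂ] H) else 0
  have hΦ : ∀ x (h : x ∈ 𝓐), Φ x = ((L ⟨x, h⟩ : S) : H →L[ℂ] H) := fun x h => by
    simp only [Φ, dif_pos h]
  have hΦ' : ∀ x : S, Φ x = ((L x : S) : H →L[ℂ] H) := fun x => hΦ x x.2
  refine ⟨Φ, ⟨?_, ?_, ?_⟩, ?_, ?_, ?_, ?_, ?_⟩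
  · intro x hx
    rw [hΦ x hx]
    exact (L ⟨x, hx⟩).2
  · intro x hx y hy hxy
    rw [hΦ x hx, hΦ y hy] at hxy
    exact congrArg Subtype.val (Lbij.1 (Subtype.ext hxy))
  · intro y hy
    obtain ⟨x, hx⟩ := Lbij.2 ⟨y, hy⟩
    refine ⟨x, x.2, ?_⟩
    rw [hΦ', hx]
  · intro x hx y hy
    have := congrArg Subtype.val (map_add L ⟨x, hx⟩ ⟨y, hy⟩)
    rw [hΦ x hx, hΦ y hy]
    exact (hΦ' (⟨x, hx⟩ + ⟨y, hy⟩)).trans this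
  · intro c x hx
    have := congrArg Subtype.val (map_smul L c ⟨x, hx⟩)
    rw [hΦ x hx]
    exact (hΦ' (c • ⟨x, hx⟩)).trans this
  · intro x hx
    have := congrArg Subtype.val (Lstar ⟨x, hx⟩)
    rw [hΦ x hx]
    exact (hΦ' (star ⟨x, hx⟩)).trans this
  · refine Lmul.imp (fun h => ?_) (fun h => ?_)
    · intro x hx y hy
      have := congrArg Subtype.val (h ⟨x, hx⟩ ⟨y, hy⟩)
      rw [hΦ x hx, hΦ y hy]
      exact (hΦ' (⟨x, hx⟩ * ⟨y, hy⟩)).trans this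
    · intro x hx y hy
      have := congrArg Subtype.val (h ⟨x, hx⟩ ⟨y, hy⟩)
      rw [hΦ x hx, hΦ y hy]
      exact (hΦ' (⟨x, hx⟩ * ⟨y, hy⟩)).trans this
  · refine Lφ.imp (fun h => ?_) (fun h => ?_)
    · intro x hx
      have hx' := (mem_iff ⟨x, hx.1⟩).mpr hx
      have := congrArg Subtype.val (h ⟨x, hx.1⟩ hx')
      rw [hψ _ hx'] at this
      rw [hΦ x hx.1]
      exact this
    · intro x hx
      have hx' := (mem_iff ⟨x, hx.1⟩).mpr hx
      have := congrArg Subtype.val (h ⟨x, hx.1⟩ hx')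
      rw [hψ _ hx'] at this
      exact this.trans (hΦ' (1 - ⟨x, hx.1⟩)).symm
end

section
/- Let H be a complex Hilbert space and let [0,I] denote the set of effects on H. If φ : [0,I] → [0,I] is a bijective affine map (i.e., φ(λA + (1−λ)B) = λφ(A) + (1−λ)φ(B) for all effects A, B and λ ∈ [0,1]), then there exists an operator U on H which is either unitary or antiunitary such that either φ(A) = U A U* for all A ∈ [0,I], or φ(A) = U(I − A)U* for all A ∈ [0,I]. -/
namespace EffAux
open scoped InnerProductSpace

section Wigner
variable {H : Type*} [NormedAddCommGroup H] [InnerProductSpace ℂ H]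

/-- Data of a ray-type relation, as in the theorem of Wigner. -/
structure RayRel (R : H → H → Prop) : Prop where
  tot : ∀ x, ∃ y, R x y
  sur : ∀ y, ∃ x, R x y
  hom : ∀ {x y}, R x y → ∀ c d : ℂ, ‖c‖ = ‖d‖ → R (c • x) (d • y)
  ip : ∀ {x y z w}, R x y → R z w → ‖⟪y, w⟫_ℂ‖ = ‖⟪x, z⟫_ℂ‖

lemma RayRel.norm {R : H → H → Prop} (hR : RayRel R) {x y : H} (h : R x y) : ‖y‖ = ‖x‖ := by
  have := hR.ip h h
  rw [inner_self_eq_norm_sq_to_K, inner_self_eq_norm_sq_to_K] at this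
  simp only [norm_pow, RCLike.norm_ofReal, abs_norm] at this
  exact (sq_eq_sq₀ (norm_nonneg _) (norm_nonneg _)).1 this

lemma unit_multiple {y w : H} (hn : ‖w‖ = ‖y‖) (h : ‖⟪y, w⟫_ℂ‖ = ‖y‖ * ‖y‖) :
    ∃ c : ℂ, ‖c‖ = 1 ∧ w = c • y := by
  by_cases hy : y = 0
  · subst hy
    refine ⟨1, by simp, ?_⟩
    simpa using hn
  · have hw : w ≠ 0 := by
      intro h0; apply hy; rw [h0, norm_zero] at hn; exact norm_eq_zero.1 hn.symm
    obtain ⟨c, hc, hcw⟩ := (norm_inner_eq_norm_iff (𝕜 := ℂ) hy hw).1 (by rw [h, hn])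
    refine ⟨c, ?_, hcw⟩
    rw [hcw, norm_smul] at hn
    have : ‖y‖ ≠ 0 := norm_ne_zero_iff.2 hy
    field_simp at hn
    exact hn

lemma RayRel.par {R : H → H → Prop} (hR : RayRel R) {x y w : H} (h : R x y)
    (hn : ‖w‖ = ‖y‖) (hi : ‖⟪y, w⟫_ℂ‖ = ‖y‖ * ‖y‖) : R x w := by
  obtain ⟨c, hc, rfl⟩ := unit_multiple hn hi
  simpa using hR.hom h 1 c (by simp [hc])

lemma RayRel.core {R : H → H → Prop} (hR : RayRel R) (s : ℂ →+* ℂ) [RingHomInvPair s s]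
    (hs : ∀ c, ‖s c‖ = ‖c‖)
    {e f : H} (he : ‖e‖ = 1) (G : H → H)
    (hG : ∀ x, ⟪e, x⟫_ℂ = 0 → R (e + x) (f + G x))
    (hG' : ∀ x, ⟪e, x⟫_ℂ = 0 → R x (G x))
    (hadd : ∀ x z, ⟪e, x⟫_ℂ = 0 → ⟪e, z⟫_ℂ = 0 → G (x + z) = G x + G z)
    (hsm : ∀ (c : ℂ) x, ⟪e, x⟫_ℂ = 0 → G (c • x) = s c • G x) :
    ∃ U : H ≃ₛₗᵢ[s] H, ∀ x, R x (U x) := by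
  have hee : ⟪e, e⟫_ℂ = 1 := by rw [inner_self_eq_norm_sq_to_K, he]; simp
  have hpe : ∀ v, ⟪e, v - ⟪e, v⟫_ℂ • e⟫_ℂ = 0 := by
    intro v; rw [inner_sub_right, inner_smul_right, hee]; ring
  let T : H → H := fun v => s ⟪e, v⟫_ℂ • f + G (v - ⟪e, v⟫_ℂ • e)
  have hTadd : ∀ v w, T (v + w) = T v + T w := by
    intro v w
    simp only [T]
    have : v + w - ⟪e, v + w⟫_ℂ • e = (v - ⟪e, v⟫_ℂ • e) + (w - ⟪e, w⟫_ℂ • e) := by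
      rw [inner_add_right]; module
    rw [this, hadd _ _ (hpe v) (hpe w), inner_add_right, map_add]
    module
  have hTsm : ∀ (c : ℂ) v, T (c • v) = s c • T v := by
    intro c v
    simp only [T]
    have : c • v - ⟪e, c • v⟫_ℂ • e = c • (v - ⟪e, v⟫_ℂ • e) := by
      rw [inner_smul_right]; module
    rw [this, hsm _ _ (hpe v), inner_smul_right, map_mul]
    module
  have hTR : ∀ v, R v (T v) := by
    intro v
    by_cases ha : ⟪e, v⟫_ℂ = 0
    · have := hG' v ha
      simpa [T, ha] using this
    · set a := ⟪e, v⟫_ℂ with hadef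
      have h1 : ⟪e, a⁻¹ • (v - a • e)⟫_ℂ = 0 := by
        rw [inner_smul_right, hpe v, mul_zero]
      have h2 := hR.hom (hG _ h1) a (s a) (hs a).symm
      rw [hsm _ _ (hpe v)] at h2
      have hsa : s a ≠ 0 := by
        intro h; apply ha; rw [← norm_eq_zero, ← hs, h, norm_zero]
      convert h2 using 1
      · rw [smul_add, smul_smul, mul_inv_cancel₀ ha]; module
      · simp only [T]
        rw [smul_add, smul_smul, map_inv₀, mul_inv_cancel₀ hsa, one_smul]
  let L : H →ₛₗ[s] H := { toFun := T, map_add' := hTadd, map_smul' := hTsm }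
  let I : H →ₛₗᵢ[s] H := { toLinearMap := L, norm_map' := fun x => hR.norm (hTR x) }
  have hsurj : Function.Surjective I := by
    intro w
    obtain ⟨v, hv⟩ := hR.sur w
    have h1 := hTR v
    have h2 := hR.ip h1 hv
    have h3 : ‖⟪v, v⟫_ℂ‖ = ‖T v‖ * ‖T v‖ := by
      rw [inner_self_eq_norm_sq_to_K, hR.norm h1]; simp [sq]
    obtain ⟨c, hc, hcw⟩ := unit_multiple (y := T v) (w := w)
      (by rw [hR.norm h1, hR.norm hv]) (by rw [h2, h3])
    refine ⟨s c • v, ?_⟩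
    show T (s c • v) = w
    rw [hTsm, RingHomInvPair.comp_apply_eq, hcw]
  exact ⟨LinearIsometryEquiv.ofSurjective I hsurj, fun x => hTR x⟩

theorem RayRel.wigner {R : H → H → Prop} (hR : RayRel R) :
    (∃ U : H ≃ₗᵢ[ℂ] H, ∀ x, R x (U x)) ∨
    (∃ U : H ≃ₛₗᵢ[starRingEnd ℂ] H, ∀ x, R x (U x)) := by
  rcases subsingleton_or_nontrivial H with hH | hH
  · left
    refine ⟨LinearIsometryEquiv.refl ℂ H, fun x => ?_⟩
    obtain ⟨y, hy⟩ := hR.tot x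
    rwa [Subsingleton.elim y (LinearIsometryEquiv.refl ℂ H x)] at hy
  obtain ⟨e, he⟩ := exists_norm_eq H (zero_le_one)
  obtain ⟨f, hef⟩ := hR.tot e
  have hee : ⟪e, e⟫_ℂ = 1 := by rw [inner_self_eq_norm_sq_to_K, he]; simp
  have hff : ⟪f, f⟫_ℂ = 1 := by rw [inner_self_eq_norm_sq_to_K, hR.norm hef, he]; simp
  have hex : ∀ x, ∃ g, ⟪e, x⟫_ℂ = 0 → (⟪f, g⟫_ℂ = 0 ∧ R (e + x) (f + g)) := by
    intro x
    by_cases hx : ⟪e, x⟫_ℂ = 0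
    · obtain ⟨y, hy⟩ := hR.tot (e + x)
      have h1 := hR.ip hef hy
      rw [inner_add_right, hee, hx, add_zero, norm_one] at h1
      have hc : ⟪f, y⟫_ℂ ≠ 0 := by intro h; rw [h] at h1; simp at h1
      refine ⟨(⟪f, y⟫_ℂ)⁻¹ • y - f, fun _ => ⟨?_, ?_⟩⟩
      · rw [inner_sub_right, inner_smul_right, inv_mul_cancel₀ hc, hff, sub_self]
      · have := hR.hom hy 1 (⟪f, y⟫_ℂ)⁻¹ (by simp [h1])
        rw [add_sub_cancel]
        simpa using this
    · exact ⟨0, fun h => absurd h hx⟩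
  choose G hG using hex
  have hGR : ∀ x, ⟪e, x⟫_ℂ = 0 → R (e + x) (f + G x) := fun x hx => (hG x hx).2
  have hGf : ∀ x, ⟪e, x⟫_ℂ = 0 → ⟪f, G x⟫_ℂ = 0 := fun x hx => (hG x hx).1
  have hab : ∀ x z, ⟪e, x⟫_ℂ = 0 → ⟪e, z⟫_ℂ = 0 → ‖1 + ⟪G x, G z⟫_ℂ‖ = ‖1 + ⟪x, z⟫_ℂ‖ := by
    intro x z hx hz
    have := hR.ip (hGR x hx) (hGR z hz)
    have h1 : ⟪x, e⟫_ℂ = 0 := inner_eq_zero_symm.1 hx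
    have h2 : ⟪G x, f⟫_ℂ = 0 := inner_eq_zero_symm.1 (hGf x hx)
    simpa [inner_add_left, inner_add_right, hee, hff, hx, hz, hGf x hx, hGf z hz, h1, h2,
      -inner_self_eq_norm_sq_to_K] using this
  have hGn : ∀ x, ⟪e, x⟫_ℂ = 0 → ‖G x‖ = ‖x‖ := by
    intro x hx
    have := hab x x hx hx
    rw [inner_self_eq_norm_sq_to_K, inner_self_eq_norm_sq_to_K] at this
    have k : ∀ r : ℝ, ‖(1 : ℂ) + ((r : ℂ)) ^ 2‖ = 1 + r ^ 2 := by
      intro r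
      rw [show (1 : ℂ) + (r : ℂ) ^ 2 = ((1 + r ^ 2 : ℝ) : ℂ) by push_cast; ring,
        Complex.norm_real, Real.norm_of_nonneg (by positivity)]
    have h3 : 1 + ‖G x‖ ^ 2 = 1 + ‖x‖ ^ 2 := by
      rw [← k, ← k]; exact this
    exact (sq_eq_sq₀ (norm_nonneg _) (norm_nonneg _)).1 (by linarith)
  have hGR' : ∀ x, ⟪e, x⟫_ℂ = 0 → R x (G x) := by
    intro x hx
    obtain ⟨y, hy⟩ := hR.tot x
    have h1 : ⟪f, y⟫_ℂ = 0 := by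
      rw [← norm_eq_zero, hR.ip hef hy, hx, norm_zero]
    have h2 := hR.ip hy (hGR x hx)
    rw [inner_add_right, inner_eq_zero_symm.1 h1, zero_add, inner_add_right,
      inner_eq_zero_symm.1 hx, zero_add] at h2
    refine hR.par hy (by rw [hGn x hx, hR.norm hy]) ?_
    rw [h2, inner_self_eq_norm_sq_to_K, hR.norm hy]; simp [sq]
  have hre : ∀ x z, ⟪e, x⟫_ℂ = 0 → ⟪e, z⟫_ℂ = 0 → (⟪G x, G z⟫_ℂ).re = (⟪x, z⟫_ℂ).re := by
    intro x z hx hz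
    have h1 := hab x z hx hz
    have h2 := hR.ip (hGR' x hx) (hGR' z hz)
    have k : ∀ c : ℂ, ‖1 + c‖ ^ 2 = 1 + 2 * c.re + ‖c‖ ^ 2 := by
      intro c
      rw [Complex.sq_norm, Complex.sq_norm, Complex.normSq_apply, Complex.normSq_apply]
      simp; ring
    have h3 := k ⟪G x, G z⟫_ℂ
    rw [h1, h2, k] at h3
    linarith
  have hre0 : ∀ w : H, (⟪w, w⟫_ℂ).re = 0 → w = 0 := by
    intro w hw
    have : RCLike.re ⟪w, w⟫_ℂ = ‖w‖ ^ 2 := inner_self_eq_norm_sq w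
    rw [RCLike.re_eq_complex_re, hw] at this
    exact norm_eq_zero.1 (pow_eq_zero_iff two_ne_zero |>.1 this.symm)
  have hoadd : ∀ x z, ⟪e, x⟫_ℂ = 0 → ⟪e, z⟫_ℂ = 0 → ⟪e, x + z⟫_ℂ = 0 := by
    intro x z hx hz; rw [inner_add_right, hx, hz, add_zero]
  have hosm : ∀ (c : ℂ) x, ⟪e, x⟫_ℂ = 0 → ⟪e, c • x⟫_ℂ = 0 := by
    intro c x hx; rw [inner_smul_right, hx, mul_zero]
  have hadd : ∀ x z, ⟪e, x⟫_ℂ = 0 → ⟪e, z⟫_ℂ = 0 → G (x + z) = G x + G z := by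
    intro x z hx hz
    have hxz := hoadd x z hx hz
    rw [← sub_eq_zero]
    apply hre0
    simp only [inner_sub_left, inner_sub_right, inner_add_left, inner_add_right, Complex.sub_re,
      Complex.add_re, hre _ _ hxz hxz, hre _ _ hxz hx, hre _ _ hxz hz, hre _ _ hx hxz,
      hre _ _ hz hxz, hre _ _ hx hx, hre _ _ hx hz, hre _ _ hz hx, hre _ _ hz hz]
    ring
  have hrsm : ∀ (r : ℝ) x, ⟪e, x⟫_ℂ = 0 → G ((r : ℂ) • x) = (r : ℂ) • G x := by
    intro r x hx
    have hrx := hosm r x hx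
    rw [← sub_eq_zero]
    apply hre0
    simp only [inner_sub_left, inner_sub_right, inner_smul_left, inner_smul_right, Complex.sub_re,
      Complex.conj_ofReal, Complex.re_ofReal_mul, hre _ _ hrx hrx, hre _ _ hrx hx,
      hre _ _ hx hrx, hre _ _ hx hx]
    ring
  have hI : ∀ x, ⟪e, x⟫_ℂ = 0 →
      G (Complex.I • x) = Complex.I • G x ∨ G (Complex.I • x) = -(Complex.I • G x) := by
    intro x hx
    have hix := hosm Complex.I x hx
    have h1 := hR.ip (hGR' x hx) (hGR' _ hix)
    rw [inner_smul_right, inner_self_eq_norm_sq_to_K] at h1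
    obtain ⟨c, hc, hcw⟩ := unit_multiple (y := G x) (w := G (Complex.I • x))
      (by rw [hGn _ hix, hGn x hx, norm_smul]; simp) (by rw [h1, hGn x hx]; simp [sq])
    have h2 := hre _ _ hx hix
    rw [hcw, inner_smul_right, inner_smul_right, inner_self_eq_norm_sq_to_K,
      inner_self_eq_norm_sq_to_K, hGn x hx] at h2
    by_cases hx0 : x = 0
    · left
      have : G x = 0 := by rw [← norm_eq_zero, hGn x hx, hx0, norm_zero]
      rw [hcw, this]; simp
    · have hxn : ‖x‖ ≠ 0 := norm_ne_zero_iff.2 hx0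
      have h3 : c.re = 0 := by
        have h4 : (c * ((‖x‖ ^ 2 : ℝ) : ℂ)).re = (Complex.I * ((‖x‖ ^ 2 : ℝ) : ℂ)).re := by
          push_cast; exact h2
        rw [Complex.re_mul_ofReal, Complex.re_mul_ofReal] at h4
        simpa [hxn] using h4
      have h5 : c.im = 1 ∨ c.im = -1 := by
        have : ‖c‖ ^ 2 = 1 := by rw [hc]; norm_num
        rw [Complex.sq_norm, Complex.normSq_apply, h3] at this
        have : c.im ^ 2 = 1 := by linarith
        simpa using this
      rcases h5 with h5 | h5
      · left
        rw [hcw]; congr 1; apply Complex.ext <;> simp [h3, h5]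
      · right
        rw [hcw, ← neg_smul]; congr 1; apply Complex.ext <;> simp [h3, h5]
  have hcsm : ∀ (c : ℂ) x, ⟪e, x⟫_ℂ = 0 →
      G (c • x) = (c.re : ℂ) • G x + (c.im : ℂ) • G (Complex.I • x) := by
    intro c x hx
    have hix := hosm Complex.I x hx
    conv_lhs => rw [← Complex.re_add_im c, add_smul, mul_smul]
    rw [hadd _ _ (hosm _ _ hx) (hosm _ _ hix), hrsm _ _ hx, hrsm _ _ hix]
  by_cases hall : ∀ x, ⟪e, x⟫_ℂ = 0 → G (Complex.I • x) = Complex.I • G x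
  · left
    refine hR.core (RingHom.id ℂ) (fun c => rfl) he G hGR hGR' hadd ?_
    intro c x hx
    rw [hcsm c x hx, hall x hx, smul_smul, ← add_smul, Complex.re_add_im]; rfl
  · right
    refine hR.core (starRingEnd ℂ) (fun c => by simp) he G hGR hGR' hadd ?_
    intro c x hx
    have key : G (Complex.I • x) = -(Complex.I • G x) := by
      push Not at hall
      obtain ⟨z, hz, hz'⟩ := hall
      have hz2 := (hI z hz).resolve_left hz'
      by_contra hcon
      have hx2 := (hI x hx).resolve_right hcon
      have hs := hadd _ _ (hosm Complex.I x hx) (hosm Complex.I z hz)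
      rw [← smul_add, hx2, hz2] at hs
      rcases hI _ (hoadd x z hx hz) with h | h
      · rw [h, hadd x z hx hz, smul_add, add_right_inj] at hs
        exact hz' (by rw [hz2]; exact hs.symm)
      · rw [h, hadd x z hx hz, smul_add, neg_add, add_left_inj] at hs
        exact hcon (by rw [hx2]; exact hs.symm)
    rw [hcsm c x hx, key, smul_neg, smul_smul, ← sub_eq_add_neg, ← sub_smul]
    congr 1
    apply Complex.ext <;> simp
end Wigner
section Effects
variable {H : Type*} [NormedAddCommGroup H] [InnerProductSpace ℂ H]

/-- The real quadratic form of an operator. -/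
noncomputable def q (A : H →L[ℂ] H) (v : H) : ℝ := (⟪A v, v⟫_ℂ).re

lemma q_add (A B : H →L[ℂ] H) (v : H) : q (A + B) v = q A v + q B v := by
  simp [q]
lemma q_sub (A B : H →L[ℂ] H) (v : H) : q (A - B) v = q A v - q B v := by
  simp [q]
lemma q_smul (t : ℝ) (A : H →L[ℂ] H) (v : H) : q (t • A) v = t * q A v := by
  simp only [q, smul_apply]
  rw [← Complex.coe_smul, inner_smul_left]; simp
lemma q_zero (v : H) : q (0 : H →L[ℂ] H) v = 0 := by simp [q]
lemma q_one (v : H) : q (1 : H →L[ℂ] H) v = ‖v‖ ^ 2 := by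
  simp only [q, one_apply_eq_self]
  exact inner_self_eq_norm_sq (𝕜 := ℂ) v
lemma re_self (v : H) : (⟪v, v⟫_ℂ).re = ‖v‖ ^ 2 := inner_self_eq_norm_sq (𝕜 := ℂ) v

/-- The rank one projection onto the span of `x` (zero if `x = 0`). -/
noncomputable def pr (x : H) : H →L[ℂ] H := (‖x‖ ^ 2)⁻¹ • InnerProductSpace.rankOne ℂ x x

lemma pr_apply (x v : H) : pr x v = (((‖x‖ ^ 2)⁻¹ : ℝ) : ℂ) • ⟪x, v⟫_ℂ • x := by
  simp [pr, ← Complex.coe_smul]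

lemma pr_zero : pr (0 : H) = 0 := by simp [pr]

lemma q_pr (x v : H) : q (pr x) v = ‖⟪x, v⟫_ℂ‖ ^ 2 / ‖x‖ ^ 2 := by
  rw [pr, q_smul, q, InnerProductSpace.rankOne_apply, inner_smul_left,
    ← Complex.normSq_eq_conj_mul_self, Complex.ofReal_re, Complex.normSq_eq_norm_sq]
  ring

lemma pr_smul {c : ℂ} (hc : c ≠ 0) (x : H) : pr (c • x) = pr x := by
  ext v
  simp only [pr_apply, norm_smul, inner_smul_left, smul_smul]
  congr 1
  have : ((‖c‖ : ℂ)) ^ 2 = (starRingEnd ℂ) c * c := by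
    rw [← Complex.normSq_eq_conj_mul_self, Complex.normSq_eq_norm_sq]; push_cast; rfl
  push_cast
  rw [mul_pow, this]
  have h2 : (starRingEnd ℂ) c ≠ 0 := by simpa using hc
  by_cases hx : x = 0
  · simp [hx]
  have hx' : (‖x‖ : ℂ) ≠ 0 := by simpa using hx
  field_simp

variable [CompleteSpace H]

lemma le_iff_q {A B : H →L[ℂ] H} (hA : IsSelfAdjoint A) (hB : IsSelfAdjoint B) :
    A ≤ B ↔ ∀ v, q A v ≤ q B v := by
  rw [ContinuousLinearMap.le_def, ContinuousLinearMap.isPositive_def']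
  constructor
  · intro h v
    have := h.2 v
    have h2 : q (B - A) v = (B - A).reApplyInnerSelf v := rfl
    rw [← h2, q_sub] at this
    linarith
  · intro h
    refine ⟨hB.sub hA, fun v => ?_⟩
    have h2 : q (B - A) v = (B - A).reApplyInnerSelf v := rfl
    rw [← h2, q_sub]
    linarith [h v]

lemma ext_q {A B : H →L[ℂ] H} (hA : IsSelfAdjoint A) (hB : IsSelfAdjoint B)
    (h : ∀ v, q A v = q B v) : A = B :=
  le_antisymm ((le_iff_q hA hB).2 fun v => (h v).le) ((le_iff_q hB hA).2 fun v => (h v).ge)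

/-- Effects. -/
def Eff (A : H →L[ℂ] H) : Prop := 0 ≤ A ∧ A ≤ 1

lemma Eff.sa {A : H →L[ℂ] H} (h : Eff A) : IsSelfAdjoint A :=
  ((ContinuousLinearMap.nonneg_iff_isPositive A).1 h.1).isSelfAdjoint

lemma sa_one : IsSelfAdjoint (1 : H →L[ℂ] H) := IsSelfAdjoint.one _
lemma sa_zero : IsSelfAdjoint (0 : H →L[ℂ] H) := IsSelfAdjoint.zero _

lemma eff_iff {A : H →L[ℂ] H} :
    Eff A ↔ IsSelfAdjoint A ∧ ∀ v, 0 ≤ q A v ∧ q A v ≤ ‖v‖ ^ 2 := by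
  constructor
  · intro h
    refine ⟨h.sa, fun v => ⟨?_, ?_⟩⟩
    · have := (le_iff_q sa_zero h.sa).1 h.1 v
      rwa [q_zero] at this
    · have := (le_iff_q h.sa sa_one).1 h.2 v
      rwa [q_one] at this
  · rintro ⟨h, h'⟩
    exact ⟨(le_iff_q sa_zero h).2 fun v => by rw [q_zero]; exact (h' v).1,
      (le_iff_q h sa_one).2 fun v => by rw [q_one]; exact (h' v).2⟩

lemma Eff.nn {A : H →L[ℂ] H} (h : Eff A) (v : H) : 0 ≤ q A v := ((eff_iff.1 h).2 v).1
lemma Eff.le {A : H →L[ℂ] H} (h : Eff A) (v : H) : q A v ≤ ‖v‖ ^ 2 := ((eff_iff.1 h).2 v).2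

lemma eff_zero : Eff (0 : H →L[ℂ] H) :=
  eff_iff.2 ⟨sa_zero, fun v => by rw [q_zero]; exact ⟨le_rfl, by positivity⟩⟩
lemma eff_one : Eff (1 : H →L[ℂ] H) :=
  eff_iff.2 ⟨sa_one, fun v => by rw [q_one]; exact ⟨by positivity, le_rfl⟩⟩

lemma sa_smul (t : ℝ) {A : H →L[ℂ] H} (h : IsSelfAdjoint A) : IsSelfAdjoint (t • A) :=
  (IsSelfAdjoint.all t).smul h

lemma Eff.compl {A : H →L[ℂ] H} (h : Eff A) : Eff (1 - A) :=
  eff_iff.2 ⟨sa_one.sub h.sa, fun v => by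
    rw [q_sub, q_one]; exact ⟨by linarith [h.le v], by linarith [h.nn v]⟩⟩

lemma Eff.comb {A B : H →L[ℂ] H} (hA : Eff A) (hB : Eff B) {s t : ℝ} (hs : 0 ≤ s) (ht : 0 ≤ t)
    (hst : s + t ≤ 1) : Eff (s • A + t • B) :=
  eff_iff.2 ⟨(sa_smul s hA.sa).add (sa_smul t hB.sa), fun v => by
    rw [q_add, q_smul, q_smul]
    have h1 := mul_nonneg hs (hA.nn v)
    have h2 := mul_nonneg ht (hB.nn v)
    have h3 := mul_le_mul_of_nonneg_left (hA.le v) hs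
    have h4 := mul_le_mul_of_nonneg_left (hB.le v) ht
    have h5 := mul_le_mul_of_nonneg_right hst (sq_nonneg ‖v‖)
    constructor <;> linarith⟩

lemma Eff.smul {A : H →L[ℂ] H} (hA : Eff A) {s : ℝ} (hs : 0 ≤ s) (hs1 : s ≤ 1) :
    Eff (s • A) := by
  simpa using hA.comb eff_zero (t := 0) hs le_rfl (by linarith)

lemma Eff.sub {A B : H →L[ℂ] H} (hA : Eff A) (hB : Eff B) (h : A ≤ B) : Eff (B - A) :=
  eff_iff.2 ⟨hB.sa.sub hA.sa, fun v => by
    have := (le_iff_q hA.sa hB.sa).1 h v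
    rw [q_sub]; exact ⟨by linarith, by linarith [hA.nn v, hB.le v]⟩⟩

lemma pr_sa (x : H) : IsSelfAdjoint (pr x) := by
  apply sa_smul
  rw [ContinuousLinearMap.isSelfAdjoint_iff_isSymmetric]
  exact InnerProductSpace.isSymmetric_rankOne_self x

lemma pr_eff (x : H) : Eff (pr x) := by
  refine eff_iff.2 ⟨pr_sa x, fun v => ?_⟩
  rw [q_pr]
  refine ⟨by positivity, ?_⟩
  by_cases hx : x = 0
  · simp [hx]
  have hx' : 0 < ‖x‖ := norm_pos_iff.2 hx
  rw [div_le_iff₀ (by positivity), ← mul_pow, mul_comm ‖v‖]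
  gcongr
  exact norm_inner_le_norm x v

lemma q_pr_self (x : H) : q (pr x) x = ‖x‖ ^ 2 := by
  rw [q_pr, inner_self_eq_norm_sq_to_K]
  by_cases hx : x = 0
  · simp [hx]
  have hx' : 0 < ‖x‖ := norm_pos_iff.2 hx
  simp
  field_simp

lemma sa_inner {A : H →L[ℂ] H} (h : IsSelfAdjoint A) (u v : H) : ⟪A u, v⟫_ℂ = ⟪u, A v⟫_ℂ :=
  (ContinuousLinearMap.isSelfAdjoint_iff_isSymmetric.1 h) u v

lemma exists_sqrt {A : H →L[ℂ] H} (h : 0 ≤ A) :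
    ∃ S : H →L[ℂ] H, (∀ u v, ⟪A u, v⟫_ℂ = ⟪S u, S v⟫_ℂ) ∧ (∀ v, q A v = ‖S v‖ ^ 2) ∧
      ∀ u, A u = S (S u) := by
  have h1 : CFC.sqrt A * CFC.sqrt A = A := CFC.sqrt_mul_sqrt_self A h
  have h2 : IsSelfAdjoint (CFC.sqrt A) :=
    ((ContinuousLinearMap.nonneg_iff_isPositive _).1 (CFC.sqrt_nonneg A)).isSelfAdjoint
  have h0 : ∀ u, A u = CFC.sqrt A (CFC.sqrt A u) := fun u => by
    conv_lhs => rw [← h1]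
    rfl
  have h3 : ∀ u v, ⟪A u, v⟫_ℂ = ⟪CFC.sqrt A u, CFC.sqrt A v⟫_ℂ := by
    intro u v
    rw [h0, sa_inner h2]
  refine ⟨CFC.sqrt A, h3, fun v => ?_, h0⟩
  rw [q, h3, re_self]

lemma cs {A : H →L[ℂ] H} (h : 0 ≤ A) (u v : H) : ‖⟪A u, v⟫_ℂ‖ ^ 2 ≤ q A u * q A v := by
  obtain ⟨S, h1, h2, -⟩ := exists_sqrt h
  rw [h1, h2, h2, ← mul_pow]
  gcongr
  exact norm_inner_le_norm _ _

lemma eq_zero_of_q {A : H →L[ℂ] H} (h : 0 ≤ A) {v : H} (hv : q A v = 0) : A v = 0 := by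
  obtain ⟨S, -, h2, h3⟩ := exists_sqrt h
  rw [h2] at hv
  have : S v = 0 := by simpa using hv
  rw [h3, this, map_zero]

/-- Below a rank one projection there are only its multiples. -/
lemma below_pr {x : H} (hx : x ≠ 0) {B : H →L[ℂ] H} (hB : Eff B) (hle : B ≤ pr x) :
    ∃ t : ℝ, 0 ≤ t ∧ t ≤ 1 ∧ B = t • pr x := by
  have hx' : 0 < ‖x‖ := norm_pos_iff.2 hx
  refine ⟨q B x / ‖x‖ ^ 2, div_nonneg (hB.nn x) (by positivity),
    (div_le_one (by positivity)).2 (hB.le x), ?_⟩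
  refine ext_q hB.sa (sa_smul _ (pr_sa x)) fun v => ?_
  set α : ℂ := ⟪x, v⟫_ℂ / (‖x‖ : ℂ) ^ 2 with hα
  have hxc : (‖x‖ : ℂ) ≠ 0 := by simpa using hx
  have h1 : ⟪x, v - α • x⟫_ℂ = 0 := by
    rw [inner_sub_right, inner_smul_right, inner_self_eq_norm_sq_to_K, hα]
    simp only [Complex.coe_algebraMap]
    field_simp
    ring
  have h2 : q B (v - α • x) = 0 := by
    apply le_antisymm _ (hB.nn _)
    have := (le_iff_q hB.sa (pr_sa x)).1 hle (v - α • x)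
    rw [q_pr, h1] at this
    simpa using this
  have h3 := eq_zero_of_q hB.1 h2
  rw [map_sub, map_smul, sub_eq_zero] at h3
  rw [q_smul, q_pr, q, h3, inner_smul_left, sa_inner hB.sa, h3, inner_smul_right, ← mul_assoc,
    ← Complex.normSq_eq_conj_mul_self, ← sa_inner hB.sa, Complex.re_ofReal_mul,
    Complex.normSq_eq_norm_sq, hα, norm_div, norm_pow, Complex.norm_real, norm_norm, q]
  field_simp

lemma bound {A : H →L[ℂ] H} (hA : Eff A) {x : H} (hx : x ≠ 0) {ε : ℝ} (hε : 0 < ε) (v : H) :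
    ε / (1 + ε) * q A v ≤ ε * (q A x / ‖x‖ ^ 2) * q (pr x) v + (‖v‖ ^ 2 - q (pr x) v) := by
  have hx' : 0 < ‖x‖ := norm_pos_iff.2 hx
  have hxc : (‖x‖ : ℂ) ≠ 0 := by simpa using hx
  obtain ⟨S, -, h2, -⟩ := exists_sqrt hA.1
  set α : ℂ := ⟪x, v⟫_ℂ / (‖x‖ : ℂ) ^ 2 with hα
  have h1 : ⟪x, v - α • x⟫_ℂ = 0 := by
    rw [inner_sub_right, inner_smul_right, inner_self_eq_norm_sq_to_K, hα]
    simp only [Complex.coe_algebraMap]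
    field_simp
    ring
  set w := v - α • x with hw
  have hv : v = α • x + w := by rw [hw]; abel
  have hP : q (pr x) v = ‖α‖ ^ 2 * ‖x‖ ^ 2 := by
    rw [q_pr, hα, norm_div, norm_pow, Complex.norm_real, norm_norm]
    field_simp
  have hvn : ‖v‖ ^ 2 = ‖α‖ ^ 2 * ‖x‖ ^ 2 + ‖w‖ ^ 2 := by
    have := norm_add_sq_eq_norm_sq_add_norm_sq_of_inner_eq_zero (𝕜 := ℂ) (α • x) w
      (by rw [inner_smul_left, h1, mul_zero])
    rw [← hv, norm_smul] at this
    nlinarith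
  have hw1 : ‖S w‖ ^ 2 ≤ ‖w‖ ^ 2 := by rw [← h2]; exact hA.le w
  have hSv : ‖S v‖ ≤ ‖α‖ * ‖S x‖ + ‖S w‖ := by
    rw [hv, map_add, map_smul, ← norm_smul]; exact norm_add_le _ _
  rw [hP, hvn, h2, h2]
  set a := ‖α‖ * ‖S x‖ with ha
  set b := ‖S w‖
  have hab : ‖S v‖ ^ 2 ≤ (a + b) ^ 2 := by gcongr
  have e1 : ε * (‖S x‖ ^ 2 / ‖x‖ ^ 2) * (‖α‖ ^ 2 * ‖x‖ ^ 2) = ε * a ^ 2 := by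
    rw [ha]; field_simp
  rw [e1, div_mul_eq_mul_div, div_le_iff₀ (by linarith)]
  have : ε * (a + b) ^ 2 ≤ (ε * a ^ 2 + b ^ 2) * (1 + ε) := by
    nlinarith [sq_nonneg (ε * a - b)]
  nlinarith [mul_le_mul_of_nonneg_left hab hε.le]

end Effects

section Maps
variable {H : Type*} [NormedAddCommGroup H] [InnerProductSpace ℂ H] [CompleteSpace H]

lemma lim_helper {a b d : ℝ} (hb : 0 ≤ b) (h : ∀ ε : ℝ, 0 < ε → ε ≤ 1 → d ≤ a + ε * b) :
    d ≤ a := by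
  apply le_of_forall_pos_le_add
  intro δ hδ
  have h1 : 0 < δ / (b + 1) := by positivity
  have h2 := h (min 1 (δ / (b + 1))) (lt_min one_pos h1) (min_le_left _ _)
  have h3 : min 1 (δ / (b + 1)) * b ≤ δ / (b + 1) * (b + 1) := by
    apply mul_le_mul (min_le_right _ _) (by linarith) hb h1.le
  rw [div_mul_cancel₀ _ (by linarith)] at h3
  linarith

/-- A pair of mutually inverse affine maps between effects. -/
structure AB (φ ψ : (H →L[ℂ] H) → (H →L[ℂ] H)) : Prop where
  mφ : ∀ {A}, Eff A → Eff (φ A)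
  mψ : ∀ {A}, Eff A → Eff (ψ A)
  l : ∀ {A}, Eff A → ψ (φ A) = A
  r : ∀ {A}, Eff A → φ (ψ A) = A
  aφ : ∀ {A B}, Eff A → Eff B → ∀ t : ℝ, 0 ≤ t → t ≤ 1 →
    φ (t • A + (1 - t) • B) = t • φ A + (1 - t) • φ B
  aψ : ∀ {A B}, Eff A → Eff B → ∀ t : ℝ, 0 ≤ t → t ≤ 1 →
    ψ (t • A + (1 - t) • B) = t • ψ A + (1 - t) • ψ B

variable {φ ψ : (H →L[ℂ] H) → (H →L[ℂ] H)}

lemma AB.symm (h : AB φ ψ) : AB ψ φ := ⟨h.mψ, h.mφ, h.r, h.l, h.aψ, h.aφ⟩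

lemma AB.comb (h : AB φ ψ) {A B C D : H →L[ℂ] H} (hA : Eff A) (hB : Eff B) (hC : Eff C)
    (hD : Eff D) {s t u v : ℝ} (hs : 0 ≤ s) (ht : 0 ≤ t) (hu : 0 ≤ u) (hv : 0 ≤ v)
    (hst : 0 < s + t) (huv : s + t = u + v) (e : s • A + t • B = u • C + v • D) :
    s • φ A + t • φ B = u • φ C + v • φ D := by
  have h1 := h.aφ hA hB (s / (s + t)) (by positivity) (by rw [div_le_one hst]; linarith)
  have h2 := h.aφ hC hD (u / (s + t)) (by positivity) (by rw [div_le_one hst]; linarith)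
  have e1 : 1 - s / (s + t) = (s + t)⁻¹ * t := by field_simp; ring
  have e2 : 1 - u / (s + t) = (s + t)⁻¹ * v := by field_simp; linarith
  have e3 : s / (s + t) = (s + t)⁻¹ * s := by field_simp
  have e4 : u / (s + t) = (s + t)⁻¹ * u := by field_simp
  rw [e1, e3, mul_smul, mul_smul, mul_smul, mul_smul, ← smul_add, ← smul_add] at h1
  rw [e2, e4, mul_smul, mul_smul, mul_smul, mul_smul, ← smul_add, ← smul_add] at h2
  rw [e, h2] at h1
  exact (smul_right_injective _ (inv_ne_zero hst.ne') h1).symm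

lemma AB.zero_symm (h : AB φ ψ) (h0 : φ 0 = 0) : ψ 0 = 0 := by
  have := h.l eff_zero
  rwa [h0] at this

lemma AB.add (h : AB φ ψ) (h0 : φ 0 = 0) {A B : H →L[ℂ] H} (hA : Eff A) (hB : Eff B)
    (hAB : Eff (A + B)) : φ (A + B) = φ A + φ B := by
  have := h.comb hAB eff_zero hA hB (s := 1) (t := 1) (u := 1) (v := 1) (by norm_num)
    (by norm_num) (by norm_num) (by norm_num) (by norm_num) (by norm_num) (by simp)
  simpa [h0] using this

lemma AB.smul (h : AB φ ψ) (h0 : φ 0 = 0) {A : H →L[ℂ] H} (hA : Eff A) {t : ℝ} (ht : 0 ≤ t)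
    (ht1 : t ≤ 1) : φ (t • A) = t • φ A := by
  have := h.aφ hA eff_zero t ht ht1
  simpa [h0] using this

lemma AB.mono (h : AB φ ψ) (h0 : φ 0 = 0) {A B : H →L[ℂ] H} (hA : Eff A) (hB : Eff B)
    (hAB : A ≤ B) : φ A ≤ φ B := by
  have h1 := hA.sub hB hAB
  have h2 := h.add h0 hA h1 (by rwa [add_sub_cancel])
  rw [add_sub_cancel] at h2
  rw [h2]
  exact le_add_of_nonneg_right (h.mφ h1).1

lemma AB.one (h : AB φ ψ) (h0 : φ 0 = 0) : φ 1 = 1 := by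
  apply le_antisymm (h.mφ eff_one).2
  have := h.mono h0 (h.mψ eff_one) eff_one (h.mψ eff_one).2
  rwa [h.r eff_one] at this

lemma AB.compl (h : AB φ ψ) (h0 : φ 0 = 0) {A : H →L[ℂ] H} (hA : Eff A) :
    φ (1 - A) = 1 - φ A := by
  have := h.add h0 hA hA.compl (by rw [add_sub_cancel]; exact eff_one)
  rw [add_sub_cancel, h.one h0] at this
  exact eq_sub_of_add_eq' this.symm

lemma AB.rank_one (h : AB φ ψ) (h0 : φ 0 = 0) {x : H} (hx : x ≠ 0) :
    ∃ y, y ≠ 0 ∧ φ (pr x) = pr y := by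
  have hx' : 0 < ‖x‖ := norm_pos_iff.2 hx
  have hP := pr_eff x
  set A := φ (pr x) with hAdef
  have hA : Eff A := h.mφ hP
  have hA0 : A ≠ 0 := by
    intro hc
    have h1 := h.l hP
    rw [← hAdef, hc, h.zero_symm h0] at h1
    have := q_pr_self x
    rw [← h1, q_zero] at this
    nlinarith
  have hmin : ∀ B, Eff B → B ≤ A → ∃ t : ℝ, B = t • A := by
    intro B hB hBA
    have h1 := h.symm.mono (h.zero_symm h0) hB hA hBA
    rw [hAdef, h.l hP] at h1
    obtain ⟨t, ht, ht1, hBt⟩ := below_pr hx (h.mψ hB) h1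
    refine ⟨t, ?_⟩
    rw [hAdef, ← h.smul h0 hP ht ht1, ← hBt, h.r hB]
  obtain ⟨u, hu⟩ : ∃ u, A u ≠ 0 := by
    by_contra hc
    push Not at hc
    exact hA0 (ContinuousLinearMap.ext hc)
  have hqu : 0 < q A u := lt_of_le_of_ne (hA.nn u) fun hc => hu (eq_zero_of_q hA.1 hc.symm)
  set y := A u with hy
  have hy' : 0 < ‖y‖ := norm_pos_iff.2 hu
  set r := ‖y‖ ^ 2 / q A u with hr
  have hrpos : 0 < r := by positivity
  have hqB : ∀ v, q (r • pr y) v = ‖⟪y, v⟫_ℂ‖ ^ 2 / q A u := by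
    intro v
    rw [q_smul, q_pr, hr]
    field_simp
  have hsa : IsSelfAdjoint (r • pr y) := sa_smul _ (pr_sa y)
  have hBle : ∀ v, q (r • pr y) v ≤ q A v := by
    intro v
    rw [hqB, div_le_iff₀ hqu, mul_comm]
    exact cs hA.1 u v
  have hBeff : Eff (r • pr y) := by
    refine eff_iff.2 ⟨hsa, fun v => ⟨?_, (hBle v).trans (hA.le v)⟩⟩
    rw [hqB]; positivity
  obtain ⟨t, ht⟩ := hmin _ hBeff ((le_iff_q hsa hA.sa).2 hBle)
  have ht0 : t ≠ 0 := by
    intro hc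
    rw [hc, zero_smul] at ht
    have := q_pr_self y
    have h2 : q (r • pr y) y = 0 := by rw [ht, q_zero]
    rw [q_smul, this] at h2
    have : 0 < r * ‖y‖ ^ 2 := by positivity
    linarith
  set c := t⁻¹ * r with hc
  have hAc : A = c • pr y := by
    rw [hc, mul_smul, ht, smul_smul, inv_mul_cancel₀ ht0, one_smul]
  have hqy : q A y = c * ‖y‖ ^ 2 := by rw [hAc, q_smul, q_pr_self]
  have hc0 : 0 ≤ c := by
    have := hA.nn y
    rw [hqy] at this
    exact nonneg_of_mul_nonneg_left this (by positivity)
  have hc1 : c ≤ 1 := by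
    have := hA.le y
    rw [hqy] at this
    exact le_of_mul_le_mul_right (by linarith) (show 0 < ‖y‖ ^ 2 by positivity)
  have h3 : pr x = c • ψ (pr y) := by
    rw [← h.symm.smul (h.zero_symm h0) (pr_eff y) hc0 hc1, ← hAc, hAdef, h.l hP]
  have hc2 : 1 ≤ c := by
    have h4 := q_pr_self x
    rw [h3, q_smul] at h4
    have h5 := mul_le_mul_of_nonneg_left ((h.mψ (pr_eff y)).le x) hc0
    exact le_of_mul_le_mul_right (by linarith) (show 0 < ‖x‖ ^ 2 by positivity)
  refine ⟨y, hu, ?_⟩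
  rw [hAc, le_antisymm hc1 hc2, one_smul]

lemma AB.q_le (h : AB φ ψ) (h0 : φ 0 = 0) {x y : H} (hx : x ≠ 0) (hxy : ‖x‖ = ‖y‖)
    (hp : φ (pr x) = pr y) {A : H →L[ℂ] H} (hA : Eff A) : q (φ A) y ≤ q A x := by
  have hx' : 0 < ‖x‖ := norm_pos_iff.2 hx
  apply lim_helper (hA.nn x)
  intro ε hε hε1
  have hP := pr_eff x
  set a := q A x / ‖x‖ ^ 2 with ha
  have ha0 : 0 ≤ a := div_nonneg (hA.nn x) (by positivity)
  have ha1 : a ≤ 1 := (div_le_one (by positivity)).2 (hA.le x)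
  have hεa0 : 0 ≤ ε * a := by positivity
  have hεa1 : ε * a ≤ 1 := by nlinarith
  have hs0 : 0 ≤ ε / (1 + ε) := by positivity
  have hs1 : ε / (1 + ε) ≤ 1 := by rw [div_le_one (by linarith)]; linarith
  have hB1 : Eff ((ε * a) • pr x) := hP.smul hεa0 hεa1
  have hBq : ∀ v, q ((ε * a) • pr x + (1 - pr x)) v
      = ε * a * q (pr x) v + (‖v‖ ^ 2 - q (pr x) v) := by
    intro v; rw [q_add, q_smul, q_sub, q_one]
  have hB : Eff ((ε * a) • pr x + (1 - pr x)) := by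
    refine eff_iff.2 ⟨hB1.sa.add hP.compl.sa, fun v => ?_⟩
    rw [hBq]
    have h1 := hP.nn v
    have h2 := hP.le v
    constructor
    · have := mul_nonneg hεa0 h1
      linarith
    · have := mul_le_mul_of_nonneg_right hεa1 h1
      linarith
  have hsA := hA.smul hs0 hs1
  have hle : (ε / (1 + ε)) • A ≤ (ε * a) • pr x + (1 - pr x) := by
    rw [le_iff_q hsA.sa hB.sa]
    intro v
    rw [hBq, q_smul]
    exact bound hA hx hε v
  have h3 := h.mono h0 hsA hB hle
  have h4 := (le_iff_q (h.mφ hsA).sa (h.mφ hB).sa).1 h3 y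
  rw [h.smul h0 hA hs0 hs1, h.add h0 hB1 hP.compl hB, h.smul h0 hP hεa0 hεa1, h.compl h0 hP, hp,
    q_smul, q_add, q_smul, q_sub, q_one, q_pr_self, ← hxy, sub_self, add_zero, ha,
    div_mul_eq_mul_div, div_le_iff₀ (by linarith)] at h4
  have h5 : ε * (q A x / ‖x‖ ^ 2) * ‖x‖ ^ 2 = ε * q A x := by field_simp
  rw [h5, mul_assoc] at h4
  have := le_of_mul_le_mul_left h4 hε
  linarith

lemma AB.q_eq (h : AB φ ψ) (h0 : φ 0 = 0) {x y : H} (hxy : ‖x‖ = ‖y‖)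
    (hp : φ (pr x) = pr y) {A : H →L[ℂ] H} (hA : Eff A) : q (φ A) y = q A x := by
  by_cases hx : x = 0
  · have hy : y = 0 := by rw [← norm_eq_zero, ← hxy, hx, norm_zero]
    simp [hx, hy, q]
  apply le_antisymm (h.q_le h0 hx hxy hp hA)
  have := h.q_le h0 hx hxy hp hA.compl
  rw [h.compl h0 hA, q_sub, q_sub, q_one, q_one, hxy] at this
  linarith

lemma AB.exists_ray (h : AB φ ψ) (h0 : φ 0 = 0) (x : H) : ∃ y, ‖x‖ = ‖y‖ ∧ φ (pr x) = pr y := by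
  by_cases hx : x = 0
  · exact ⟨0, by simp [hx], by rw [hx, pr_zero, h0]⟩
  obtain ⟨y, hy, hxy⟩ := h.rank_one h0 hx
  have hx' : ‖x‖ ≠ 0 := norm_ne_zero_iff.2 hx
  have hy' : ‖y‖ ≠ 0 := norm_ne_zero_iff.2 hy
  refine ⟨((‖x‖ / ‖y‖ : ℝ) : ℂ) • y, ?_, ?_⟩
  · rw [norm_smul, Complex.norm_real, norm_div, norm_norm, norm_norm]; field_simp
  · rw [pr_smul _ y, hxy]
    rw [Complex.ofReal_ne_zero]; positivity

lemma AB.rayRel (h : AB φ ψ) (h0 : φ 0 = 0) :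
    RayRel (fun x y : H => ‖x‖ = ‖y‖ ∧ φ (pr x) = pr y) where
  tot x := h.exists_ray h0 x
  sur y := by
    obtain ⟨x, h1, h2⟩ := h.symm.exists_ray (h.zero_symm h0) y
    exact ⟨x, h1.symm, by rw [← h2, h.r (pr_eff y)]⟩
  hom := by
    rintro x y ⟨h1, h2⟩ c d hcd
    refine ⟨by rw [norm_smul, norm_smul, hcd, h1], ?_⟩
    by_cases hc : c = 0
    · have hd : d = 0 := by rw [← norm_eq_zero, ← hcd, hc, norm_zero]
      rw [hc, hd, zero_smul, zero_smul, pr_zero, h0]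
    · have hd : d ≠ 0 := by rw [← norm_ne_zero_iff, ← hcd]; exact norm_ne_zero_iff.2 hc
      rw [pr_smul hc, pr_smul hd, h2]
  ip := by
    rintro x y z w ⟨h1, h2⟩ ⟨h3, h4⟩
    have h5 := h.q_eq h0 h3 h4 (pr_eff x)
    rw [h2, q_pr, q_pr, ← h1] at h5
    by_cases hx : x = 0
    · have hy : y = 0 := by rw [← norm_eq_zero, ← h1, hx, norm_zero]
      simp [hx, hy]
    have hx' : ‖x‖ ≠ 0 := norm_ne_zero_iff.2 hx
    field_simp at h5
    exact (sq_eq_sq₀ (norm_nonneg _) (norm_nonneg _)).1 h5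

lemma q_polar {A : H →L[ℂ] H} (hA : IsSelfAdjoint A) (x z : H) :
    q A (x + z) = q A x + q A z + 2 * (⟪A x, z⟫_ℂ).re := by
  have : (⟪A z, x⟫_ℂ).re = (⟪A x, z⟫_ℂ).re := by
    rw [sa_inner hA, ← inner_conj_symm, Complex.conj_re]
  simp only [q, map_add, inner_add_left, inner_add_right, Complex.add_re, this]
  ring

lemma intertwine {A B : H →L[ℂ] H} (hA : IsSelfAdjoint A) (hB : IsSelfAdjoint B) (V : H → H)
    (hadd : ∀ x z, V (x + z) = V x + V z) (hn : ∀ x, ‖V x‖ = ‖x‖)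
    (hs : Function.Surjective V) (hq : ∀ x, q B (V x) = q A x) (x : H) : B (V x) = V (A x) := by
  have h1 : ∀ x z, (⟪V x, V z⟫_ℂ).re = (⟪x, z⟫_ℂ).re := by
    intro x z
    have e1 := q_polar (sa_one (H := H)) x z
    have e2 := q_polar (sa_one (H := H)) (V x) (V z)
    simp only [q_one, ← hadd, hn, one_apply_eq_self] at e1 e2
    linarith
  have h2 : ∀ z, (⟪B (V x), V z⟫_ℂ).re = (⟪A x, z⟫_ℂ).re := by
    intro z
    have e1 := q_polar hA x z
    have e2 := q_polar hB (V x) (V z)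
    simp only [← hadd, hq] at e2
    linarith
  obtain ⟨z, hz⟩ := hs (B (V x) - V (A x))
  have h3 : (⟪B (V x) - V (A x), B (V x) - V (A x)⟫_ℂ).re = 0 := by
    conv_lhs => rw [← hz]
    rw [hz, inner_sub_left, Complex.sub_re, ← hz, h2, h1, sub_self]
  rw [re_self] at h3
  exact sub_eq_zero.1 (by simpa using h3)

lemma AB.proj (h : AB φ ψ) : φ 0 * φ 0 = φ 0 := by
  set E := φ 0 with hEdef
  have hE : Eff E := h.mφ eff_zero
  have hq1 : ∀ v, q (E * E) v = ‖E v‖ ^ 2 := by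
    intro v
    rw [q, ← re_self, ContinuousLinearMap.mul_apply, sa_inner hE.sa]
  have hsa1 : IsSelfAdjoint (E * E) := by
    rw [IsSelfAdjoint, star_mul, hE.sa.star_eq]
  have hEn : ∀ v, ‖E v‖ ^ 2 ≤ q E v := by
    intro v
    obtain ⟨S, h1, h2, h3⟩ := exists_sqrt hE.1
    rw [h3, h2, ← h2]
    exact (hE.le (S v)).trans_eq rfl
  have hX : Eff (E * E) := eff_iff.2 ⟨hsa1, fun v => by
    rw [hq1]; exact ⟨by positivity, (hEn v).trans (hE.le v)⟩⟩
  have hY : Eff ((2 : ℝ) • E - E * E) := by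
    refine eff_iff.2 ⟨(sa_smul _ hE.sa).sub hsa1, fun v => ?_⟩
    rw [q_sub, q_smul, hq1]
    refine ⟨by linarith [hEn v, hE.nn v], ?_⟩
    have h1 : 0 ≤ ‖v - E v‖ ^ 2 := by positivity
    rw [← re_self, inner_sub_left, inner_sub_right, inner_sub_right, Complex.sub_re,
      Complex.sub_re, Complex.sub_re, re_self, re_self, ← sa_inner hE.sa] at h1
    simp only [q]
    linarith
  have h1 := h.symm.comb hX hY hE hE (s := 1) (t := 1) (u := 1) (v := 1) (by norm_num)
    (by norm_num) (by norm_num) (by norm_num) (by norm_num) (by norm_num) (by module)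
  rw [hEdef, h.l eff_zero, ← hEdef] at h1
  simp only [one_smul, add_zero] at h1
  have h2 : ψ (E * E) = 0 := by
    apply le_antisymm _ (h.mψ hX).1
    rw [eq_neg_of_add_eq_zero_left h1]
    exact neg_nonpos.2 (h.mψ hY).1
  rw [← h.r hX, h2]

lemma pr_rot {x z : H} (hx : ‖x‖ = 1) (hz : ‖z‖ = 1) (hxz : ⟪x, z⟫_ℂ = 0) (r : ℝ) :
    pr (x + (r : ℂ) • z) = (1 + r ^ 2)⁻¹ • (pr x + r ^ 2 • pr z +
      r • (InnerProductSpace.rankOne ℂ x z + InnerProductSpace.rankOne ℂ z x)) := by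
  have hn : ‖x + (r : ℂ) • z‖ ^ 2 = 1 + r ^ 2 := by
    have := norm_add_sq_eq_norm_sq_add_norm_sq_of_inner_eq_zero (𝕜 := ℂ) x ((r : ℂ) • z)
      (by rw [inner_smul_right, hxz, mul_zero])
    rw [norm_smul, hx, hz, Complex.norm_real, Real.norm_eq_abs] at this
    nlinarith [sq_abs r]
  unfold pr
  rw [hn, hx, hz]
  congr 1
  ext v
  simp only [InnerProductSpace.rankOne_apply, add_apply, smul_apply,
    inner_add_left, inner_smul_left, Complex.conj_ofReal, ← Complex.coe_smul]
  push_cast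
  module

lemma AB.zero_or_one (h : AB φ ψ) : φ 0 = 0 ∨ φ 0 = 1 := by
  by_contra hcon
  push Not at hcon
  obtain ⟨hne0, hne1⟩ := hcon
  have hproj := h.proj
  have hψE : ψ (φ 0) = 0 := h.l eff_zero
  have hE : Eff (φ 0) := h.mφ eff_zero
  have hφ0 : φ 0 = φ 0 := rfl
  generalize hEdef : φ 0 = E at *
  have hEE : ∀ v, E (E v) = E v := fun v => by
    conv_rhs => rw [← hproj]
    rfl
  obtain ⟨x, hx, hEx⟩ : ∃ x, ‖x‖ = 1 ∧ E x = x := by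
    obtain ⟨u, hu⟩ : ∃ u, E u ≠ 0 := by
      by_contra hc
      push Not at hc
      exact hne0 (ContinuousLinearMap.ext hc)
    have hu' : ‖E u‖ ≠ 0 := norm_ne_zero_iff.2 hu
    refine ⟨((‖E u‖⁻¹ : ℝ) : ℂ) • E u, ?_, ?_⟩
    · rw [norm_smul, Complex.norm_real, norm_inv, norm_norm, inv_mul_cancel₀ hu']
    · rw [map_smul, hEE]
  obtain ⟨z, hz, hEz⟩ : ∃ z, ‖z‖ = 1 ∧ E z = 0 := by
    obtain ⟨u, hu⟩ : ∃ u, u - E u ≠ 0 := by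
      by_contra hc
      push Not at hc
      exact hne1 (ContinuousLinearMap.ext fun u => (sub_eq_zero.1 (hc u)).symm)
    have hu' : ‖u - E u‖ ≠ 0 := norm_ne_zero_iff.2 hu
    refine ⟨((‖u - E u‖⁻¹ : ℝ) : ℂ) • (u - E u), ?_, ?_⟩
    · rw [norm_smul, Complex.norm_real, norm_inv, norm_norm, inv_mul_cancel₀ hu']
    · rw [map_smul, map_sub, hEE, sub_self, smul_zero]
  have hxz : ⟪x, z⟫_ℂ = 0 := by rw [← hEx, sa_inner hE.sa, hEz, inner_zero_right]
  have hzx : ⟪z, x⟫_ℂ = 0 := inner_eq_zero_symm.1 hxz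
  have hxx : ⟪x, x⟫_ℂ = 1 := by rw [inner_self_eq_norm_sq_to_K, hx]; simp
  have hzz : ⟪z, z⟫_ℂ = 1 := by rw [inner_self_eq_norm_sq_to_K, hz]; simp
  -- basic facts on quadratic forms
  have hqE : ∀ v, q E v = ‖E v‖ ^ 2 := by
    intro v
    rw [q, ← re_self, ← hEE, sa_inner hE.sa, hEE]
  have hqx : ∀ v, q (pr x) v = ‖⟪x, v⟫_ℂ‖ ^ 2 := by intro v; rw [q_pr, hx]; simp
  have hqz : ∀ v, q (pr z) v = ‖⟪z, v⟫_ℂ‖ ^ 2 := by intro v; rw [q_pr, hz]; simp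
  have hpy : ∀ v, ‖v - E v‖ ^ 2 = ‖v‖ ^ 2 - ‖E v‖ ^ 2 := by
    intro v
    rw [← hqE, ← re_self, inner_sub_left, inner_sub_right, inner_sub_right, Complex.sub_re,
      Complex.sub_re, Complex.sub_re, re_self, re_self, ← hqE, ← sa_inner hE.sa]
    simp only [q]
    ring
  have hxle : ∀ v, ‖⟪x, v⟫_ℂ‖ ^ 2 ≤ ‖E v‖ ^ 2 := by
    intro v
    have h1 : ⟪x, v⟫_ℂ = ⟪x, E v⟫_ℂ := by rw [← sa_inner hE.sa, hEx]
    have h2 := norm_inner_le_norm (𝕜 := ℂ) x (E v)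
    rw [hx, one_mul, ← h1] at h2
    gcongr
  have hzle : ∀ v, ‖⟪z, v⟫_ℂ‖ ^ 2 ≤ ‖v‖ ^ 2 - ‖E v‖ ^ 2 := by
    intro v
    have h1 : ⟪z, v⟫_ℂ = ⟪z, v - E v⟫_ℂ := by
      rw [inner_sub_right, ← sa_inner hE.sa, hEz, inner_zero_left, sub_zero]
    have h2 := norm_inner_le_norm (𝕜 := ℂ) z (v - E v)
    rw [hz, one_mul, ← h1] at h2
    rw [← hpy]
    gcongr
  -- the rotated projections
  let F : ℝ → (H →L[ℂ] H) := fun r => E - pr x + pr (x + (r : ℂ) • z)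
  have hF : ∀ r, Eff (F r) := by
    intro r
    refine eff_iff.2 ⟨(hE.sa.sub (pr_sa x)).add (pr_sa _), fun v => ?_⟩
    have hnn := (pr_eff (x + (r : ℂ) • z)).nn v
    simp only [F]
    rw [q_add, q_sub, hqE, hqx]
    refine ⟨by linarith [hxle v], ?_⟩
    set w := (v - E v) + ⟪x, v⟫_ℂ • x with hw
    have h1 : ⟪x + (r : ℂ) • z, v⟫_ℂ = ⟪x + (r : ℂ) • z, w⟫_ℂ := by
      have e1 : ⟪x, v - E v⟫_ℂ = 0 := by
        rw [inner_sub_right, ← sa_inner hE.sa, hEx, sub_self]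
      have e2 : ⟪z, v - E v⟫_ℂ = ⟪z, v⟫_ℂ := by
        rw [inner_sub_right, ← sa_inner hE.sa, hEz, inner_zero_left, sub_zero]
      rw [hw, inner_add_left, inner_add_left, inner_smul_left, inner_smul_left, inner_add_right,
        inner_add_right, inner_smul_right, inner_smul_right, e1, e2, hxx, hzx]
      ring
    have h2 : q (pr (x + (r : ℂ) • z)) v = q (pr (x + (r : ℂ) • z)) w := by
      rw [q_pr, q_pr, h1]
    have h3 : ‖w‖ ^ 2 = ‖v‖ ^ 2 - ‖E v‖ ^ 2 + ‖⟪x, v⟫_ℂ‖ ^ 2 := by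
      have := norm_add_sq_eq_norm_sq_add_norm_sq_of_inner_eq_zero (𝕜 := ℂ)
        (v - E v) (⟪x, v⟫_ℂ • x)
        (by rw [inner_smul_right, inner_sub_left, sa_inner hE.sa, hEx, sub_self, mul_zero])
      rw [norm_smul, hx] at this
      rw [← hpy, hw]
      nlinarith
    have h4 := (pr_eff (x + (r : ℂ) • z)).le w
    rw [h2]
    linarith
  set D : H →L[ℂ] H := E - (1 / 2 : ℝ) • pr x + (1 / 2 : ℝ) • pr z with hDdef
  have hD : Eff D := by
    refine eff_iff.2 ⟨(hE.sa.sub (sa_smul _ (pr_sa x))).add (sa_smul _ (pr_sa z)), fun v => ?_⟩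
    rw [hDdef, q_add, q_sub, q_smul, q_smul, hqE, hqx, hqz]
    have h1 := hxle v
    have h2 := hzle v
    have h3 := sq_nonneg ‖⟪x, v⟫_ℂ‖
    have h4 := sq_nonneg ‖⟪z, v⟫_ℂ‖
    constructor <;> linarith
  have key : ∀ r : ℝ, 0 < r → r ≤ 1 → ∀ v, q (ψ D) v ≤ q (ψ (F 1)) v + r * q (ψ D) v := by
    intro r hr hr1 v
    set k := r / (1 + r ^ 2) with hk
    have hkpos : 0 < k := by positivity
    have hkr : 2 * k * r ≤ 1 := by
      rw [hk, mul_div_assoc', div_mul_eq_mul_div, div_le_one (by positivity)]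
      nlinarith
    have e : (1 : ℝ) • F r + (2 * k * (1 - r)) • D = (2 * k) • F 1 + (1 - 2 * k * r) • E := by
      simp only [F, hDdef, pr_rot hx hz hxz]
      match_scalars <;> simp only [hk] <;> field_simp <;> ring
    have h1 := h.symm.comb (hF r) hD (hF 1) hE (by norm_num)
      (mul_nonneg (by positivity) (by linarith)) (by positivity) (by linarith)
      (by nlinarith [mul_nonneg hkpos.le (sub_nonneg.2 hr1)]) (by ring) e
    rw [hψE, smul_zero, add_zero, one_smul] at h1
    have h2 : q (ψ (F r)) v + 2 * k * (1 - r) * q (ψ D) v = 2 * k * q (ψ (F 1)) v := by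
      rw [← q_smul, ← q_smul, ← h1, q_add]
    have h3 := (h.mψ (hF r)).nn v
    have h4 : 2 * k * ((1 - r) * q (ψ D) v) ≤ 2 * k * q (ψ (F 1)) v := by linarith
    have := le_of_mul_le_mul_left h4 (by positivity)
    linarith
  have hle : ψ D ≤ ψ (F 1) := by
    rw [le_iff_q (h.mψ hD).sa (h.mψ (hF 1)).sa]
    intro v
    exact lim_helper ((h.mψ hD).nn v) fun r hr hr1 => key r hr hr1 v
  have hC := (h.mψ hD).sub (h.mψ (hF 1)) hle
  have h1 := h.comb hC (h.mψ hD) (h.mψ (hF 1)) eff_zero (s := 1) (t := 1) (u := 1) (v := 1)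
    (by norm_num) (by norm_num) (by norm_num) (by norm_num) (by norm_num) (by norm_num) (by module)
  rw [h.r hD, h.r (hF 1), hEdef] at h1
  simp only [one_smul] at h1
  set C := φ (ψ (F 1) - ψ D)
  have hCE : C = F 1 + E - D := eq_sub_of_add_eq h1
  have hCeff : Eff C := h.mφ hC
  have hCz : C z = ((1 / 2 : ℝ) : ℂ) • x := by
    rw [hCE]
    simp only [F, hDdef, pr_rot hx hz hxz, add_apply, sub_apply, smul_apply, hEz, pr_apply, hx, hz,
      hxz, hzx, hzz, InnerProductSpace.rankOne_apply, ← Complex.coe_smul]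
    simp only [zero_smul, smul_zero]
    push_cast
    match_scalars <;> norm_num
  have hCq : q C z = 0 := by
    rw [q, hCz, inner_smul_left, hxz, mul_zero, Complex.zero_re]
  have := eq_zero_of_q hCeff.1 hCq
  rw [hCz] at this
  have h5 : ‖((1 / 2 : ℝ) : ℂ) • x‖ = 1 / 2 := by
    rw [norm_smul, hx, Complex.norm_real]; norm_num
  rw [this, norm_zero] at h5
  norm_num at h5

/-- The normalized version. -/
lemma AB.main (h : AB φ ψ) (h0 : φ 0 = 0) :
    (∃ U : H ≃ₗᵢ[ℂ] H, ∀ A, Eff A → ∀ x, φ A (U x) = U (A x)) ∨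
    (∃ U : H ≃ₛₗᵢ[starRingEnd ℂ] H, ∀ A, Eff A → ∀ x, φ A (U x) = U (A x)) := by
  rcases (h.rayRel h0).wigner with ⟨U, hU⟩ | ⟨U, hU⟩
  · exact Or.inl ⟨U, fun A hA x => intertwine hA.sa (h.mφ hA).sa U (map_add U) U.norm_map
      U.surjective (fun x => h.q_eq h0 (hU x).1 (hU x).2 hA) x⟩
  · exact Or.inr ⟨U, fun A hA x => intertwine hA.sa (h.mφ hA).sa U (map_add U) U.norm_map
      U.surjective (fun x => h.q_eq h0 (hU x).1 (hU x).2 hA) x⟩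

lemma AB.neg (h : AB φ ψ) : AB (fun A => 1 - φ A) (fun A => ψ (1 - A)) where
  mφ hA := (h.mφ hA).compl
  mψ hA := h.mψ hA.compl
  l hA := by simp only [sub_sub_cancel]; exact h.l hA
  r hA := by simp only [h.r hA.compl, sub_sub_cancel]
  aφ hA hB t ht ht1 := by rw [h.aφ hA hB t ht ht1]; module
  aψ hA hB t ht ht1 := by
    rw [← h.aψ hA.compl hB.compl t ht ht1]
    congr 1
    module

lemma exists_AB (φ : (H →L[ℂ] H) → (H →L[ℂ] H))
    (hbij : Set.BijOn φ {A : H →L[ℂ] H | 0 ≤ A ∧ A ≤ 1} {A : H →L[ℂ] H | 0 ≤ A ∧ A ≤ 1})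
    (haff : ∀ A : H →L[ℂ] H, 0 ≤ A → A ≤ 1 → ∀ B : H →L[ℂ] H, 0 ≤ B → B ≤ 1 →
      ∀ t : ℝ, t ∈ Set.Icc (0 : ℝ) 1 →
      φ ((t : ℂ) • A + ((1 - t : ℝ) : ℂ) • B) = (t : ℂ) • φ A + ((1 - t : ℝ) : ℂ) • φ B) :
    ∃ ψ, AB φ ψ := by
  have hm : ∀ {A}, Eff A → Eff (φ A) := fun {A} hA => hbij.mapsTo hA
  have hex : ∀ B, ∃ A, Eff B → Eff A ∧ φ A = B := by
    intro B
    by_cases hB : Eff B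
    · obtain ⟨A, hA, hAB⟩ := hbij.surjOn hB
      exact ⟨A, fun _ => ⟨hA, hAB⟩⟩
    · exact ⟨0, fun hc => absurd hc hB⟩
  choose ψ hψ using hex
  have ha : ∀ {A B}, Eff A → Eff B → ∀ t : ℝ, 0 ≤ t → t ≤ 1 →
      φ (t • A + (1 - t) • B) = t • φ A + (1 - t) • φ B := by
    intro A B hA hB t ht ht1
    have := haff A hA.1 hA.2 B hB.1 hB.2 t ⟨ht, ht1⟩
    simpa only [Complex.coe_smul] using this
  refine ⟨ψ, hm, fun {A} hA => (hψ A hA).1, ?_, fun {A} hA => (hψ A hA).2, ha, ?_⟩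
  · intro A hA
    have := hψ _ (hm hA)
    exact hbij.injOn this.1 hA this.2
  · intro A B hA hB t ht ht1
    have hA' := hψ A hA
    have hB' := hψ B hB
    have hAB : Eff (t • A + (1 - t) • B) := hA.comb hB ht (by linarith) (by linarith)
    have h3 := hψ _ hAB
    refine hbij.injOn h3.1 (hA'.1.comb hB'.1 ht (by linarith) (by linarith)) ?_
    rw [h3.2, ha hA'.1 hB'.1 t ht ht1, hA'.2, hB'.2]

lemma unitary_of (U : H ≃ₗᵢ[ℂ] H) : ∃ W : H →L[ℂ] H, W ∈ unitary (H →L[ℂ] H) ∧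
    (∀ x, W x = U x) ∧ ∀ x, U (star W x) = x := by
  let W := Unitary.linearIsometryEquiv.symm U
  have hW : ∀ x, (W : H →L[ℂ] H) x = U x := fun x => rfl
  refine ⟨W, W.2, hW, fun x => ?_⟩
  rw [← hW]
  have := Unitary.mul_star_self_of_mem W.2
  exact congrArg (fun T : H →L[ℂ] H => T x) this

end Maps
end EffAux

/-- Every bijective affine map of the Hilbert space effect algebra `[0, I]` onto itself is of
the form `A ↦ U A U*` or `A ↦ U (I - A) U*` for a unitary or antiunitary operator `U`. -/
theorem affine_bijection_of_effects
    {H : Type*} [NormedAddCommGroup H] [InnerProductSpace ℂ H] [CompleteSpace H]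
    (φ : (H →L[ℂ] H) → (H →L[ℂ] H))
    (hbij : Set.BijOn φ {A : H →L[ℂ] H | 0 ≤ A ∧ A ≤ 1} {A : H →L[ℂ] H | 0 ≤ A ∧ A ≤ 1})
    (haff : ∀ A : H →L[ℂ] H, 0 ≤ A → A ≤ 1 → ∀ B : H →L[ℂ] H, 0 ≤ B → B ≤ 1 →
      ∀ t : ℝ, t ∈ Set.Icc (0 : ℝ) 1 →
      φ ((t : ℂ) • A + ((1 - t : ℝ) : ℂ) • B) = (t : ℂ) • φ A + ((1 - t : ℝ) : ℂ) • φ B) :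
    (∃ U : H →L[ℂ] H, U ∈ unitary (H →L[ℂ] H) ∧
      ((∀ A : H →L[ℂ] H, 0 ≤ A → A ≤ 1 → φ A = U * A * star U) ∨
       (∀ A : H →L[ℂ] H, 0 ≤ A → A ≤ 1 → φ A = U * (1 - A) * star U))) ∨
    (∃ V : H ≃ₛₗᵢ[starRingEnd ℂ] H,
      ((∀ A : H →L[ℂ] H, 0 ≤ A → A ≤ 1 → ∀ x : H, φ A x = V (A (V.symm x))) ∨
       (∀ A : H →L[ℂ] H, 0 ≤ A → A ≤ 1 → ∀ x : H, φ A x = V ((1 - A) (V.symm x))))) := by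
  obtain ⟨ψ, h⟩ := EffAux.exists_AB φ hbij haff
  rcases h.zero_or_one with h0 | h1
  · rcases h.main h0 with ⟨U, hU⟩ | ⟨V, hV⟩
    · left
      obtain ⟨W, hW, hWU, hWs⟩ := EffAux.unitary_of U
      refine ⟨W, hW, Or.inl fun A hA0 hA1 => ?_⟩
      ext x
      have := hU A ⟨hA0, hA1⟩ (star W x)
      rw [hWs] at this
      rw [this, ← hWU]
      rfl
    · right
      refine ⟨V, Or.inl fun A hA0 hA1 x => ?_⟩
      have := hV A ⟨hA0, hA1⟩ (V.symm x)
      rwa [LinearIsometryEquiv.apply_symm_apply] at this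
  · rcases h.neg.main (by simp [h1]) with ⟨U, hU⟩ | ⟨V, hV⟩
    · left
      obtain ⟨W, hW, hWU, hWs⟩ := EffAux.unitary_of U
      refine ⟨W, hW, Or.inr fun A hA0 hA1 => ?_⟩
      ext x
      have := hU A ⟨hA0, hA1⟩ (star W x)
      rw [hWs, sub_apply, one_apply_eq_self, sub_eq_iff_eq_add'] at this
      have h2 : φ A x = x - U (A (star W x)) := by rw [eq_sub_iff_add_eq]; exact this.symm
      rw [h2]
      show _ = W ((1 - A) (star W x))
      rw [sub_apply, one_apply_eq_self, hWU, map_sub, hWs]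
    · right
      refine ⟨V, Or.inr fun A hA0 hA1 x => ?_⟩
      have := hV A ⟨hA0, hA1⟩ (V.symm x)
      rw [LinearIsometryEquiv.apply_symm_apply, sub_apply, one_apply_eq_self,
        sub_eq_iff_eq_add'] at this
      have h2 : φ A x = x - V (A (V.symm x)) := by rw [eq_sub_iff_add_eq]; exact this.symm
      rw [h2, sub_apply, one_apply_eq_self, map_sub, LinearIsometryEquiv.apply_symm_apply]
end

section
/- Let H be a complex Hilbert space with dim H ≥ 3 and let [0,I] denote the set of effects on H. If φ : [0,I] → [0,I] is a bijective map satisfying φ(ABA) = φ(A)φ(B)φ(A) for all A, B ∈ [0,I], then there exists an operator U on H, either unitary or antiunitary, such that φ(A) = U A U* for all A ∈ [0,I]. -/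
lemma aux_f_id (f : ℝ → ℝ) (h0 : ∀ t, 0 ≤ t → t ≤ 1 → 0 ≤ f t) (h1 : f 1 = 1)
    (hmul : ∀ s t, 0 ≤ s → s ≤ 1 → 0 ≤ t → t ≤ 1 → f (s * t) = f s * f t)
    (hadd : ∀ t, 0 ≤ t → t ≤ 1 → f t + f (1 - t) = 1) :
    ∀ t, 0 ≤ t → t ≤ 1 → f t = t := by
  have hf0 : f 0 = 0 := by
    have := hadd 1 zero_le_one le_rfl
    simp only [sub_self] at this
    linarith
  have hA : ∀ s t, 0 ≤ s → 0 ≤ t → s + t ≤ 1 → f (s + t) = f s + f t := by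
    intro s t hs ht hst
    rcases (add_nonneg hs ht).eq_or_lt with h | h
    · have hs' : s = 0 := by linarith
      have ht' : t = 0 := by linarith
      simp [hs', ht', hf0]
    · have e1 : f s = f (s + t) * f (s / (s + t)) := by
        rw [← hmul _ _ h.le hst (by positivity) (by rw [div_le_one h]; linarith)]
        congr 1; field_simp
      have e2 : f t = f (s + t) * f (1 - s / (s + t)) := by
        have : 1 - s / (s + t) = t / (s + t) := by field_simp; ring
        rw [this, ← hmul _ _ h.le hst (by positivity) (by rw [div_le_one h]; linarith)]
        congr 1; field_simp
      have e3 := hadd (s / (s + t)) (by positivity) (by rw [div_le_one h]; linarith)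
      rw [e1, e2, ← mul_add, e3, mul_one]
  have hmono : ∀ s t, 0 ≤ s → s ≤ t → t ≤ 1 → f s ≤ f t := by
    intro s t hs hst ht
    have := hA s (t - s) hs (by linarith) (by linarith)
    rw [add_sub_cancel] at this
    have := h0 (t - s) (by linarith) (by linarith)
    linarith
  have hk : ∀ (k : ℕ) (x : ℝ), 0 ≤ x → k * x ≤ 1 → f (k * x) = k * f x := by
    intro k x hx
    induction k with
    | zero => intro; simp [hf0]
    | succ k ih =>
      intro h
      push_cast at h ⊢
      have h' : (k : ℝ) * x + x ≤ 1 := by linarith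
      rw [add_mul, one_mul, hA _ _ (by positivity) hx h', ih (by linarith)]
      ring
  have hlow : ∀ t, 0 ≤ t → t ≤ 1 → t ≤ f t := by
    intro t ht ht1
    by_contra! hlt
    obtain ⟨n, hn⟩ := exists_nat_one_div_lt (sub_pos.2 hlt)
    have hN : (0 : ℝ) < (n : ℝ) + 1 := by positivity
    have e1 : f (1 / ((n : ℝ) + 1)) = 1 / ((n : ℝ) + 1) := by
      have := hk (n + 1) (1 / ((n : ℝ) + 1)) (by positivity) (by push_cast; field_simp; rfl)
      push_cast at this
      rw [mul_one_div_cancel hN.ne', h1] at this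
      field_simp
      linarith
    set k := ⌊t * ((n : ℝ) + 1)⌋₊ with hkdef
    have k1 : (k : ℝ) ≤ t * ((n : ℝ) + 1) := Nat.floor_le (by positivity)
    have k2 : t * ((n : ℝ) + 1) < k + 1 := Nat.lt_floor_add_one _
    have k3 : (k : ℝ) * (1 / ((n : ℝ) + 1)) ≤ t := by
      rw [mul_one_div, div_le_iff₀ hN]; exact k1
    have k4 : t - 1 / ((n : ℝ) + 1) < (k : ℝ) * (1 / ((n : ℝ) + 1)) := by
      rw [sub_lt_iff_lt_add, mul_one_div, ← add_div, lt_div_iff₀ hN]; exact k2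
    have := hmono _ t (by positivity) k3 ht1
    rw [hk k _ (by positivity) (by linarith), e1] at this
    linarith
  intro t ht ht1
  have := hadd t ht ht1
  have := hlow t ht ht1
  have := hlow (1 - t) (by linarith) (by linarith)
  linarith
open ComplexConjugate

section
variable {H : Type*} [NormedAddCommGroup H] [InnerProductSpace ℂ H]

local notation "⟪" x "," y "⟫" => inner ℂ x y

/-- A map on `e^⊥` that is real-isometric and σ-compatible with `I` extends. -/
lemma aux_extend (σ : ℂ →+* ℂ) [RingHomInvPair σ σ] [RingHomIsometric σ]
    (hσ : ∀ r : ℝ, σ r = r) (e e' : H) (he : ‖e‖ = 1) (he' : ‖e'‖ = 1) (g : H → H)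
    (hperp : ∀ v, ⟪e, v⟫ = 0 → ⟪e', g v⟫ = 0)
    (hnorm : ∀ v, ⟪e, v⟫ = 0 → ‖g v‖ = ‖v‖)
    (hadd : ∀ v w, ⟪e, v⟫ = 0 → ⟪e, w⟫ = 0 → g (v + w) = g v + g w)
    (hsm : ∀ (r : ℝ) v, ⟪e, v⟫ = 0 → g ((r : ℂ) • v) = (r : ℂ) • g v)
    (hI : ∀ v, ⟪e, v⟫ = 0 → g (Complex.I • v) = σ Complex.I • g v)
    (hsurj : ∀ u, ⟪e', u⟫ = 0 → ∃ v, ⟪e, v⟫ = 0 ∧ g v = u) :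
    ∃ U : H ≃ₛₗᵢ[σ] H, U e = e' ∧ ∀ v, ⟪e, v⟫ = 0 → U v = g v := by
  have hee : ⟪e, e⟫ = 1 := by simp [inner_self_eq_norm_sq_to_K, he]
  have hee' : ⟪e', e'⟫ = 1 := by simp [inner_self_eq_norm_sq_to_K, he']
  have hpr : ∀ x, ⟪e, x - ⟪e, x⟫ • e⟫ = 0 := by
    intro x; simp [inner_sub_right, inner_smul_right, he]
  have hpr' : ∀ x, ⟪e', x - ⟪e', x⟫ • e'⟫ = 0 := by
    intro x; simp [inner_sub_right, inner_smul_right, he']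
  have hsmul : ∀ (a : ℂ) v, ⟪e, v⟫ = 0 → g (a • v) = σ a • g v := by
    intro a v hv
    have hv' : ⟪e, Complex.I • v⟫ = 0 := by simp [inner_smul_right, hv]
    conv_lhs => rw [← Complex.re_add_im a, add_smul, mul_smul]
    conv_rhs => rw [← Complex.re_add_im a]
    rw [hadd, hsm _ _ hv, hsm _ _ hv', hI _ hv, map_add, map_mul, hσ, hσ, add_smul, mul_smul]
    · simp [inner_smul_right, hv]
    · simp [inner_smul_right, hv]
  have hg0 : g 0 = 0 := by
    have := hnorm 0 (by simp)
    simpa using this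
  let L : H →ₛₗ[σ] H :=
    { toFun := fun x => σ ⟪e, x⟫ • e' + g (x - ⟪e, x⟫ • e)
      map_add' := by
        intro x y
        have : x + y - ⟪e, x + y⟫ • e = (x - ⟪e, x⟫ • e) + (y - ⟪e, y⟫ • e) := by
          rw [inner_add_right, add_smul]; abel
        rw [this, hadd _ _ (hpr x) (hpr y), inner_add_right, map_add, add_smul]
        abel
      map_smul' := by
        intro a x
        have : a • x - ⟪e, a • x⟫ • e = a • (x - ⟪e, x⟫ • e) := by
          rw [inner_smul_right, smul_sub, smul_smul]
        rw [this, hsmul _ _ (hpr x), inner_smul_right, map_mul, smul_add, smul_smul] }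
  have hL : ∀ x, L x = σ ⟪e, x⟫ • e' + g (x - ⟪e, x⟫ • e) := fun x => rfl
  have hsq : ∀ (d w : H) (a : ℂ), ‖d‖ = 1 → ⟪d, w⟫ = 0 → ‖a • d + w‖ ^ 2 = ‖a‖ ^ 2 + ‖w‖ ^ 2 := by
    intro d w a hd hw
    have := norm_add_sq_eq_norm_sq_add_norm_sq_of_inner_eq_zero (𝕜 := ℂ) (a • d) w
      (by rw [inner_smul_left, hw, mul_zero])
    rw [norm_smul, hd, mul_one] at this
    nlinarith [this]
  let LI : H →ₛₗᵢ[σ] H :=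
    { L with
      norm_map' := by
        intro x
        change ‖L x‖ = ‖x‖
        have h1 := hsq e' (g (x - ⟪e, x⟫ • e)) (σ ⟪e, x⟫) he' (hperp _ (hpr x))
        have h2 := hsq e (x - ⟪e, x⟫ • e) ⟪e, x⟫ he (hpr x)
        rw [add_sub_cancel] at h2
        rw [← hL, hnorm _ (hpr x), RingHomIsometric.norm_map, ← h2] at h1
        exact (sq_eq_sq₀ (norm_nonneg _) (norm_nonneg _)).1 h1 }
  have hLI : ∀ x, LI x = L x := fun x => rfl
  have hLe : L e = e' := by rw [hL, hee]; simp [hg0]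
  have hLv : ∀ v, ⟪e, v⟫ = 0 → L v = g v := by
    intro v hv; rw [hL]; simp [hv]
  refine ⟨LinearIsometryEquiv.ofSurjective LI ?_, ?_, ?_⟩
  · intro y
    obtain ⟨v, hv, hgv⟩ := hsurj _ (hpr' y)
    refine ⟨σ ⟪e', y⟫ • e + v, ?_⟩
    have : σ (σ ⟪e', y⟫) = ⟪e', y⟫ := RingHomInvPair.comp_apply_eq (σ := σ) (σ' := σ)
    rw [hLI, map_add, LinearMap.map_smulₛₗ, hLe, hLv v hv, hgv, this]
    abel
  · exact hLe
  · intro v hv; exact hLv v hv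

lemma aux_wigner (e : H) (he : ‖e‖ = 1) (T : H → H)
    (hT : ∀ x y, ‖⟪T x, T y⟫‖ = ‖⟪x, y⟫‖)
    (hsurj : ∀ y, ∃ x, ∃ c : ℂ, ‖c‖ = 1 ∧ y = c • T x) :
    (∃ U : H ≃ₗᵢ[ℂ] H, ∀ v, ⟪e, v⟫ = 0 → ∃ c : ℂ, ‖c‖ = 1 ∧ U (e + v) = c • T (e + v)) ∨
    (∃ U : H ≃ₛₗᵢ[starRingEnd ℂ] H, ∀ v, ⟪e, v⟫ = 0 →
      ∃ c : ℂ, ‖c‖ = 1 ∧ U (e + v) = c • T (e + v)) := by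
  have hTn : ∀ x, ‖T x‖ = ‖x‖ := by
    intro x
    have := hT x x
    simp only [inner_self_eq_norm_sq_to_K, norm_pow] at this
    have := (sq_eq_sq₀ (norm_nonneg _) (norm_nonneg _)).1 this
    simpa using this
  have hee : ⟪e, e⟫ = 1 := by simp [inner_self_eq_norm_sq_to_K, he]
  set e' := T e with he'def
  have he' : ‖e'‖ = 1 := by rw [he'def, hTn, he]
  have hee' : ⟪e', e'⟫ = 1 := by simp [inner_self_eq_norm_sq_to_K, he']
  have hlift : ∀ v, ∃ w, ⟪e, v⟫ = 0 → ⟪e', w⟫ = 0 ∧ ∃ c : ℂ, ‖c‖ = 1 ∧ e' + w = c • T (e + v) := by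
    intro v
    refine ⟨(⟪e', T (e + v)⟫)⁻¹ • T (e + v) - e', fun hv => ?_⟩
    have h1 : ‖⟪e', T (e + v)⟫‖ = 1 := by
      rw [he'def, hT, inner_add_right, hv, hee]; simp
    have h2 : ⟪e', T (e + v)⟫ ≠ 0 := by
      intro h; rw [h] at h1; simp at h1
    refine ⟨?_, (⟪e', T (e + v)⟫)⁻¹, by rw [norm_inv, h1, inv_one], by abel⟩
    rw [inner_sub_right, inner_smul_right, hee', inv_mul_cancel₀ h2, sub_self]
  choose g hg using hlift
  have hperp : ∀ v, ⟪e, v⟫ = 0 → ⟪e', g v⟫ = 0 := fun v hv => (hg v hv).1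
  have hperp' : ∀ v, ⟪e, v⟫ = 0 → ⟪g v, e'⟫ = 0 := fun v hv => by
    rw [← inner_conj_symm, hperp v hv, map_zero]
  have hG : ∀ v, ⟪e, v⟫ = 0 → ∃ c : ℂ, ‖c‖ = 1 ∧ e' + g v = c • T (e + v) := fun v hv => (hg v hv).2
  have hsq : ∀ (d w : H), ‖d‖ = 1 → ⟪d, w⟫ = 0 → ‖d + w‖ ^ 2 = 1 + ‖w‖ ^ 2 := by
    intro d w hd hw
    have := norm_add_sq_eq_norm_sq_add_norm_sq_of_inner_eq_zero (𝕜 := ℂ) d w hw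
    rw [hd] at this
    nlinarith [this]
  have hnorm : ∀ v, ⟪e, v⟫ = 0 → ‖g v‖ = ‖v‖ := by
    intro v hv
    obtain ⟨c, hc, h⟩ := hG v hv
    have h1 := hsq e' (g v) he' (hperp v hv)
    have h2 := hsq e v he hv
    rw [h, norm_smul, hc, one_mul, hTn, h2] at h1
    exact ((sq_eq_sq₀ (norm_nonneg _) (norm_nonneg _)).1 (by linarith)).symm
  have hGG : ∀ v w, ⟪e, v⟫ = 0 → ⟪e, w⟫ = 0 → ‖1 + ⟪g v, g w⟫‖ = ‖1 + ⟪v, w⟫‖ := by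
    intro v w hv hw
    obtain ⟨c, hc, h⟩ := hG v hv
    obtain ⟨d, hd, h'⟩ := hG w hw
    have hv' : ⟪v, e⟫ = 0 := by rw [← inner_conj_symm, hv, map_zero]
    have h1 : ⟪e' + g v, e' + g w⟫ = 1 + ⟪g v, g w⟫ := by
      simp [inner_add_left, inner_add_right, he', hperp w hw, hperp' v hv]
    have h2 : ⟪e + v, e + w⟫ = 1 + ⟪v, w⟫ := by
      simp [inner_add_left, inner_add_right, he, hv', hw]
    rw [← h1, ← h2, h, h', inner_smul_left, inner_smul_right, norm_mul, norm_mul, hT]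
    simp [hc, hd]
  have hgT : ∀ v, ⟪e, v⟫ = 0 → ∃ d : ℂ, ‖d‖ = 1 ∧ g v = d • T v := by
    intro v hv
    by_cases hv0 : v = 0
    · refine ⟨1, by simp, ?_⟩
      have h1 : g v = 0 := by rw [← norm_eq_zero, hnorm v hv, hv0, norm_zero]
      have h2 : T v = 0 := by rw [← norm_eq_zero, hTn, hv0, norm_zero]
      rw [h1, h2, smul_zero]
    · obtain ⟨c, hc, h⟩ := hG v hv
      have hv' : ⟪v, e⟫ = 0 := by rw [← inner_conj_symm, hv, map_zero]
      have h0 : ⟪T v, e'⟫ = 0 := by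
        rw [← norm_eq_zero, he'def, hT, hv', norm_zero]
      have h1 : ‖⟪T v, g v⟫‖ = ‖T v‖ * ‖g v‖ := by
        have : ⟪T v, g v⟫ = ⟪T v, e' + g v⟫ := by rw [inner_add_right, h0, zero_add]
        rw [this, h, inner_smul_right, norm_mul, hc, hT, inner_add_right, hv', zero_add, hTn,
          hnorm v hv, one_mul, inner_self_eq_norm_sq_to_K]
        simp [sq]
      have hTv0 : T v ≠ 0 := by rw [← norm_ne_zero_iff, hTn]; exact norm_ne_zero_iff.2 hv0
      have hgv0 : g v ≠ 0 := by rw [← norm_ne_zero_iff, hnorm v hv]; exact norm_ne_zero_iff.2 hv0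
      obtain ⟨r, hr, h2⟩ := (norm_inner_eq_norm_iff hTv0 hgv0).1 h1
      refine ⟨r, ?_, h2⟩
      have := congrArg norm h2
      rw [norm_smul, hnorm v hv, hTn] at this
      exact (mul_eq_right₀ (norm_ne_zero_iff.2 hv0)).1 this.symm
  have habs : ∀ v w, ⟪e, v⟫ = 0 → ⟪e, w⟫ = 0 → ‖⟪g v, g w⟫‖ = ‖⟪v, w⟫‖ := by
    intro v w hv hw
    obtain ⟨c, hc, h⟩ := hgT v hv
    obtain ⟨d, hd, h'⟩ := hgT w hw
    rw [h, h', inner_smul_left, inner_smul_right, norm_mul, norm_mul, hT]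
    simp [hc, hd]
  have hre : ∀ v w, ⟪e, v⟫ = 0 → ⟪e, w⟫ = 0 → (⟪g v, g w⟫).re = (⟪v, w⟫).re := by
    intro v w hv hw
    have h1 := congrArg (fun t => t ^ 2) (hGG v w hv hw)
    have h2 := congrArg (fun t => t ^ 2) (habs v w hv hw)
    simp only [← Complex.normSq_eq_norm_sq, Complex.normSq_apply, Complex.add_re, Complex.add_im,
      Complex.one_re, Complex.one_im] at h1 h2
    linarith
  have hlin : ∀ (a b c : ℝ) (u v w : H), ⟪e, u⟫ = 0 → ⟪e, v⟫ = 0 → ⟪e, w⟫ = 0 →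
      (a : ℂ) • u + (b : ℂ) • v + (c : ℂ) • w = 0 →
      (a : ℂ) • g u + (b : ℂ) • g v + (c : ℂ) • g w = 0 := by
    intro a b c u v w hu hv hw h
    have key : ∀ u v w : H, ‖(a : ℂ) • u + (b : ℂ) • v + (c : ℂ) • w‖ ^ 2 =
        a * a * (⟪u, u⟫).re + b * b * (⟪v, v⟫).re + c * c * (⟪w, w⟫).re
        + 2 * a * b * (⟪u, v⟫).re + 2 * a * c * (⟪u, w⟫).re + 2 * b * c * (⟪v, w⟫).re := by
      intro u v w
      have s1 : (⟪v, u⟫).re = (⟪u, v⟫).re := inner_re_symm (𝕜 := ℂ) v u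
      have s2 : (⟪w, u⟫).re = (⟪u, w⟫).re := inner_re_symm (𝕜 := ℂ) w u
      have s3 : (⟪w, v⟫).re = (⟪v, w⟫).re := inner_re_symm (𝕜 := ℂ) w v
      rw [@norm_sq_eq_re_inner ℂ]
      simp only [inner_add_left, inner_add_right, inner_smul_left, inner_smul_right,
        Complex.conj_ofReal, Complex.add_re, RCLike.re_eq_complex_re, Complex.re_ofReal_mul, s1, s2, s3]
      ring
    have h1 := key u v w
    have h2 := key (g u) (g v) (g w)
    rw [hre _ _ hu hu, hre _ _ hv hv, hre _ _ hw hw, hre _ _ hu hv, hre _ _ hu hw,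
      hre _ _ hv hw, ← h1, h] at h2
    simpa using h2
  have hgadd : ∀ v w, ⟪e, v⟫ = 0 → ⟪e, w⟫ = 0 → g (v + w) = g v + g w := by
    intro v w hv hw
    have := hlin 1 (-1) (-1) (v + w) v w (by simp [inner_add_right, hv, hw]) hv hw (by simp)
    simp at this
    exact sub_eq_zero.1 (by rw [← this]; abel)
  have hgsm : ∀ (r : ℝ) v, ⟪e, v⟫ = 0 → g ((r : ℂ) • v) = (r : ℂ) • g v := by
    intro r v hv
    have := hlin 1 (-r) 0 ((r : ℂ) • v) v v (by simp [inner_smul_right, hv]) hv hv (by simp)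
    simp only [Complex.ofReal_one, one_smul, Complex.ofReal_neg, neg_smul, Complex.ofReal_zero,
      zero_smul, add_zero] at this
    exact sub_eq_zero.1 (by rw [← this, sub_eq_add_neg])
  have hIperp : ∀ v, ⟪e, v⟫ = 0 → ⟪e, Complex.I • v⟫ = 0 := by
    intro v hv; simp [inner_smul_right, hv]
  have hIor : ∀ v, ⟪e, v⟫ = 0 →
      g (Complex.I • v) = Complex.I • g v ∨ g (Complex.I • v) = -(Complex.I • g v) := by
    intro v hv
    have h1 := hre v (Complex.I • v) hv (hIperp v hv)
    have h2 := habs v (Complex.I • v) hv (hIperp v hv)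
    have hvv : ⟪v, v⟫ = ((‖v‖ ^ 2 : ℝ) : ℂ) := by rw [inner_self_eq_norm_sq_to_K]; simp
    rw [inner_smul_right, hvv] at h1 h2
    have h1' : (⟪g v, g (Complex.I • v)⟫).re = 0 := by
      rw [h1, mul_comm, Complex.re_ofReal_mul]; simp
    have h2' : |(⟪g v, g (Complex.I • v)⟫).im| = ‖v‖ ^ 2 := by
      have h5 : ‖⟪g v, g (Complex.I • v)⟫‖ ^ 2 = |(⟪g v, g (Complex.I • v)⟫).im| ^ 2 := by
        rw [← Complex.normSq_eq_norm_sq, Complex.normSq_apply, h1', sq_abs]; ring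
      rw [← (sq_eq_sq₀ (norm_nonneg _) (abs_nonneg _)).1 h5, h2]; simp
    have hn1 := hnorm v hv
    have hn2 : ‖g (Complex.I • v)‖ = ‖v‖ := by
      rw [hnorm _ (hIperp v hv), norm_smul]; simp
    have hin : (⟪g (Complex.I • v), Complex.I • g v⟫).re = (⟪g v, g (Complex.I • v)⟫).im := by
      have h6 : (⟪g v, g (Complex.I • v)⟫).im = -(⟪g (Complex.I • v), g v⟫).im :=
        inner_im_symm (𝕜 := ℂ) (g v) (g (Complex.I • v))
      rw [inner_smul_right, h6]
      simp
    rcases abs_choice (⟪g v, g (Complex.I • v)⟫).im with h3 | h3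
    · left
      have := @norm_sub_sq ℂ _ _ _ _ (g (Complex.I • v)) (Complex.I • g v)
      rw [RCLike.re_eq_complex_re, hin, ← h3, h2', hn2, norm_smul, hn1, Complex.norm_I] at this
      have : ‖g (Complex.I • v) - Complex.I • g v‖ ^ 2 = 0 := by rw [this]; ring
      exact sub_eq_zero.1 (by simpa using this)
    · right
      have := @norm_add_sq ℂ _ _ _ _ (g (Complex.I • v)) (Complex.I • g v)
      have h4 : (⟪g v, g (Complex.I • v)⟫).im = - ‖v‖ ^ 2 := by linarith
      rw [RCLike.re_eq_complex_re, hin, h4, hn2, norm_smul, hn1, Complex.norm_I] at this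
      have : ‖g (Complex.I • v) + Complex.I • g v‖ ^ 2 = 0 := by rw [this]; ring
      exact eq_neg_of_add_eq_zero_left (by simpa using this)
  have hIall : (∀ v, ⟪e, v⟫ = 0 → g (Complex.I • v) = Complex.I • g v) ∨
      (∀ v, ⟪e, v⟫ = 0 → g (Complex.I • v) = -(Complex.I • g v)) := by
    by_contra! hcon
    obtain ⟨⟨v, hv, hv1⟩, ⟨w, hw, hw1⟩⟩ := hcon
    have hv2 := (hIor v hv).resolve_left hv1
    have hw2 := (hIor w hw).resolve_right hw1
    have hvw : ⟪e, v + w⟫ = 0 := by simp [inner_add_right, hv, hw]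
    have h3 := hIor (v + w) hvw
    rw [smul_add, hgadd _ _ (hIperp v hv) (hIperp w hw), hgadd _ _ hv hw, smul_add] at h3
    rcases h3 with h3 | h3
    · rw [hw2] at h3
      exact hv1 (add_right_cancel h3)
    · rw [hv2, neg_add] at h3
      exact hw1 (add_left_cancel h3)
  have hgsurj : ∀ u, ⟪e', u⟫ = 0 → ∃ v, ⟪e, v⟫ = 0 ∧ g v = u := by
    intro u hu
    obtain ⟨x, c, hc, hx⟩ := hsurj (e' + u)
    have hc0 : c ≠ 0 := by rintro rfl; simp at hc
    have h1 : ‖⟪e, x⟫‖ = 1 := by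
      have h := congrArg (fun z => ‖⟪e', z⟫‖) hx
      simp only [inner_add_right, hee', hu, inner_smul_right, norm_mul, hc, one_mul] at h
      rw [he'def, hT] at h
      simpa using h.symm
    have hx0 : ⟪e, x⟫ ≠ 0 := by intro h; rw [h] at h1; simp at h1
    set v := (⟪e, x⟫)⁻¹ • x - e with hvdef
    have hv : ⟪e, v⟫ = 0 := by
      rw [hvdef, inner_sub_right, inner_smul_right, hee, inv_mul_cancel₀ hx0, sub_self]
    refine ⟨v, hv, ?_⟩

    obtain ⟨d, hd, h⟩ := hG v hv
    have hev : e + v = (⟪e, x⟫)⁻¹ • x := by rw [hvdef]; abel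
    have hd0 : d ≠ 0 := by rintro rfl; simp at hd
    have hnx : ‖e + v‖ = ‖x‖ := by rw [hev, norm_smul, norm_inv, h1, inv_one, one_mul]
    have hip : ‖⟪e' + u, e' + g v⟫‖ = ‖x‖ * ‖x‖ := by
      rw [hx, h, inner_smul_left, inner_smul_right, norm_mul, norm_mul, hT, hev, inner_smul_right,
        norm_mul, inner_self_eq_norm_sq_to_K]
      simp [hc, hd, h1, sq]
    have hxn : ‖x‖ ≠ 0 := by
      intro h; rw [norm_eq_zero.1 h] at hx0; simp at hx0
    have n1 : ‖e' + u‖ = ‖x‖ := by rw [hx, norm_smul, hc, hTn, one_mul]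
    have n2 : ‖e' + g v‖ = ‖x‖ := by rw [h, norm_smul, hd, hTn, one_mul, hnx]
    obtain ⟨r, hr, h2⟩ := (norm_inner_eq_norm_iff (x := e' + u) (y := e' + g v) (𝕜 := ℂ)
      (by rw [← norm_ne_zero_iff, n1]; exact hxn)
      (by rw [← norm_ne_zero_iff, n2]; exact hxn)).1 (by rw [hip, n1, n2])
    have h3 := congrArg (fun z => ⟪e', z⟫) h2
    simp only [inner_add_right, inner_smul_right, hee', hu, hperp v hv, add_zero, mul_one] at h3
    rw [← h3, one_smul] at h2
    exact add_left_cancel h2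
  rcases hIall with hI | hI
  · left
    obtain ⟨U, hU1, hU2⟩ := aux_extend (RingHom.id ℂ) (fun r => rfl) e e' he he' g hperp hnorm
      hgadd hgsm hI hgsurj
    refine ⟨U, fun v hv => ?_⟩
    rw [map_add, hU1, hU2 v hv]
    exact hG v hv
  · right
    obtain ⟨U, hU1, hU2⟩ := aux_extend (starRingEnd ℂ) (fun r => Complex.conj_ofReal r) e e' he he'
      g hperp hnorm hgadd hgsm (by intro v hv; rw [hI v hv]; simp) hgsurj
    refine ⟨U, fun v hv => ?_⟩
    rw [map_add, hU1, hU2 v hv]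
    exact hG v hv
end

section
variable {H : Type*} [NormedAddCommGroup H] [InnerProductSpace ℂ H] [CompleteSpace H]

local notation "⟪" x "," y "⟫" => inner ℂ x y

/-- The operator `|x⟩⟨x|`. -/
noncomputable def rk (x : H) : H →L[ℂ] H := InnerProductSpace.rankOne ℂ x x

/-- Being an effect. -/
def Eff (A : H →L[ℂ] H) : Prop := 0 ≤ A ∧ A ≤ 1

lemma rk_apply (x z : H) : rk x z = ⟪x, z⟫ • x := rfl

lemma rk_proj {x : H} (hx : ‖x‖ = 1) : IsStarProjection (rk x) :=
  InnerProductSpace.isStarProjection_rankOne_self hx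

lemma inner_self_one {x : H} (hx : ‖x‖ = 1) : ⟪x, x⟫ = 1 := by
  rw [inner_self_eq_norm_sq_to_K, hx]; simp

lemma rk_self {x : H} (hx : ‖x‖ = 1) : rk x x = x := by
  rw [rk_apply, inner_self_one hx, one_smul]

lemma rk_ne_zero {x : H} (hx : ‖x‖ = 1) : rk x ≠ 0 := by
  intro h
  have := rk_self hx
  rw [h] at this
  rw [← this] at hx
  simp at hx

lemma rk_sandwich (x : H) (A : H →L[ℂ] H) : rk x * A * rk x = ⟪x, A x⟫ • rk x := by
  ext z
  simp [rk_apply, smul_smul, mul_comm]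

lemma eff_proj {P : H →L[ℂ] H} (h : IsStarProjection P) : Eff P := ⟨h.nonneg, h.le_one⟩

lemma eff_rk {x : H} (hx : ‖x‖ = 1) : Eff (rk x) := eff_proj (rk_proj hx)

lemma eff_zero : Eff (0 : H →L[ℂ] H) := eff_proj (.zero _)
lemma eff_one : Eff (1 : H →L[ℂ] H) := eff_proj (.one _)

lemma eff_sa {A : H →L[ℂ] H} (h : Eff A) : IsSelfAdjoint A := IsSelfAdjoint.of_nonneg h.1

lemma eff_triple {A B : H →L[ℂ] H} (hA : Eff A) (hB : Eff B) : Eff (A * B * A) := by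
  have hs := eff_sa hA
  refine ⟨hs.conjugate_nonneg hB.1, ?_⟩
  have h1 : A * B * A ≤ A * 1 * A := hs.conjugate_le_conjugate hB.2
  refine h1.trans ?_
  rw [mul_one]
  have h0 : 0 ≤ A * A := hs.mul_self_nonneg
  rw [← CStarAlgebra.norm_le_one_iff_of_nonneg _ h0]
  have h2 : ‖A‖ ≤ 1 := (CStarAlgebra.norm_le_one_iff_of_nonneg _ hA.1).2 hA.2
  exact (norm_mul_le _ _).trans (by nlinarith [norm_nonneg A])

lemma eff_sq {A : H →L[ℂ] H} (hA : Eff A) : Eff (A * A) := by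
  simpa using eff_triple hA eff_one

lemma eff_inner {A : H →L[ℂ] H} (hA : Eff A) {x : H} (hx : ‖x‖ = 1) :
    ∃ s : ℝ, 0 ≤ s ∧ s ≤ 1 ∧ ⟪x, A x⟫ = s := by
  have h1 := ((ContinuousLinearMap.nonneg_iff_isPositive A).1 hA.1).inner_nonneg_right x
  have h2 := ((ContinuousLinearMap.le_def A 1).1 hA.2).inner_nonneg_right x
  simp only [sub_apply, one_apply_eq_self, inner_sub_right,
    inner_self_one hx] at h2
  rw [Complex.le_def] at h1 h2
  refine ⟨(⟪x, A x⟫).re, h1.1, ?_, ?_⟩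
  · have := h2.1
    simp at this
    linarith
  · apply Complex.ext
    · simp
    · simpa using h1.2.symm

open ComplexOrder in
lemma eff_smul_one {t : ℝ} (h0 : 0 ≤ t) (h1 : t ≤ 1) : Eff ((t : ℂ) • (1 : H →L[ℂ] H)) := by
  have hp : ∀ s : ℝ, 0 ≤ s → 0 ≤ (s : ℂ) • (1 : H →L[ℂ] H) := fun s hs =>
    smul_nonneg (Complex.zero_le_real.2 hs) zero_le_one
  refine ⟨hp t h0, ?_⟩
  rw [← sub_nonneg]
  have := hp (1 - t) (by linarith)
  simpa [sub_smul] using this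

lemma proj_exists {Q : H →L[ℂ] H} (hQ : IsStarProjection Q) (h0 : Q ≠ 0) :
    ∃ y, ‖y‖ = 1 ∧ Q * rk y * Q = rk y := by
  obtain ⟨z, hz⟩ : ∃ z, Q z ≠ 0 := by
    by_contra! h
    exact h0 (by ext z; simpa using h z)
  have hn : ‖Q z‖ ≠ 0 := norm_ne_zero_iff.2 hz
  set y := ((‖Q z‖⁻¹ : ℝ) : ℂ) • Q z with hy
  have hQQ : ∀ w, Q (Q w) = Q w := fun w => by
    have := congrArg (fun T => T w) hQ.isIdempotentElem.eq
    simpa using this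
  have hQy : Q y = y := by rw [hy, map_smul, hQQ]
  refine ⟨y, by rw [hy, norm_smul]; simp [hn], ?_⟩
  ext w
  have : ⟪y, Q w⟫ = ⟪y, w⟫ := by
    have h := ContinuousLinearMap.adjoint_inner_left Q w y
    rw [← ContinuousLinearMap.star_eq_adjoint, hQ.isSelfAdjoint.star_eq, hQy] at h
    exact h.symm
  simp [rk_apply, this, hQy]

lemma proj_minimal {P : H →L[ℂ] H} (hP : IsStarProjection P) (h0 : P ≠ 0) {x : H} (hx : ‖x‖ = 1)
    (h : rk x * P * rk x = P) : P = rk x := by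
  rw [rk_sandwich] at h
  set c := ⟪x, P x⟫
  have h1 := hP.isIdempotentElem.eq
  rw [← h, smul_mul_smul_comm, (rk_proj hx).isIdempotentElem.eq, ← sub_eq_zero, ← sub_smul,
    smul_eq_zero] at h1
  have h2 := h1.resolve_right (rk_ne_zero hx)
  have h3 : c * (c - 1) = 0 := by rw [← h2]; ring
  rcases mul_eq_zero.1 h3 with h4 | h4
  · exact absurd (by rw [← h, h4, zero_smul]) h0
  · rw [← h, sub_eq_zero.1 h4, one_smul]

lemma rk_eq {z w : H} (hz : ‖z‖ = 1) (hw : ‖w‖ = 1) (h : rk z = rk w) :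
    ∃ c : ℂ, ‖c‖ = 1 ∧ z = c • w := by
  have h1 := rk_self hz
  rw [h, rk_apply] at h1
  refine ⟨⟪w, z⟫, ?_, h1.symm⟩
  have := congrArg norm h1
  rwa [norm_smul, hw, hz, mul_one] at this

/-- The hypotheses on the map. -/
structure JT (φ : (H →L[ℂ] H) → (H →L[ℂ] H)) : Prop where
  maps : ∀ A, Eff A → Eff (φ A)
  inj : ∀ A B, Eff A → Eff B → φ A = φ B → A = B
  surj : ∀ B, Eff B → ∃ A, Eff A ∧ φ A = B
  triple : ∀ A B, Eff A → Eff B → φ (A * B * A) = φ A * φ B * φ A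

namespace JT
variable {φ : (H →L[ℂ] H) → (H →L[ℂ] H)}

lemma zero (h : JT φ) : φ 0 = 0 := by
  obtain ⟨B, hB, hB0⟩ := h.surj 0 eff_zero
  have := h.triple 0 B eff_zero hB
  simpa [hB0] using this

lemma one (h : JT φ) : φ 1 = 1 := by
  obtain ⟨B, hB, hB0⟩ := h.surj 1 eff_one
  have h1 := h.triple 1 B eff_one hB
  rw [one_mul, mul_one, hB0, mul_one] at h1
  have h2 : (φ 1) ^ 2 = 1 ^ 2 := by rw [sq, ← h1, one_pow]
  have h3 := (CFC.sq_eq_sq_iff (φ 1) 1 (h.maps 1 eff_one).1 zero_le_one).1 h2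
  exact h3

lemma sq (h : JT φ) {A : H →L[ℂ] H} (hA : Eff A) : φ (A * A) = φ A * φ A := by
  have := h.triple A 1 hA eff_one
  simpa [h.one] using this

lemma proj_iff (h : JT φ) {A : H →L[ℂ] H} (hA : Eff A) :
    IsStarProjection (φ A) ↔ IsStarProjection A := by
  constructor
  · intro hp
    refine ⟨?_, eff_sa hA⟩
    refine h.inj _ _ (eff_sq hA) hA ?_
    rw [h.sq hA]; exact hp.isIdempotentElem
  · intro hp
    refine ⟨?_, eff_sa (h.maps A hA)⟩
    change φ A * φ A = φ A
    rw [← h.sq hA, hp.isIdempotentElem.eq]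

lemma absorb (h : JT φ) {P Q : H →L[ℂ] H} (hP : Eff P) (hQ : Eff Q) :
    φ Q * φ P * φ Q = φ P ↔ Q * P * Q = P := by
  rw [← h.triple Q P hQ hP]
  exact ⟨fun e => h.inj _ _ (eff_triple hQ hP) hP e, fun e => by rw [e]⟩

lemma ne_zero (h : JT φ) {P : H →L[ℂ] H} (hP : Eff P) : φ P ≠ 0 ↔ P ≠ 0 := by
  rw [not_iff_not]
  constructor
  · intro e
    exact h.inj _ _ hP eff_zero (by rw [e, h.zero])
  · rintro rfl; exact h.zero

lemma rank1 (h : JT φ) {x : H} (hx : ‖x‖ = 1) : ∃ y, ‖y‖ = 1 ∧ φ (rk x) = rk y := by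
  obtain ⟨y, hy, hq⟩ := proj_exists ((h.proj_iff (eff_rk hx)).2 (rk_proj hx))
    ((h.ne_zero (eff_rk hx)).2 (rk_ne_zero hx))
  obtain ⟨B, hB, hBy⟩ := h.surj _ (eff_rk hy)
  refine ⟨y, hy, ?_⟩
  rw [← hBy] at hq
  have h1 := (h.absorb hB (eff_rk hx)).1 hq
  have h2 : IsStarProjection B := (h.proj_iff hB).1 (by rw [hBy]; exact rk_proj hy)
  have h3 : B ≠ 0 := (h.ne_zero hB).1 (by rw [hBy]; exact rk_ne_zero hy)
  rw [← hBy, proj_minimal h2 h3 hx h1]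

lemma rank1_surj (h : JT φ) {y : H} (hy : ‖y‖ = 1) : ∃ x, ‖x‖ = 1 ∧ φ (rk x) = rk y := by
  obtain ⟨B, hB, hBy⟩ := h.surj _ (eff_rk hy)
  have h2 : IsStarProjection B := (h.proj_iff hB).1 (by rw [hBy]; exact rk_proj hy)
  have h3 : B ≠ 0 := (h.ne_zero hB).1 (by rw [hBy]; exact rk_ne_zero hy)
  obtain ⟨x, hx, hq⟩ := proj_exists h2 h3
  refine ⟨x, hx, ?_⟩
  have h1 := (h.absorb (eff_rk hx) hB).2 hq
  rw [hBy] at h1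
  exact proj_minimal ((h.proj_iff (eff_rk hx)).2 (rk_proj hx))
    ((h.ne_zero (eff_rk hx)).2 (rk_ne_zero hx)) hy h1

lemma scalar (h : JT φ) {e : H} (he : ‖e‖ = 1) {t : ℝ} (h0 : 0 ≤ t) (h1 : t ≤ 1) :
    ∃ c : ℝ, 0 ≤ c ∧ φ ((t : ℂ) • 1) = (c : ℂ) • 1 := by
  have ht := eff_smul_one (H := H) h0 h1
  set T := φ ((t : ℂ) • 1) with hT
  have hTe : Eff T := h.maps _ ht
  have hunit : ∀ y : H, ‖y‖ = 1 → ⟪y, T y⟫ • T y = ⟪y, T (T y)⟫ • y := by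
    intro y hy
    obtain ⟨x, hx, hxy⟩ := h.rank1_surj hy
    have e1 := h.triple _ _ ht (eff_rk hx)
    have e2 := h.triple _ _ (eff_rk hx) (eff_sq ht)
    rw [h.sq ht] at e2
    have e3 : ((t : ℂ) • (1 : H →L[ℂ] H)) * rk x * ((t : ℂ) • 1) =
        rk x * (((t : ℂ) • 1) * ((t : ℂ) • 1)) * rk x := by
      simp [(rk_proj hx).isIdempotentElem.eq, smul_smul]
    rw [e3, e2, ← hT, hxy] at e1
    have e4 := congrArg (fun S => S y) e1
    simp only [mul_apply_eq_comp, rk_self hy, rk_apply, map_smul] at e4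
    exact e4.symm
  obtain ⟨a, ha⟩ := LinearMap.exists_eq_smul_id_of_forall_notLinearIndependent
    (f := (T : H →ₗ[ℂ] H)) (by
      intro v hli
      rw [LinearIndependent.pair_iff] at hli
      have hv : v ≠ 0 := by
        rintro rfl
        have := hli 1 0 (by simp)
        simp at this
      have hn : (‖v‖ : ℂ) ≠ 0 := by exact_mod_cast norm_ne_zero_iff.2 hv
      obtain ⟨r, y, hy1, rfl⟩ : ∃ (r : ℂ) (y : H), ‖y‖ = 1 ∧ v = r • y :=
        ⟨(‖v‖ : ℂ), (‖v‖ : ℂ)⁻¹ • v, by rw [norm_smul]; simp [hv],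
          by rw [smul_smul, mul_inv_cancel₀ hn, one_smul]⟩
      have e1 := hunit y hy1
      have e2 := hli (-⟪y, T (T y)⟫) ⟪y, T y⟫ (by
        rw [ContinuousLinearMap.coe_coe]
        rw [map_smul, smul_comm _ r y, smul_comm _ r (T y), e1]
        rw [← smul_add, neg_smul, neg_add_cancel, smul_zero])
      have e3 : ⟪T y, T y⟫ = 0 := by
        have h' := ContinuousLinearMap.adjoint_inner_left T (T y) y
        rw [← ContinuousLinearMap.star_eq_adjoint, (eff_sa hTe).star_eq] at h'
        rw [h', ← neg_eq_zero]; exact e2.1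
      have e4 : T y = 0 := inner_self_eq_zero.1 e3
      have e5 : T (r • y) = 0 := by rw [map_smul, e4, smul_zero]
      have := hli 0 1 (by rw [ContinuousLinearMap.coe_coe, e5]; simp)
      simp at this)
  have ha' : ∀ z, T z = a • z := fun z => by
    have := congrArg (fun S => S z) ha
    simpa using this
  obtain ⟨s, hs0, hs1, hs⟩ := eff_inner hTe he
  rw [ha', inner_smul_right, inner_self_one he, mul_one] at hs
  refine ⟨s, hs0, ?_⟩
  ext z
  rw [ha', hs]; simp

/-- Orthogonal additivity on rank one projections. -/
lemma add (h : JT φ) {x y : H} (hx : ‖x‖ = 1) (hy : ‖y‖ = 1) (hxy : ⟪x, y⟫ = 0) :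
    φ (rk x + rk y) = φ (rk x) + φ (rk y) ∧ IsStarProjection (rk x + rk y) := by
  have hyx : ⟪y, x⟫ = 0 := by rw [← inner_conj_symm, hxy, map_zero]
  have m1 : rk x * rk y = 0 := by ext z; simp [rk_apply, hxy]
  have m2 : rk y * rk x = 0 := by ext z; simp [rk_apply, hyx]
  have hp := (rk_proj hx).add (rk_proj hy) m1
  have ix := (rk_proj hx).isIdempotentElem.eq
  have iy := (rk_proj hy).isIdempotentElem.eq
  refine ⟨?_, hp⟩
  have hR := eff_proj hp
  obtain ⟨x', hx', ex⟩ := h.rank1 hx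
  obtain ⟨y', hy', ey⟩ := h.rank1 hy
  have ix' := (rk_proj hx').isIdempotentElem.eq
  have iy' := (rk_proj hy').isIdempotentElem.eq
  have o1 : ⟪x', y'⟫ = 0 := by
    have e1 := h.triple _ _ (eff_rk hx) (eff_rk hy)
    rw [m1, zero_mul, h.zero, ex, ey, rk_sandwich] at e1
    have e2 := (smul_eq_zero.1 e1.symm).resolve_right (rk_ne_zero hx')
    rw [rk_apply, inner_smul_right, ← inner_conj_symm, mul_comm] at e2
    have := mul_self_eq_zero.1 (show ‖⟪x', y'⟫‖ * ‖⟪x', y'⟫‖ = 0 by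
      have := congrArg norm e2
      rw [norm_mul, norm_zero, RCLike.norm_conj] at this
      exact this)
    exact norm_eq_zero.1 this
  have o2 : ⟪y', x'⟫ = 0 := by rw [← inner_conj_symm, o1, map_zero]
  have n1 : rk x' * rk y' = 0 := by ext z; simp [rk_apply, o1]
  have n2 : rk y' * rk x' = 0 := by ext z; simp [rk_apply, o2]
  have hS := (rk_proj hx').add (rk_proj hy') n1
  obtain ⟨S, hSe, hSφ⟩ := h.surj _ (eff_proj hS)

  have a1 : S * rk x * S = rk x := by
    rw [← h.absorb (eff_rk hx) hSe, hSφ, ex]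
    simp [add_mul, mul_add, ix', n2, n1]
  have a2 : S * rk y * S = rk y := by
    rw [← h.absorb (eff_rk hy) hSe, hSφ, ey]
    simp [add_mul, mul_add, iy', n2, n1]
  have a3 : S * (rk x + rk y) * S = rk x + rk y := by rw [mul_add, add_mul, a1, a2]
  rw [← h.absorb hR hSe, hSφ] at a3

  set R := φ (rk x + rk y) with hRdef
  have hRp : IsStarProjection R := (h.proj_iff hR).2 hp
  have b1 : R * rk x' * R = rk x' := by
    rw [← ex, h.absorb (eff_rk hx) hR]
    simp [add_mul, mul_add, ix, m2, m1]
  have b2 : R * rk y' * R = rk y' := by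
    rw [← ey, h.absorb (eff_rk hy) hR]
    simp [add_mul, mul_add, iy, m2, m1]
  have b3 : R * (rk x' + rk y') * R = rk x' + rk y' := by rw [mul_add, add_mul, b1, b2]
  rw [ex, ey]
  set Z := rk x' + rk y'
  have c1 : Z * R = R := by
    rw [← a3, ← mul_assoc, ← mul_assoc, hS.isIdempotentElem.eq]
  have c2 : Z * R = Z := by
    rw [← b3, mul_assoc, hRp.isIdempotentElem.eq]
  rw [← c1, c2]

lemma expect (h : JT φ) {e : H} (he : ‖e‖ = 1) {e₂ : H} (he₂ : ‖e₂‖ = 1) (hee : ⟪e, e₂⟫ = 0)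
    {x y : H} (hx : ‖x‖ = 1) (hy : ‖y‖ = 1) (hxy : φ (rk x) = rk y) {A : H →L[ℂ] H} (hA : Eff A) :
    ⟪y, φ A y⟫ = ⟪x, A x⟫ := by
  have hs : ∀ t : ℝ, ∃ c : ℝ, 0 ≤ t → t ≤ 1 → 0 ≤ c ∧ φ ((t : ℂ) • 1) = (c : ℂ) • 1 := by
    intro t
    by_cases ht : 0 ≤ t ∧ t ≤ 1
    · obtain ⟨c, hc⟩ := h.scalar he ht.1 ht.2
      exact ⟨c, fun _ _ => hc⟩
    · exact ⟨0, fun h0 h1 => absurd ⟨h0, h1⟩ ht⟩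
  choose f hf using hs
  have hinj : ∀ a b : ℝ, (a : ℂ) • (1 : H →L[ℂ] H) = (b : ℂ) • 1 → a = b := by
    intro a b hab
    have := congrArg (fun S => ⟪e, S e⟫) hab
    simp only [smul_apply, one_apply_eq_self, inner_smul_right,
      inner_self_one he, mul_one] at this
    exact_mod_cast this
  have key : ∀ {x y : H}, ‖x‖ = 1 → ‖y‖ = 1 → φ (rk x) = rk y → ∀ {A : H →L[ℂ] H}, Eff A →
      ∀ s : ℝ, ⟪x, A x⟫ = s → ⟪y, φ A y⟫ = f s := by
    intro x y hx hy hxy A hA s hsA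
    obtain ⟨s', h0, h1, hs'⟩ := eff_inner hA hx
    have hss : s = s' := by rw [hsA] at hs'; exact_mod_cast hs'
    subst hss
    have e1 := h.triple _ _ (eff_rk hx) hA
    have e2 := h.triple _ _ (eff_rk hx) (eff_smul_one h0 h1)
    have e3 : rk x * A * rk x = rk x * ((s : ℂ) • 1) * rk x := by
      rw [rk_sandwich, hsA]
      simp [(rk_proj hx).isIdempotentElem.eq]
    rw [← e3, e1, (hf s h0 h1).2, hxy, rk_sandwich] at e2
    have e4 := congrArg (fun S => ⟪y, S y⟫) e2
    simpa [rk_self hy, inner_self_one hy, inner_smul_right, hy] using e4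
  have f1 : f 1 = 1 := by
    have := (hf 1 zero_le_one le_rfl).2
    simp only [Complex.ofReal_one, one_smul] at this
    rw [h.one] at this
    exact hinj _ _ (by rw [← this]; simp)
  have fm3 : ∀ s t, 0 ≤ s → s ≤ 1 → 0 ≤ t → t ≤ 1 → f (s * s * t) = f s * f s * f t := by
    intro s t hs0 hs1 ht0 ht1
    have e1 := h.triple _ _ (eff_smul_one hs0 hs1) (eff_smul_one ht0 ht1)
    have e2 : ((s : ℂ) • (1 : H →L[ℂ] H)) * ((t : ℂ) • 1) * ((s : ℂ) • 1) =
        ((s * s * t : ℝ) : ℂ) • 1 := by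
      simp only [smul_mul_smul_comm, mul_one]
      congr 1; push_cast; ring
    have hss : s * s ≤ 1 := by nlinarith
    have hsst : s * s * t ≤ 1 := by nlinarith [mul_self_nonneg s]
    rw [e2, (hf _ (by positivity) hsst).2, (hf s hs0 hs1).2, (hf t ht0 ht1).2] at e1
    apply hinj
    rw [e1]
    simp only [smul_mul_smul_comm, mul_one]
    congr 1; push_cast; ring
  have fm : ∀ s t, 0 ≤ s → s ≤ 1 → 0 ≤ t → t ≤ 1 → f (s * t) = f s * f t := by
    intro s t hs0 hs1 ht0 ht1
    have r0 := Real.sqrt_nonneg s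
    have r1 : √s ≤ 1 := Real.sqrt_le_one.2 hs1
    have rr := Real.mul_self_sqrt hs0
    have e1 := fm3 (√s) t r0 r1 ht0 ht1
    have e2 := fm3 (√s) 1 r0 r1 zero_le_one le_rfl
    rw [rr] at e1 e2
    rw [mul_one, f1, mul_one] at e2
    rw [e1, e2]
  have fadd : ∀ t, 0 ≤ t → t ≤ 1 → f t + f (1 - t) = 1 := by
    intro t ht0 ht1
    have ht1' : 0 ≤ 1 - t := by linarith
    have hee2 : ⟪e₂, e⟫ = 0 := by rw [← inner_conj_symm, hee, map_zero]
    set q := ((√t : ℝ) : ℂ) • e + ((√(1 - t) : ℝ) : ℂ) • e₂ with hq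
    have q1 : ⟪e, q⟫ = (√t : ℝ) := by
      rw [hq, inner_add_right, inner_smul_right, inner_smul_right, hee, inner_self_one he]; simp
    have q2 : ⟪e₂, q⟫ = (√(1 - t) : ℝ) := by
      rw [hq, inner_add_right, inner_smul_right, inner_smul_right, hee2, inner_self_one he₂]; simp
    have q1' : ⟪q, e⟫ = (√t : ℝ) := by rw [← inner_conj_symm, q1, Complex.conj_ofReal]
    have q2' : ⟪q, e₂⟫ = (√(1 - t) : ℝ) := by rw [← inner_conj_symm, q2, Complex.conj_ofReal]
    have hqq : ⟪q, q⟫ = 1 := by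
      conv_lhs => rw [hq]
      rw [← hq, inner_add_right, inner_smul_right, inner_smul_right, q1', q2',
        ← Complex.ofReal_mul, ← Complex.ofReal_mul, Real.mul_self_sqrt ht0, Real.mul_self_sqrt ht1']
      push_cast; ring
    have hqn : ‖q‖ = 1 := by
      have := norm_sq_eq_re_inner (𝕜 := ℂ) q
      rw [hqq] at this
      simp only [RCLike.re_eq_complex_re, Complex.one_re] at this
      exact (pow_eq_one_iff_of_nonneg (norm_nonneg _) two_ne_zero).1 this
    obtain ⟨q', hq', eq'⟩ := h.rank1 hqn
    obtain ⟨hadd, hproj⟩ := h.add he he₂ hee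
    have k1 := key hqn hq' eq' (eff_rk he) t (by
      rw [rk_apply, inner_smul_right, q1, q1', ← Complex.ofReal_mul, Real.mul_self_sqrt ht0])
    have k2 := key hqn hq' eq' (eff_rk he₂) (1 - t) (by
      rw [rk_apply, inner_smul_right, q2, q2', ← Complex.ofReal_mul, Real.mul_self_sqrt ht1'])
    have k3 := key hqn hq' eq' (eff_proj hproj) 1 (by
      rw [add_apply, inner_add_right, rk_apply, rk_apply, inner_smul_right,
        inner_smul_right, q1, q1', q2, q2',
        ← Complex.ofReal_mul, ← Complex.ofReal_mul, Real.mul_self_sqrt ht0, Real.mul_self_sqrt ht1']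
      push_cast; ring)
    rw [hadd, add_apply, inner_add_right, k1, k2, f1] at k3
    exact_mod_cast k3
  obtain ⟨s, hs0, hs1, hsA⟩ := eff_inner hA hx
  rw [key hx hy hxy hA s hsA, hsA,
    aux_f_id f (fun t h0 h1 => (hf t h0 h1).1) f1 fm fadd s hs0 hs1]

lemma lift (h : JT φ) {e : H} (he : ‖e‖ = 1) {e₂ : H} (he₂ : ‖e₂‖ = 1) (hee : ⟪e, e₂⟫ = 0) :
    ∃ T : H → H, (∀ x y, ‖⟪T x, T y⟫‖ = ‖⟪x, y⟫‖) ∧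
      (∀ y, ∃ x, ∃ c : ℂ, ‖c‖ = 1 ∧ y = c • T x) ∧
      (∀ A, Eff A → ∀ x, ⟪T x, φ A (T x)⟫ = ⟪x, A x⟫) := by
  have hs : ∀ x : H, ∃ y, ‖x‖ = 1 → ‖y‖ = 1 ∧ φ (rk x) = rk y := by
    intro x
    by_cases hx : ‖x‖ = 1
    · obtain ⟨y, hy⟩ := h.rank1 hx
      exact ⟨y, fun _ => hy⟩
    · exact ⟨0, fun h' => absurd h' hx⟩
  choose T₀ hT₀ using hs
  have hu : ∀ x y : H, ‖x‖ = 1 → ‖y‖ = 1 → ‖⟪T₀ x, T₀ y⟫‖ = ‖⟪x, y⟫‖ := by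
    intro x y hx hy
    have e1 := h.expect he he₂ hee hx (hT₀ x hx).1 (hT₀ x hx).2 (eff_rk hy)
    rw [(hT₀ y hy).2, rk_apply, rk_apply, inner_smul_right, inner_smul_right] at e1
    have e2 := congrArg norm e1
    rw [norm_mul, norm_mul, norm_inner_symm (T₀ y), norm_inner_symm y] at e2
    exact (mul_self_inj (norm_nonneg _) (norm_nonneg _)).1 e2
  have hdec : ∀ x : H, x ≠ 0 → ∃ u : H, ‖u‖ = 1 ∧ u = (‖x‖ : ℂ)⁻¹ • x ∧ x = (‖x‖ : ℂ) • u := by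
    intro x hx
    have hn : (‖x‖ : ℂ) ≠ 0 := by exact_mod_cast norm_ne_zero_iff.2 hx
    exact ⟨_, by rw [norm_smul]; simp [hx], rfl, by rw [smul_smul, mul_inv_cancel₀ hn, one_smul]⟩
  refine ⟨fun x => (‖x‖ : ℂ) • T₀ ((‖x‖ : ℂ)⁻¹ • x), ?_, ?_, ?_⟩
  · intro x y
    by_cases hx : x = 0
    · simp [hx]
    by_cases hy : y = 0
    · simp [hy]
    obtain ⟨u, hu1, hu2, hu3⟩ := hdec x hx
    obtain ⟨w, hw1, hw2, hw3⟩ := hdec y hy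
    simp only
    rw [← hu2, ← hw2]
    conv_rhs => rw [hu3, hw3]
    simp only [inner_smul_left, inner_smul_right, norm_mul, hu u w hu1 hw1]
  · intro y
    by_cases hy : y = 0
    · exact ⟨0, 1, by simp, by simp [hy]⟩
    obtain ⟨z, hz1, hz2, hz3⟩ := hdec y hy
    obtain ⟨x, hx, hxz⟩ := h.rank1_surj hz1
    have hn : (‖y‖ : ℂ) ≠ 0 := by exact_mod_cast norm_ne_zero_iff.2 hy
    obtain ⟨c, hc, hcz⟩ := rk_eq hz1 (hT₀ x hx).1 (by rw [← hxz, (hT₀ x hx).2])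
    refine ⟨(‖y‖ : ℂ) • x, c, hc, ?_⟩
    have hnn : ‖(‖y‖ : ℂ) • x‖ = ‖y‖ := by rw [norm_smul, hx]; simp
    simp only
    rw [hnn, smul_smul (_⁻¹), inv_mul_cancel₀ hn, one_smul, smul_comm, ← hcz]
    exact hz3
  · intro A hA x
    by_cases hx : x = 0
    · simp [hx]
    obtain ⟨u, hu1, hu2, hu3⟩ := hdec x hx
    simp only
    rw [← hu2]
    conv_rhs => rw [hu3]
    simp only [map_smul, inner_smul_left, inner_smul_right,
      h.expect he he₂ hee hu1 (hT₀ u hu1).1 (hT₀ u hu1).2 hA]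

end JT

lemma aux_q {e : H} (he : ‖e‖ = 1) (q : H → ℂ) (hq1 : ∀ (a : ℂ) x, q x = 0 → q (a • x) = 0)
    (hq2 : ∀ x y, q (x + y) + q (x - y) = 2 * q x + 2 * q y)
    (hq3 : ∀ v, ⟪e, v⟫ = 0 → q (e + v) = 0) : ∀ x, q x = 0 := by
  have hne : ∀ x, ⟪e, x⟫ ≠ 0 → q x = 0 := by
    intro x hx
    have h1 := hq3 ((⟪e, x⟫)⁻¹ • x - e) (by
      rw [inner_sub_right, inner_smul_right, inner_self_one he, inv_mul_cancel₀ hx, sub_self])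
    rw [add_sub_cancel] at h1
    have h2 := hq1 ⟪e, x⟫ _ h1
    rwa [smul_smul, mul_inv_cancel₀ hx, one_smul] at h2
  intro x
  by_cases hx : ⟪e, x⟫ = 0
  · have h1 := hq2 x e
    rw [hne (x + e) (by rw [inner_add_right, hx, inner_self_one he]; simp),
      hne (x - e) (by rw [inner_sub_right, hx, inner_self_one he]; simp),
      hne e (by rw [inner_self_one he]; simp)] at h1
    simpa using h1
  · exact hne x hx

lemma anti_inner (V : H ≃ₛₗᵢ[starRingEnd ℂ] H) (x y : H) : ⟪V x, V y⟫ = conj ⟪x, y⟫ := by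
  have hre : ∀ x y : H, (⟪V x, V y⟫).re = (⟪x, y⟫).re := by
    intro x y
    have h1 := @norm_add_sq ℂ _ _ _ _ (V x) (V y)
    have h2 := @norm_add_sq ℂ _ _ _ _ x y
    rw [← map_add, V.norm_map, V.norm_map, V.norm_map, h2] at h1
    simp only [RCLike.re_eq_complex_re] at h1
    linarith
  apply Complex.ext
  · rw [Complex.conj_re, hre]
  · have := hre x (Complex.I • y)
    rw [V.map_smulₛₗ, inner_smul_right, inner_smul_right] at this
    simp at this
    rw [Complex.conj_im]
    linarith
end

/-- If `dim H ≥ 3`, every bijection of the Hilbert space effect algebra `[0, I]` that is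
multiplicative with respect to the Jordan triple product `(A, B) ↦ ABA` is of the form
`A ↦ U A U*` for a unitary or antiunitary operator `U`. -/
theorem jordan_triple_bijection_of_effects
    {H : Type*} [NormedAddCommGroup H] [InnerProductSpace ℂ H] [CompleteSpace H]
    (hdim : 3 ≤ Module.rank ℂ H)
    (φ : (H →L[ℂ] H) → (H →L[ℂ] H))
    (hbij : Set.BijOn φ {A : H →L[ℂ] H | 0 ≤ A ∧ A ≤ 1} {A : H →L[ℂ] H | 0 ≤ A ∧ A ≤ 1})
    (htriple : ∀ A : H →L[ℂ] H, 0 ≤ A → A ≤ 1 → ∀ B : H →L[ℂ] H, 0 ≤ B → B ≤ 1 →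
      φ (A * B * A) = φ A * φ B * φ A) :
    (∃ U : H →L[ℂ] H, U ∈ unitary (H →L[ℂ] H) ∧
      ∀ A : H →L[ℂ] H, 0 ≤ A → A ≤ 1 → φ A = U * A * star U) ∨
    (∃ V : H ≃ₛₗᵢ[starRingEnd ℂ] H,
      ∀ A : H →L[ℂ] H, 0 ≤ A → A ≤ 1 → ∀ x : H, φ A x = V (A (V.symm x))) := by
  have h : JT φ :=
    { maps := fun A hA => hbij.mapsTo hA
      inj := fun A B hA hB e => hbij.injOn hA hB e
      surj := fun B hB => hbij.surjOn hB
      triple := fun A B hA hB => htriple A hA.1 hA.2 B hB.1 hB.2 }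
  have hlt : 1 < Module.rank ℂ H := lt_of_lt_of_le (by norm_num) hdim
  have : Nontrivial H := by
    rw [← rank_pos_iff_nontrivial (R := ℂ)]
    exact lt_trans zero_lt_one hlt
  obtain ⟨e, he⟩ := exists_norm_eq H zero_le_one
  obtain ⟨w, hw⟩ := exists_linearIndependent_pair_of_one_lt_rank hlt
    (x := e) (by rw [← norm_ne_zero_iff, he]; exact one_ne_zero)
  obtain ⟨e₂, he₂, hee⟩ : ∃ e₂ : H, ‖e₂‖ = 1 ∧ inner ℂ e e₂ = 0 := by
    set d := w - (inner ℂ e w : ℂ) • e with hd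
    have hd0 : d ≠ 0 := by
      intro h0
      rw [LinearIndependent.pair_iff] at hw
      have := hw (-(inner ℂ e w : ℂ)) 1 (by rw [one_smul, neg_smul, ← h0, hd]; abel)
      simp at this
    refine ⟨(‖d‖ : ℂ)⁻¹ • d, by rw [norm_smul]; simp [hd0], ?_⟩
    rw [inner_smul_right, hd, inner_sub_right, inner_smul_right, inner_self_one he, mul_one,
      sub_self, mul_zero]
  obtain ⟨T, hT1, hT2, hT3⟩ := h.lift he he₂ hee
  have hphase : ∀ (c : ℂ) (y z : H) (S : H →L[ℂ] H), ‖c‖ = 1 → y = c • z →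
      inner ℂ y (S y) = inner ℂ z (S z) := by
    intro c y z S hc hy
    rw [hy, map_smul, inner_smul_left, inner_smul_right, ← mul_assoc, ← Complex.normSq_eq_conj_mul_self,
      Complex.normSq_eq_norm_sq, hc]
    simp
  rcases aux_wigner e he T hT1 hT2 with ⟨U, hU⟩ | ⟨V, hV⟩
  · left
    have hmain : ∀ A, Eff A → ∀ x, φ A (U x) = U (A x) := by
      intro A hA
      have hq := aux_q he (fun x => inner ℂ (U x) (φ A (U x)) - inner ℂ x (A x))
        (by
          intro a x hx
          have hx' := sub_eq_zero.1 hx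
          simp only [map_smul, inner_smul_left, inner_smul_right, hx', sub_self])
        (by
          intro x y
          simp only [map_add, map_sub, inner_add_left, inner_add_right, inner_sub_left,
            inner_sub_right]
          ring)
        (by
          intro v hv
          obtain ⟨c, hc, hcv⟩ := hU v hv
          rw [hphase c _ _ (φ A) hc hcv, hT3 A hA, sub_self])
      let B : H →ₗ[ℂ] H := U.symm.toLinearEquiv.toLinearMap ∘ₗ (φ A).toLinearMap ∘ₗ
        U.toLinearEquiv.toLinearMap
      have hB : ∀ x, U (B x) = φ A (U x) := fun x => U.apply_symm_apply _
      have hBA : B = (A : H →ₗ[ℂ] H) := by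
        rw [← ext_inner_map]
        intro x
        have h1 := sub_eq_zero.1 (hq x)
        rw [← hB, U.inner_map_map] at h1
        rw [← inner_conj_symm, h1, inner_conj_symm]
        rfl
      intro x
      rw [← hB, hBA]; rfl
    refine ⟨(Unitary.linearIsometryEquiv.symm U : unitary (H →L[ℂ] H)), Subtype.property _, ?_⟩
    intro A h0 h1
    set W := Unitary.linearIsometryEquiv.symm U with hW
    have hWU : ∀ x, (W : H →L[ℂ] H) x = U x := fun x => by
      rw [hW, Unitary.coe_symm_linearIsometryEquiv_apply]; rfl
    have hcomm : φ A * (W : H →L[ℂ] H) = W * A := by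
      ext x
      simp only [mul_apply_eq_comp, hWU]
      exact hmain A ⟨h0, h1⟩ x
    rw [← hcomm, mul_assoc, Unitary.mul_star_self_of_mem W.2, mul_one]
  · right
    refine ⟨V, fun A h0 h1 => ?_⟩
    have hA : Eff A := ⟨h0, h1⟩
    have hq := aux_q he (fun x => inner ℂ (V x) (φ A (V x)) - inner ℂ x (A x))
      (by
        intro a x hx
        have hx' := sub_eq_zero.1 hx
        simp only [LinearIsometryEquiv.map_smulₛₗ, map_smul, inner_smul_left, inner_smul_right, hx',
          Complex.conj_conj]
        ring)
      (by
        intro x y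
        simp only [map_add, map_sub, inner_add_left, inner_add_right, inner_sub_left,
          inner_sub_right]
        ring)
      (by
        intro v hv
        obtain ⟨c, hc, hcv⟩ := hV v hv
        rw [hphase c _ _ (φ A) hc hcv, hT3 A hA, sub_self])
    let B : H →ₗ[ℂ] H :=
      { toFun := fun x => V.symm (φ A (V x))
        map_add' := fun x y => by simp
        map_smul' := fun a x => by simp [LinearIsometryEquiv.map_smulₛₗ] }
    have hB : ∀ x, V (B x) = φ A (V x) := fun x => V.apply_symm_apply _
    have hBA : B = (A : H →ₗ[ℂ] H) := by
      rw [← ext_inner_map]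
      intro x
      have h1 := sub_eq_zero.1 (hq x)
      rw [← hB, anti_inner, inner_conj_symm] at h1
      rw [h1]
      have h' := ContinuousLinearMap.adjoint_inner_left A x x
      rw [← ContinuousLinearMap.star_eq_adjoint, (eff_sa hA).star_eq] at h'
      exact h'.symm
    intro x
    have := hB (V.symm x)
    rw [V.apply_symm_apply, hBA] at this
    exact this.symm
end
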